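/- Let γ be a smooth 1-form on a neighborhood of 0 in ℝ^{2n} with γ(0)=0 and dγ = ω₀, the standard symplectic form, and let X be its associated conformal vector field, ω₀(X(x), ·) = γ_x. Assume DX(0) is hyperbolic (no eigenvalue has zero real part). Then there exists a local smooth diffeomorphism φ of ℝ^{2n} with φ(0)=0 such that: (a) φ preserves the symplectic form, i.e. ω₀(Dφ(x)u, Dφ(x)v) = ω₀(u,v) for all x near 0 and all u,v; and (b) the transported vector field Y, defined by Dφ(x)·Y(x) = X(φ(x)), is in Poincaré–Dulac normal form: if S denotes the semisimple part in the Jordan–Chevalley decomposition of the matrix DY(0), then DY(x)(Sx) = S·Y(x) for all x near 0 (i.e. Y commutes with the linear vector field x ↦ Sx). Consequently φ*γ is the contraction of ω₀ with a vector field commuting with its own semisimple linear part. -/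

import Mathlib

open scoped Topology

section Preliminaries

open scoped ContDiff

section FixedPoint

variable {Q C : Type*} [NormedAddCommGroup Q] [NormedSpace ℝ Q] [CompleteSpace Q]
  [NormedAddCommGroup C] [NormedSpace ℝ C] [CompleteSpace C]

/-- A family of fixed points of uniformly contracting maps depends smoothly on the parameter. -/
theorem contDiffAt_fixedPoint {P : Q × C → C} (hP : ContDiff ℝ ∞ P) {κ : NNReal} (hκ : κ < 1)
    {q₀ : Q} (hlip : ∀ᶠ q in 𝓝 q₀, LipschitzWith κ (fun c => P (q, c)))
    {f : Q → C} (hf : ∀ q, P (q, f q) = f q) : ContDiffAt ℝ ∞ f q₀ := by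
  set G : Q × C → C := fun p => p.2 - P p with hG
  have hGs : ContDiff ℝ ∞ G := contDiff_snd.sub hP
  have hGd : fderiv ℝ G (q₀, f q₀) ∘L .inr ℝ Q C =
      1 - fderiv ℝ (fun c => P (q₀, c)) (f q₀) := by
    have h1 : HasFDerivAt (fun c => G (q₀, c))
        (fderiv ℝ G (q₀, f q₀) ∘L .inr ℝ Q C) (f q₀) := by
      have := (hGs.differentiable (by simp)).differentiableAt (x := (q₀, f q₀)) |>.hasFDerivAt
      exact HasFDerivAt.comp (f q₀) this (hasFDerivAt_prodMk_right q₀ (f q₀))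
    have h2 : HasFDerivAt (fun c => G (q₀, c))
        (1 - fderiv ℝ (fun c => P (q₀, c)) (f q₀)) (f q₀) := by
      have hd : DifferentiableAt ℝ (fun c => P (q₀, c)) (f q₀) :=
        ((hP.comp (contDiff_prodMk_right q₀)).differentiable (by simp)).differentiableAt
      exact (hasFDerivAt_id (f q₀)).sub hd.hasFDerivAt
    exact h1.unique h2
  have hn : ‖fderiv ℝ (fun c => P (q₀, c)) (f q₀)‖ < 1 :=
    lt_of_le_of_lt (norm_fderiv_le_of_lipschitz ℝ hlip.self_of_nhds) (by exact_mod_cast hκ)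
  have hinv : (fderiv ℝ G (q₀, f q₀) ∘L .inr ℝ Q C).IsInvertible := by
    rw [hGd]
    have hu : IsUnit (1 - fderiv ℝ (fun c => P (q₀, c)) (f q₀)) :=
      isUnit_one_sub_of_norm_lt_one hn
    obtain ⟨e, he⟩ := hu
    exact ⟨ContinuousLinearEquiv.unitsEquiv ℝ C e, he⟩
  have hc := hGs.contDiffAt (x := (q₀, f q₀))
  have hψ := hc.contDiffAt_implicitFunction (by simp) hinv
  refine hψ.congr_of_eventuallyEq ?_
  filter_upwards [hc.eventually_apply_implicitFunction (by simp) hinv, hlip] with q hq hl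
  set ψ := hc.implicitFunction (by simp) hinv q
  have h1 : P (q, ψ) = ψ := by
    have : ψ - P (q, ψ) = f q₀ - P (q₀, f q₀) := hq
    rw [hf q₀, sub_self, sub_eq_zero] at this
    exact this.symm
  have h2 := hl.dist_le_mul (f q) ψ
  rw [hf q, h1] at h2
  have : (κ : ℝ) < 1 := by exact_mod_cast hκ
  have h3 : dist (f q) ψ ≤ 0 := by nlinarith [dist_nonneg (x := f q) (y := ψ)]
  exact dist_le_zero.1 h3

end FixedPoint

section Nemytskii

variable {I : Type*} [TopologicalSpace I] [CompactSpace I]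

/-- Pointwise application of a continuous family of operators to a continuous family of vectors. -/
noncomputable def ContinuousMap.pointwiseApplyL (I E F : Type*) [TopologicalSpace I]
    [CompactSpace I] [NormedAddCommGroup E] [NormedSpace ℝ E] [NormedAddCommGroup F]
    [NormedSpace ℝ F] : C(I, E →L[ℝ] F) →L[ℝ] C(I, E) →L[ℝ] C(I, F) :=
  LinearMap.mkContinuous₂
    (LinearMap.mk₂ ℝ (fun (a : C(I, E →L[ℝ] F)) (h : C(I, E)) =>
        (⟨fun s => a s (h s), by fun_prop⟩ : C(I, F)))
      (fun _ _ _ => by ext; simp) (fun _ _ _ => by ext; simp) (fun _ _ _ => by ext; simp)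
      (fun _ _ _ => by ext; simp)) 1
    (fun a h => by
      rw [one_mul]
      refine (ContinuousMap.norm_le _ (mul_nonneg (norm_nonneg a) (norm_nonneg h))).2 fun s => ?_
      exact (a s).le_of_opNorm_le_of_le (a.norm_coe_le_norm s) (h.norm_coe_le_norm s))

theorem ContinuousMap.pointwiseApplyL_apply {E F : Type*}
    [NormedAddCommGroup E] [NormedSpace ℝ E] [NormedAddCommGroup F] [NormedSpace ℝ F]
    (a : C(I, E →L[ℝ] F)) (h : C(I, E)) (s : I) :
    ContinuousMap.pointwiseApplyL I E F a h s = a s (h s) := rfl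

/-- The superposition operator `u ↦ X ∘ u` on continuous functions. -/
def ContinuousMap.superpose {E F : Type*} [TopologicalSpace E] [TopologicalSpace F] {X : E → F}
    (hX : Continuous X) (u : C(I, E)) : C(I, F) := ⟨fun s => X (u s), hX.comp u.continuous⟩

theorem ContinuousMap.hasFDerivAt_superpose {E F : Type*}
    [NormedAddCommGroup E] [NormedSpace ℝ E] [NormedAddCommGroup F] [NormedSpace ℝ F]
    {X : E → F} {X' : E → E →L[ℝ] F} (hX : Continuous X) (hX' : Continuous X')
    (hd : ∀ x, HasFDerivAt X (X' x) x) (u : C(I, E)) :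
    HasFDerivAt (ContinuousMap.superpose hX)
      (ContinuousMap.pointwiseApplyL I E F (ContinuousMap.superpose hX' u)) u := by
  rw [hasFDerivAt_iff_isLittleO_nhds_zero, Asymptotics.isLittleO_iff]
  intro ε hε
  have hK : IsCompact (Set.range u) := isCompact_range u.continuous
  have := hK.uniformContinuousAt_of_continuousAt X' (fun a _ => hX'.continuousAt)
    (Metric.dist_mem_uniformity hε)
  obtain ⟨δ, hδ, hδ'⟩ := Metric.mem_uniformity_dist.1 this
  filter_upwards [Metric.ball_mem_nhds (0 : C(I, E)) hδ] with h hh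
  rw [ContinuousMap.norm_le _ (by positivity)]
  intro s
  have hhs : ‖h s‖ ≤ ‖h‖ := h.norm_coe_le_norm s
  have hh' : ‖h‖ < δ := by simpa using hh
  have key := (convex_ball (u s) δ).norm_image_sub_le_of_norm_hasFDerivWithin_le' (f := X)
    (f' := X') (φ := X' (u s)) (C := ε) (x := u s) (y := u s + h s)
    (fun x _ => (hd x).hasFDerivWithinAt) (fun x hx => by
      have := hδ' (a := u s) (b := x) (by rw [dist_comm]; exact hx) ⟨s, rfl⟩
      rw [← dist_eq_norm, dist_comm]
      exact le_of_lt this) (Metric.mem_ball_self hδ) (by simpa using lt_of_le_of_lt hhs hh')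
  calc _ = ‖X (u s + h s) - X (u s) - X' (u s) (u s + h s - u s)‖ := by
        simp [ContinuousMap.superpose, ContinuousMap.pointwiseApplyL_apply]
    _ ≤ _ := key
    _ ≤ ε * ‖h‖ := by simpa using mul_le_mul_of_nonneg_left hhs hε.le

theorem ContinuousMap.contDiff_superpose_nat.{u} (n : ℕ) {E : Type u} [NormedAddCommGroup E]
    [NormedSpace ℝ E] : ∀ {F : Type u} [NormedAddCommGroup F] [NormedSpace ℝ F]
    {X : E → F} (hX : ContDiff ℝ ∞ X),
    ContDiff ℝ n (ContinuousMap.superpose (I := I) hX.continuous) := by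
  induction n with
  | zero =>
    intro F _ _ X hX
    refine contDiff_zero.2 ?_
    rw [continuous_iff_continuousAt]
    intro u
    have h' : ContDiff ℝ ∞ (fderiv ℝ X) := (contDiff_infty_iff_fderiv.1 hX).2
    exact (ContinuousMap.hasFDerivAt_superpose hX.continuous h'.continuous
      (fun x => (hX.differentiable (by simp) x).hasFDerivAt) u).continuousAt
  | succ n ih =>
    intro F _ _ X hX
    have h' : ContDiff ℝ ∞ (fderiv ℝ X) := (contDiff_infty_iff_fderiv.1 hX).2
    push_cast
    rw [contDiff_succ_iff_hasFDerivAt]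
    refine ⟨_, ?_, fun u => ContinuousMap.hasFDerivAt_superpose hX.continuous h'.continuous
      (fun x => (hX.differentiable (by simp) x).hasFDerivAt) u⟩
    exact (ContinuousMap.pointwiseApplyL I E F).contDiff.comp (ih h')

theorem ContinuousMap.contDiff_superpose.{u} {E F : Type u} [NormedAddCommGroup E]
    [NormedSpace ℝ E] [NormedAddCommGroup F] [NormedSpace ℝ F]
    {X : E → F} (hX : ContDiff ℝ ∞ X) :
    ContDiff ℝ ∞ (ContinuousMap.superpose (I := I) hX.continuous) :=
  contDiff_infty.2 fun n => ContinuousMap.contDiff_superpose_nat n hX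

end Nemytskii

section FlowConstruction

variable {E : Type*} [NormedAddCommGroup E] [NormedSpace ℝ E]

omit [NormedSpace ℝ E] in
theorem continuous_IccExtend_unitInterval (w : C(unitInterval, E)) :
    Continuous (Set.IccExtend zero_le_one w) := w.continuous.Icc_extend'

/-- Integration from `0` as an operator on continuous functions on the unit interval. -/
noncomputable def unitIntegralL (E : Type*) [NormedAddCommGroup E] [NormedSpace ℝ E] :
    C(unitInterval, E) →L[ℝ] C(unitInterval, E) :=
  LinearMap.mkContinuous
    { toFun := fun w => ⟨fun s => ∫ σ in (0 : ℝ)..s, Set.IccExtend zero_le_one w σ,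
        (intervalIntegral.continuous_primitive (fun a b =>
          (continuous_IccExtend_unitInterval w).intervalIntegrable a b) 0).comp
          continuous_subtype_val⟩
      map_add' := fun v w => by
        ext s
        exact intervalIntegral.integral_add
          ((continuous_IccExtend_unitInterval v).intervalIntegrable _ _)
          ((continuous_IccExtend_unitInterval w).intervalIntegrable _ _)
      map_smul' := fun c v => by
        ext s
        exact intervalIntegral.integral_smul c _ } 1
    (fun w => by
      rw [one_mul]
      refine (ContinuousMap.norm_le _ (norm_nonneg w)).2 fun s => ?_
      have := intervalIntegral.norm_integral_le_of_norm_le_const (a := 0) (b := (s : ℝ))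
        (f := Set.IccExtend zero_le_one w) (C := ‖w‖) (fun x _ => w.norm_coe_le_norm _)
      refine this.trans ?_
      rw [sub_zero, abs_of_nonneg s.2.1]
      exact mul_le_of_le_one_right (norm_nonneg w) s.2.2)

theorem unitIntegralL_apply (w : C(unitInterval, E)) (s : unitInterval) :
    unitIntegralL E w s = ∫ σ in (0 : ℝ)..s, Set.IccExtend zero_le_one w σ := rfl

/-- Multiplication by `exp (l s)` on continuous functions on the unit interval. -/
noncomputable def expMulL (E : Type*) [NormedAddCommGroup E] [NormedSpace ℝ E] (l : ℝ) :
    C(unitInterval, E) →L[ℝ] C(unitInterval, E) :=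
  ContinuousMap.pointwiseApplyL unitInterval E E
    ⟨fun s => Real.exp (l * s) • ContinuousLinearMap.id ℝ E, by fun_prop⟩

theorem expMulL_apply (l : ℝ) (w : C(unitInterval, E)) (s : unitInterval) :
    expMulL E l w s = Real.exp (l * s) • w s := rfl

theorem expMulL_expMulL_neg (l : ℝ) (w : C(unitInterval, E)) :
    expMulL E l (expMulL E (-l) w) = w := by
  ext s
  rw [expMulL_apply, expMulL_apply, smul_smul, ← Real.exp_add]
  simp

theorem norm_expMulL_neg_unitIntegralL_le {l : ℝ} (hl : 0 < l) {B : ℝ} (hB : 0 ≤ B)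
    (w : C(unitInterval, E)) (hw : ∀ s, ‖w s‖ ≤ B * Real.exp (l * s)) :
    ‖expMulL E (-l) (unitIntegralL E w)‖ ≤ B / l := by
  refine (ContinuousMap.norm_le _ (by positivity)).2 fun s => ?_
  rw [expMulL_apply, unitIntegralL_apply, norm_smul, Real.norm_eq_abs, Real.abs_exp]
  have h1 : ‖∫ σ in (0 : ℝ)..s, Set.IccExtend zero_le_one w σ‖ ≤
      ∫ σ in (0 : ℝ)..s, B * Real.exp (l * σ) := by
    refine intervalIntegral.norm_integral_le_of_norm_le s.2.1 ?_
      (Continuous.intervalIntegrable (by fun_prop) _ _)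
    refine Filter.Eventually.of_forall fun σ hσ => ?_
    have hmem : σ ∈ Set.Icc (0 : ℝ) 1 := ⟨hσ.1.le, hσ.2.trans s.2.2⟩
    rw [Set.IccExtend_of_mem _ _ hmem]
    exact hw ⟨σ, hmem⟩
  have h2 : ∫ σ in (0 : ℝ)..s, B * Real.exp (l * σ) = B * ((Real.exp (l * s) - 1) / l) := by
    rw [intervalIntegral.integral_const_mul, intervalIntegral.integral_comp_mul_left _ hl.ne']
    simp [div_eq_inv_mul]
  rw [h2] at h1
  calc _ ≤ Real.exp (-l * s) * (B * ((Real.exp (l * s) - 1) / l)) := by gcongr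
    _ = B / l * (1 - Real.exp (-l * s)) := by
      have : Real.exp (-l * s) * Real.exp (l * s) = 1 := by rw [← Real.exp_add]; simp
      linear_combination (B / l) * this
    _ ≤ B / l := mul_le_of_le_one_right (by positivity) (by linarith [Real.exp_pos (-l * s)])

variable [CompleteSpace E] {X : E → E} (hX : ContDiff ℝ ∞ X)

/-- The weighted Picard operator. -/
noncomputable def picardOp (l : ℝ) (p : (ℝ × E) × C(unitInterval, E)) : C(unitInterval, E) :=
  expMulL E (-l) (ContinuousLinearMap.const ℝ unitInterval p.1.2 + p.1.1 • unitIntegralL E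
    (ContinuousMap.superpose hX.continuous (expMulL E l p.2)))

omit [CompleteSpace E] in
theorem contDiff_picardOp (l : ℝ) : ContDiff ℝ ∞ (picardOp hX l) := by
  unfold picardOp
  have h := (ContinuousMap.contDiff_superpose (I := unitInterval) hX)
  have h2 : ContDiff ℝ ∞ fun p : (ℝ × E) × C(unitInterval, E) =>
    ContinuousMap.superpose hX.continuous (expMulL E l p.2) :=
      h.comp ((expMulL E l).contDiff.comp contDiff_snd)
  have h3 : ContDiff ℝ ∞ fun p : (ℝ × E) × C(unitInterval, E) => unitIntegralL E
    (ContinuousMap.superpose hX.continuous (expMulL E l p.2)) :=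
      (unitIntegralL E).contDiff.comp h2
  have h4 : ContDiff ℝ ∞ fun p : (ℝ × E) × C(unitInterval, E) =>
      ContinuousLinearMap.const ℝ unitInterval p.1.2 :=
    (ContinuousLinearMap.const ℝ unitInterval (M := E)).contDiff.comp
      (contDiff_snd.comp contDiff_fst)
  exact (expMulL E (-l)).contDiff.comp (h4.add ((contDiff_fst.comp contDiff_fst).smul h3))

omit [CompleteSpace E] in
theorem lipschitzWith_picardOp {L : NNReal} (hL : LipschitzWith L X) {l : ℝ} (hl : 0 < l)
    (q : ℝ × E) (hq : |q.1| * L ≤ l / 2) :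
    LipschitzWith (1 / 2) (fun c => picardOp hX l (q, c)) := by
  refine LipschitzWith.of_dist_le_mul fun v w => ?_
  have h1 : picardOp hX l (q, v) - picardOp hX l (q, w) = q.1 • expMulL E (-l) (unitIntegralL E
    (ContinuousMap.superpose hX.continuous (expMulL E l v) -
      ContinuousMap.superpose hX.continuous (expMulL E l w))) := by
    simp only [picardOp, ← map_sub, ← map_smul]
    congr 1
    simp [smul_sub]
  rw [dist_eq_norm, h1, norm_smul, dist_eq_norm]
  have h2 := norm_expMulL_neg_unitIntegralL_le hl (B := L * ‖v - w‖) (by positivity)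
    (ContinuousMap.superpose hX.continuous (expMulL E l v) -
      ContinuousMap.superpose hX.continuous (expMulL E l w)) (fun s => by
      have := hL.dist_le_mul (expMulL E l v s) (expMulL E l w s)
      rw [dist_eq_norm, dist_eq_norm, expMulL_apply, expMulL_apply, ← smul_sub, norm_smul,
        Real.norm_eq_abs, Real.abs_exp] at this
      have h3 : ‖v s - w s‖ ≤ ‖v - w‖ := (v - w).norm_coe_le_norm s
      calc _ ≤ (L : ℝ) * (Real.exp (l * s) * ‖v s - w s‖) := this
        _ ≤ (L : ℝ) * (Real.exp (l * s) * ‖v - w‖) := by gcongr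
        _ = _ := by ring)
  calc _ ≤ ‖q.1‖ * (L * ‖v - w‖ / l) := by gcongr
    _ = (|q.1| * L) * (‖v - w‖ / l) := by rw [Real.norm_eq_abs]; ring
    _ ≤ l / 2 * (‖v - w‖ / l) := by gcongr
    _ = _ := by push_cast; field_simp

/-- The integral equation for the reparametrized trajectory of `X` from `x` up to time `T`. -/
def IsTraj (T : ℝ) (x : E) (u : C(unitInterval, E)) : Prop :=
  u = ContinuousLinearMap.const ℝ unitInterval x + T • unitIntegralL E
    (ContinuousMap.superpose hX.continuous u)

theorem existsUnique_isTraj {L : NNReal} (hL : LipschitzWith L X) (T : ℝ) (x : E) :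
    ∃! u, IsTraj hX T x u := by
  set l : ℝ := 2 * (|T| * L) + 1 with hl
  have hl0 : 0 < l := by positivity
  have hc : ContractingWith (1 / 2) (fun c => picardOp hX l ((T, x), c)) :=
    ⟨by rw [← NNReal.coe_lt_coe]; norm_num,
      lipschitzWith_picardOp hX hL hl0 (T, x) (by simp [hl]; linarith)⟩
  refine ⟨expMulL E l (ContractingWith.fixedPoint _ hc), ?_, fun u hu => ?_⟩
  · have := ContractingWith.fixedPoint_isFixedPt hc
    have h2 : picardOp hX l ((T, x), _) = _ := this
    have h3 := congrArg (expMulL E l) h2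
    rw [picardOp, expMulL_expMulL_neg] at h3
    exact h3.symm
  · have h1 : Function.IsFixedPt (fun c => picardOp hX l ((T, x), c)) (expMulL E (-l) u) := by
      change picardOp hX l ((T, x), _) = _
      rw [picardOp, expMulL_expMulL_neg]
      exact congrArg _ hu.symm
    rw [← ContractingWith.fixedPoint_unique hc h1, expMulL_expMulL_neg]

omit [CompleteSpace E] in
theorem IsTraj.rescale {T : ℝ} {x : E} {u : C(unitInterval, E)} (hu : IsTraj hX T x u)
    (s : unitInterval) : IsTraj hX (s * T) x (u.comp ⟨fun σ => s * σ, by fun_prop⟩) := by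
  ext σ
  have h1 := congrArg (fun w : C(unitInterval, E) => w (s * σ)) hu
  simp only [ContinuousMap.add_apply, ContinuousMap.smul_apply, unitIntegralL_apply] at h1
  simp only [ContinuousMap.comp_apply, ContinuousMap.coe_mk, ContinuousMap.add_apply,
    ContinuousMap.smul_apply, unitIntegralL_apply]
  rw [h1]
  have h2 : ∀ y, ContinuousLinearMap.const ℝ unitInterval (M := E) x y = x := fun _ => rfl
  rw [h2, h2, mul_comm (s : ℝ) T, mul_smul]
  congr 2
  have h3 := intervalIntegral.smul_integral_comp_mul_left (a := 0) (b := (σ : ℝ))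
    (Set.IccExtend zero_le_one (ContinuousMap.superpose hX.continuous u)) (s : ℝ)
  rw [mul_zero] at h3
  rw [show ((s * σ : unitInterval) : ℝ) = (s : ℝ) * σ from rfl, ← h3]
  congr 1
  refine intervalIntegral.integral_congr fun τ hτ => ?_
  rw [Set.uIcc_of_le σ.2.1] at hτ
  have hm : τ ∈ Set.Icc (0 : ℝ) 1 := ⟨hτ.1, hτ.2.trans σ.2.2⟩
  have hm' : (s : ℝ) * τ ∈ Set.Icc (0 : ℝ) 1 :=
    ⟨mul_nonneg s.2.1 hm.1, mul_le_one₀ s.2.2 hm.1 hm.2⟩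
  rw [Set.IccExtend_of_mem _ _ hm, Set.IccExtend_of_mem _ _ hm']
  rfl

/-- Global flow of a smooth globally Lipschitz vector field. -/
theorem exists_smooth_flow {L : NNReal} (hX : ContDiff ℝ ∞ X) (hL : LipschitzWith L X) :
    ∃ Φ : ℝ → E → E, (∀ x, Φ 0 x = x) ∧ (∀ t x, HasDerivAt (fun s => Φ s x) (X (Φ t x)) t) ∧
      ContDiff ℝ ∞ (fun p : ℝ × E => Φ p.1 p.2) := by
  choose u hu huniq using fun p : ℝ × E => existsUnique_isTraj hX hL p.1 p.2
  have hsm : ContDiff ℝ ∞ u := by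
    rw [contDiff_iff_contDiffAt]
    intro q₀
    set l : ℝ := 2 * ((|q₀.1| + 1) * L) + 1 with hl
    have hl0 : 0 < l := by positivity
    have h1 : ContDiffAt ℝ ∞ (fun p => expMulL E (-l) (u p)) q₀ := by
      refine contDiffAt_fixedPoint (contDiff_picardOp hX l) (κ := 1 / 2)
        (by rw [← NNReal.coe_lt_coe]; norm_num) ?_ fun q => ?_
      · have : ∀ᶠ q : ℝ × E in 𝓝 q₀, |q.1| < |q₀.1| + 1 :=
          (continuous_fst.abs.continuousAt (x := q₀)).eventually_lt continuousAt_const (by simp)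
        filter_upwards [this] with q hq
        refine lipschitzWith_picardOp hX hL hl0 q ?_
        have := mul_le_mul_of_nonneg_right hq.le L.2
        change |q.1| * L ≤ _ at this
        have h' : (|q₀.1| + 1) * (L : ℝ) ≤ l / 2 := by rw [hl]; linarith
        exact this.trans h'
      · rw [picardOp, expMulL_expMulL_neg]
        exact congrArg _ (hu q).symm
    have h2 := (expMulL E l).contDiff.contDiffAt.comp q₀ h1
    refine h2.congr_of_eventuallyEq (Filter.Eventually.of_forall fun q => ?_)
    exact (expMulL_expMulL_neg l (u q)).symm
  have hsm1 : ContDiff ℝ ∞ (fun p => u p 1) :=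
    (ContinuousMap.evalCLM ℝ (1 : unitInterval) (M := E)).contDiff.comp hsm
  have hresc : ∀ (s : unitInterval) (T : ℝ) (x : E), u (s * T, x) 1 = u (T, x) s := by
    intro s T x
    rw [← huniq (s * T, x) _ ((hu (T, x)).rescale hX s)]
    simp
  have hne : ∀ t x, t ≠ 0 → HasDerivAt (fun s => u (s, x) 1) (X (u (t, x) 1)) t := by
    intro t x ht
    set w := u (2 * t, x) with hw
    have hcont : Continuous
      (Set.IccExtend zero_le_one (ContinuousMap.superpose hX.continuous w)) :=
        continuous_IccExtend_unitInterval _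
    have h1 : HasDerivAt (fun s : ℝ => x + (2 * t) • ∫ σ in (0 : ℝ)..s,
        Set.IccExtend zero_le_one (ContinuousMap.superpose hX.continuous w) σ)
        ((2 * t) • Set.IccExtend zero_le_one (ContinuousMap.superpose hX.continuous w)
          ((2 * t)⁻¹ * t)) ((2 * t)⁻¹ * t) :=
      ((hcont.integral_hasStrictDerivAt 0 _).hasDerivAt.const_smul _).const_add x
    have h2 := h1.scomp t ((hasDerivAt_id t).const_mul (2 * t)⁻¹)
    have hhalf : (2 * t)⁻¹ * t = 1 / 2 := by field_simp
    have hm : (1 / 2 : ℝ) ∈ Set.Icc (0 : ℝ) 1 := by constructor <;> norm_num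
    have hval : Set.IccExtend zero_le_one (ContinuousMap.superpose hX.continuous w)
        ((2 * t)⁻¹ * t) = X (u (t, x) 1) := by
      rw [hhalf, Set.IccExtend_of_mem _ _ hm]
      change X (w _) = _
      rw [hw, ← hresc]
      congr 4
      simp only
      ring
    rw [hval, smul_smul] at h2
    have h3 : (2 * t)⁻¹ * 1 * (2 * t) = 1 := by field_simp
    rw [h3, one_smul] at h2
    refine h2.congr_of_eventuallyEq ?_
    have hev : ∀ᶠ s in 𝓝 t, (2 * t)⁻¹ * s ∈ Set.Ioo (0 : ℝ) 1 := by
      have hc : ContinuousAt (fun s => (2 * t)⁻¹ * s) t := by fun_prop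
      refine hc.preimage_mem_nhds ?_
      rw [hhalf]
      exact Ioo_mem_nhds (by norm_num) (by norm_num)
    filter_upwards [hev] with s hs
    have h4 := hresc ⟨(2 * t)⁻¹ * s, hs.1.le, hs.2.le⟩ (2 * t) x
    have h5 : (2 * t)⁻¹ * s * (2 * t) = s := by field_simp
    simp only [h5] at h4
    rw [h4]
    have h6 := congrArg (fun z : C(unitInterval, E) => z ⟨(2 * t)⁻¹ * s, hs.1.le, hs.2.le⟩)
      (hu (2 * t, x))
    exact h6
  refine ⟨fun t x => u (t, x) 1, fun x => ?_, fun t x => ?_, hsm1⟩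
  · have := congrArg (fun w : C(unitInterval, E) => w 1) (hu (0, x))
    simp only [zero_smul, add_zero] at this
    exact this
  · have hc1 : ContDiff ℝ ∞ (fun s => u (s, x) 1) :=
      hsm1.comp (contDiff_prodMk_left x)
    have hd : Differentiable ℝ (fun s => u (s, x) 1) := hc1.differentiable (by simp)
    have heq : deriv (fun s => u (s, x) 1) = fun s => X (u (s, x) 1) :=
      Continuous.ext_on (dense_compl_singleton (0 : ℝ)) (hc1.continuous_deriv (by simp))
        (hX.continuous.comp hc1.continuous) (fun s hs => (hne s x hs).deriv)
    have := (hd t).hasDerivAt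
    rw [heq] at this
    exact this

end FlowConstruction

section FlowAPI

variable {E : Type*} [NormedAddCommGroup E] [NormedSpace ℝ E]

/-- `Φ` is a smooth global flow of the vector field `X`. -/
structure IsSmoothFlow (X : E → E) (Φ : ℝ → E → E) : Prop where
  zero : ∀ x, Φ 0 x = x
  hasDerivAt : ∀ t x, HasDerivAt (fun s => Φ s x) (X (Φ t x)) t
  smooth : ContDiff ℝ ∞ (fun p : ℝ × E => Φ p.1 p.2)

namespace IsSmoothFlow

variable {X Y : E → E} {Φ Ψ : ℝ → E → E} {L : NNReal}

theorem smooth_time (h : IsSmoothFlow X Φ) (t : ℝ) : ContDiff ℝ ∞ (Φ t) :=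
  h.smooth.comp (contDiff_prodMk_right t)

theorem continuous_curve (h : IsSmoothFlow X Φ) (x : E) : Continuous (fun t => Φ t x) :=
  (h.smooth.comp (contDiff_prodMk_left x)).continuous

theorem eq_of_hasDerivAt (h : IsSmoothFlow X Φ) (hL : LipschitzWith L X) {c : ℝ → E}
    (hc : ∀ t, HasDerivAt c (X (c t)) t) (t : ℝ) : c t = Φ t (c 0) := by
  have := ODE_solution_unique_univ (v := fun _ => X) (s := fun _ => Set.univ) (t₀ := 0)
    (K := L) (f := c) (g := fun t => Φ t (c 0)) (fun t => hL.lipschitzOnWith)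
    (fun t => ⟨hc t, trivial⟩) (fun t => ⟨h.hasDerivAt t _, trivial⟩) (h.zero _).symm
  exact congrFun this t

theorem add (h : IsSmoothFlow X Φ) (hL : LipschitzWith L X) (s t : ℝ) (x : E) :
    Φ (s + t) x = Φ s (Φ t x) := by
  have := h.eq_of_hasDerivAt hL (c := fun s => Φ (s + t) x) (fun s => by
    have := (h.hasDerivAt (s + t) x).scomp s ((hasDerivAt_id s).add_const t)
    simpa [Function.comp_def] using this) s
  simpa using this

theorem neg_add_self (h : IsSmoothFlow X Φ) (hL : LipschitzWith L X) (t : ℝ) (x : E) :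
    Φ (-t) (Φ t x) = x := by
  rw [← h.add hL, neg_add_cancel, h.zero]

theorem reverse (h : IsSmoothFlow X Φ) : IsSmoothFlow (fun x => -X x) (fun t => Φ (-t)) where
  zero x := by simp [h.zero]
  hasDerivAt t x := by
    have := (h.hasDerivAt (-t) x).scomp t (hasDerivAt_neg t)
    simpa [Function.comp_def] using this
  smooth := h.smooth.comp ((contDiff_fst.neg).prodMk contDiff_snd)

theorem dist_le_of_nonneg (h : IsSmoothFlow X Φ) (hL : LipschitzWith L X) {t : ℝ} (ht : 0 ≤ t)
    (x y : E) : dist (Φ t x) (Φ t y) ≤ Real.exp (L * t) * dist x y := by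
  have := dist_le_of_trajectories_ODE (v := fun _ => X) (K := L) (a := 0) (b := t)
    (f := fun s => Φ s x) (g := fun s => Φ s y) (δ := dist x y) (fun _ => hL)
    (h.continuous_curve x).continuousOn (fun s _ => (h.hasDerivAt s x).hasDerivWithinAt)
    (h.continuous_curve y).continuousOn (fun s _ => (h.hasDerivAt s y).hasDerivWithinAt)
    (by simp [h.zero]) t ⟨ht, le_rfl⟩
  rw [sub_zero] at this
  linarith

theorem dist_le (h : IsSmoothFlow X Φ) (hL : LipschitzWith L X) (t : ℝ)
    (x y : E) : dist (Φ t x) (Φ t y) ≤ Real.exp (L * |t|) * dist x y := by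
  rcases le_total 0 t with ht | ht
  · rw [abs_of_nonneg ht]; exact h.dist_le_of_nonneg hL ht x y
  · have := h.reverse.dist_le_of_nonneg (L := L) hL.neg (neg_nonneg.2 ht) x y
    rw [abs_of_nonpos ht]
    simpa using this

theorem dist_flow_le (h : IsSmoothFlow X Φ) (h' : IsSmoothFlow Y Ψ) (hL : LipschitzWith L X)
    {y : E} {ε : ℝ} (hε : 0 ≤ ε)
    (hb : ∀ s ∈ Set.Icc (0 : ℝ) 1, ‖X (Ψ s y) - Y (Ψ s y)‖ ≤ ε) {t : ℝ}
    (ht : t ∈ Set.Icc (0 : ℝ) 1) : dist (Φ t y) (Ψ t y) ≤ ε * Real.exp (L + 1) := by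
  have key := dist_le_of_approx_trajectories_ODE (v := fun _ => X) (K := L + 1) (a := 0) (b := 1)
    (f := fun s => Φ s y) (g := fun s => Ψ s y) (δ := 0) (εf := 0) (εg := ε)
    (f' := fun s => X (Φ s y)) (g' := fun s => Y (Ψ s y))
    (fun _ => hL.weaken (by simp))
    (h.continuous_curve y).continuousOn (fun s _ => (h.hasDerivAt s y).hasDerivWithinAt)
    (fun s _ => by simp)
    (h'.continuous_curve y).continuousOn (fun s _ => (h'.hasDerivAt s y).hasDerivWithinAt)
    (fun s hs => by rw [dist_comm, dist_eq_norm]; exact hb s ⟨hs.1, hs.2.le⟩)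
    (by simp [h.zero, h'.zero]) t ht
  refine key.trans ?_
  have hK : ((L + 1 : NNReal) : ℝ) ≠ 0 := by positivity
  rw [gronwallBound_of_K_ne_0 hK]
  simp only [zero_mul, zero_add, sub_zero]
  set K : ℝ := ((L + 1 : NNReal) : ℝ) with hKd
  have hK1 : 1 ≤ K := by rw [hKd]; push_cast; linarith [L.2]
  have hKe : (L : ℝ) + 1 = K := by rw [hKd]; push_cast; rfl
  rw [hKe]
  have h1 : Real.exp (K * t) ≤ Real.exp K :=
    Real.exp_le_exp.2 (by nlinarith [ht.1, ht.2])
  have h2 : ε / K ≤ ε := div_le_self hε hK1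
  calc ε / K * (Real.exp (K * t) - 1) ≤ ε / K * Real.exp K := by
        gcongr; linarith
    _ ≤ ε * Real.exp K := by gcongr

theorem differentiableAt (h : IsSmoothFlow X Φ) (t : ℝ) (x : E) : DifferentiableAt ℝ (Φ t) x :=
  (h.smooth_time t).differentiable (by simp) x

/-- The variational equation. -/
theorem hasDerivAt_fderiv (h : IsSmoothFlow X Φ) (hX : ContDiff ℝ ∞ X) (t : ℝ) (x u : E) :
    HasDerivAt (fun s => fderiv ℝ (Φ s) x u) (fderiv ℝ X (Φ t x) (fderiv ℝ (Φ t) x u)) t := by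
  set f : ℝ × E → E := fun p => Φ p.1 p.2 with hf
  have hfd : Differentiable ℝ f := h.smooth.differentiable (by simp)
  have hf' : ContDiff ℝ ∞ (fderiv ℝ f) := (contDiff_infty_iff_fderiv.1 h.smooth).2
  have hf'd : Differentiable ℝ (fderiv ℝ f) := hf'.differentiable (by simp)
  have hx : ∀ s y v, fderiv ℝ (Φ s) y v = fderiv ℝ f (s, y) (0, v) := by
    intro s y v
    have := (hfd (s, y)).hasFDerivAt.comp y (hasFDerivAt_prodMk_right s y)
    have h2 : HasFDerivAt (Φ s) _ y := this
    rw [h2.fderiv]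
    simp
  have ht : ∀ p : ℝ × E, fderiv ℝ f p (1, 0) = X (f p) := by
    intro p
    have := (hfd (p.1, p.2)).hasFDerivAt.comp_hasDerivAt p.1
      (hasFDerivAt_prodMk_left p.1 p.2).hasDerivAt
    have h2 : HasDerivAt (fun s => Φ s p.2) _ p.1 := this
    have := h2.unique (h.hasDerivAt p.1 p.2)
    simpa using this
  have h1 : HasDerivAt (fun s => fderiv ℝ (Φ s) x u)
      (fderiv ℝ (fderiv ℝ f) (t, x) (1, 0) (0, u)) t := by
    have := (hf'd (t, x)).hasFDerivAt.comp_hasDerivAt t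
      (hasFDerivAt_prodMk_left t x).hasDerivAt
    have h3 := this.clm_apply (hasDerivAt_const t ((0 : ℝ), u))
    simp only [map_zero, add_zero, Function.comp_def] at h3
    have h4 : (fun s => fderiv ℝ (Φ s) x u) = fun s => fderiv ℝ f (s, x) (0, u) := by
      funext s; exact hx s x u
    rw [h4]
    simpa using h3
  have hsymm : IsSymmSndFDerivAt ℝ f (t, x) :=
    (h.smooth.contDiffAt).isSymmSndFDerivAt (by simp; exact ENat.LEInfty.out)
  rw [hsymm.eq] at h1
  have h2 : fderiv ℝ (fun p => fderiv ℝ f p (1, 0)) (t, x) (0, u) =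
      fderiv ℝ (fderiv ℝ f) (t, x) (0, u) (1, 0) := by
    rw [fderiv_clm_apply (hf'd _) (differentiableAt_const _)]
    simp
  have h3 : (fun p => fderiv ℝ f p (1, 0)) = fun p => X (f p) := funext ht
  rw [h3] at h2
  have h4 : fderiv ℝ (fun p => X (f p)) (t, x) = fderiv ℝ X (f (t, x)) ∘L fderiv ℝ f (t, x) :=
    fderiv_comp (t, x) (hX.differentiable (by simp) _) (hfd _)
  rw [h4] at h2
  rw [← h2] at h1
  rw [hx]
  exact h1

/-- Flows of conformal fields are conformal. -/
theorem conformal (h : IsSmoothFlow X Φ) (hX : ContDiff ℝ ∞ X) (Ω : E →L[ℝ] E →L[ℝ] ℝ) {c : ℝ}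
    (hc : ∀ x u v, Ω (fderiv ℝ X x u) v + Ω u (fderiv ℝ X x v) = c * Ω u v) (t : ℝ) (x u v : E) :
    Ω (fderiv ℝ (Φ t) x u) (fderiv ℝ (Φ t) x v) = Real.exp (c * t) * Ω u v := by
  set g : ℝ → ℝ := fun s => Real.exp (-(c * s)) *
    Ω (fderiv ℝ (Φ s) x u) (fderiv ℝ (Φ s) x v) with hg
  have hd : ∀ s, HasDerivAt g 0 s := by
    intro s
    have hu := h.hasDerivAt_fderiv hX s x u
    have hv := h.hasDerivAt_fderiv hX s x v
    have h1 := ((Ω.hasFDerivAt.comp_hasDerivAt s hu).clm_apply hv)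
    have h2 : HasDerivAt (fun s => Real.exp (-(c * s))) (Real.exp (-(c * s)) * (-c)) s := by
      have := ((hasDerivAt_id s).const_mul c).neg.exp
      simpa using this
    have h3 := h2.mul h1
    refine h3.congr_deriv ?_
    have h4 := hc (Φ s x) (fderiv ℝ (Φ s) x u) (fderiv ℝ (Φ s) x v)
    simp only [Function.comp_apply]
    linear_combination (Real.exp (-(c * s))) * h4
  have hconst : g t = g 0 :=
    is_const_of_deriv_eq_zero (fun s => (hd s).differentiableAt) (fun s => (hd s).deriv) t 0
  have h0 : fderiv ℝ (Φ 0) x = ContinuousLinearMap.id ℝ E := by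
    have : Φ 0 = id := funext h.zero
    rw [this, fderiv_id]
  simp only [hg, h0, mul_zero, neg_zero, Real.exp_zero, one_mul,
    ContinuousLinearMap.id_apply] at hconst
  rw [← hconst, ← mul_assoc, ← Real.exp_add]
  simp

end IsSmoothFlow

end FlowAPI

section RapidSeries

variable {E F : Type*} [NormedAddCommGroup E] [NormedSpace ℝ E]
  [NormedAddCommGroup F] [NormedSpace ℝ F]

theorem norm_fderiv_le_interpolation {f : E → F} (hf : ContDiff ℝ ∞ f) {R a b h : ℝ}
    (ha : ∀ y, ‖y‖ ≤ R + 1 → ‖f y‖ ≤ a) (hb : ∀ y, ‖y‖ ≤ R + 1 → ‖iteratedFDeriv ℝ 2 f y‖ ≤ b)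
    (h0 : 0 < h) (h1 : h ≤ 1) {x : E} (hx : ‖x‖ ≤ R) : ‖fderiv ℝ f x‖ ≤ 2 * a / h + b * h := by
  have hx' : ‖x‖ ≤ R + 1 := by linarith
  have ha0 : 0 ≤ a := (norm_nonneg _).trans (ha x hx')
  have hb0 : 0 ≤ b := (norm_nonneg _).trans (hb x hx')
  have hfd : ContDiff ℝ ∞ (fderiv ℝ f) := (contDiff_infty_iff_fderiv.1 hf).2
  have hball : ∀ y ∈ Metric.closedBall x h, ‖y‖ ≤ R + 1 := by
    intro y hy
    have : ‖y - x‖ ≤ h := by simpa [dist_eq_norm] using hy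
    have h2 : ‖y‖ ≤ ‖y - x‖ + ‖x‖ := by simpa using norm_add_le (y - x) x
    linarith
  have hD : ∀ y ∈ Metric.closedBall x h, ‖fderiv ℝ f y - fderiv ℝ f x‖ ≤ b * h := by
    intro y hy
    have key := (convex_closedBall x h).norm_image_sub_le_of_norm_fderiv_le (𝕜 := ℝ)
      (f := fderiv ℝ f) (C := b) (x := x) (y := y)
      (fun z _ => hfd.differentiable (by simp) z) (fun z hz => by
        have := hb z (hball z hz)
        rwa [← norm_iteratedFDeriv_fderiv, norm_iteratedFDeriv_one] at this)
      (Metric.mem_closedBall_self h0.le) hy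
    have : ‖y - x‖ ≤ h := by simpa [dist_eq_norm] using hy
    exact key.trans (by gcongr)
  refine ContinuousLinearMap.opNorm_le_of_unit_norm (by positivity) fun v hv => ?_
  have hmem : x + h • v ∈ Metric.closedBall x h := by
    simp [norm_smul, hv, abs_of_pos h0]
  have key := (convex_closedBall x h).norm_image_sub_le_of_norm_fderiv_le' (𝕜 := ℝ)
    (f := f) (φ := fderiv ℝ f x) (C := b * h) (x := x) (y := x + h • v)
    (fun z _ => hf.differentiable (by simp) z) hD (Metric.mem_closedBall_self h0.le) hmem
  rw [add_sub_cancel_left, map_smul, norm_smul, hv, Real.norm_eq_abs, abs_of_pos h0, mul_one] at key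
  have h3 : ‖h • fderiv ℝ f x v‖ ≤ 2 * a + b * h * h := by
    have e : h • fderiv ℝ f x v = (f (x + h • v) - f x) -
      (f (x + h • v) - f x - h • fderiv ℝ f x v) := by abel
    rw [e]
    have := ha _ (hball _ hmem)
    have := ha x hx'
    linarith [norm_sub_le (f (x + h • v) - f x) (f (x + h • v) - f x - h • fderiv ℝ f x v),
      norm_sub_le (f (x + h • v)) (f x)]
  rw [norm_smul, Real.norm_eq_abs, abs_of_pos h0] at h3
  have h4 : 2 * a / h + b * h = (2 * a + b * h * h) / h := by field_simp
  rw [h4, le_div_iff₀ h0]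
  linarith

/-- Sequences of smooth maps that decay faster than any exponential, locally uniformly, and whose
derivatives grow at most exponentially. -/
structure RapidSeq (u : ℕ → E → F) : Prop where
  smooth : ∀ n, ContDiff ℝ ∞ (u n)
  decay : ∀ R N : ℝ, ∃ C, ∀ n x, ‖x‖ ≤ R → ‖u n x‖ ≤ C * Real.exp (-(N * n))
  growth : ∀ (k : ℕ) (R : ℝ), ∃ C r : ℝ, ∀ (n : ℕ) x, ‖x‖ ≤ R →
    ‖iteratedFDeriv ℝ k (u n) x‖ ≤ C * Real.exp (r * n)

theorem RapidSeq.fderiv {u : ℕ → E → F} (hu : RapidSeq u) :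
    RapidSeq (fun n => fderiv ℝ (u n)) where
  smooth n := (contDiff_infty_iff_fderiv.1 (hu.smooth n)).2
  decay R N := by
    obtain ⟨C₂, r, h₂⟩ := hu.growth 2 (R + 1)
    set M : ℝ := max 0 (N + r) with hM
    obtain ⟨C₁, h₁⟩ := hu.decay (R + 1) (M + N)
    refine ⟨2 * C₁ + C₂, fun n x hx => ?_⟩
    have hx' : ‖x‖ ≤ R + 1 := by linarith
    have hn : (0 : ℝ) ≤ n := by positivity
    have hM0 : 0 ≤ M := le_max_left _ _
    have hC₂ : 0 ≤ C₂ := by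
      have := (norm_nonneg _).trans (h₂ n x hx')
      exact nonneg_of_mul_nonneg_left this (Real.exp_pos _)
    have key := norm_fderiv_le_interpolation (hu.smooth n) (R := R) (h := Real.exp (-(M * n)))
      (h₁ n) (h₂ n) (Real.exp_pos _) (by
        rw [Real.exp_le_one_iff]; exact neg_nonpos.2 (by positivity)) hx
    refine key.trans ?_
    have e1 : 2 * (C₁ * Real.exp (-((M + N) * n))) / Real.exp (-(M * n)) =
        2 * C₁ * Real.exp (-(N * n)) := by
      rw [div_eq_mul_inv, ← Real.exp_neg, mul_assoc, mul_assoc, ← Real.exp_add, ← mul_assoc]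
      congr 2; ring
    have e2 : C₂ * Real.exp (r * n) * Real.exp (-(M * n)) ≤ C₂ * Real.exp (-(N * n)) := by
      rw [mul_assoc, ← Real.exp_add]
      gcongr
      have : N + r ≤ M := le_max_right _ _
      nlinarith
    rw [e1, add_mul]
    linarith
  growth k R := by
    obtain ⟨C, r, h⟩ := hu.growth (k + 1) R
    exact ⟨C, r, fun n x hx => by rw [norm_iteratedFDeriv_fderiv]; exact h n x hx⟩

theorem summable_exp_neg_nat (C : ℝ) : Summable fun n : ℕ => C * Real.exp (-(1 * (n : ℝ))) := by
  have := (Real.summable_exp_neg_nat).mul_left C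
  simpa using this

theorem RapidSeq.summable [CompleteSpace F] {u : ℕ → E → F} (hu : RapidSeq u) (x : E) :
    Summable fun n => u n x := by
  obtain ⟨C, hC⟩ := hu.decay ‖x‖ 1
  exact Summable.of_norm_bounded (summable_exp_neg_nat C) fun n => hC n x le_rfl

theorem RapidSeq.hasFDerivAt_tsum [CompleteSpace F] {u : ℕ → E → F} (hu : RapidSeq u) (x : E) :
    HasFDerivAt (fun y => ∑' n, u n y) (∑' n, _root_.fderiv ℝ (u n) x) x := by
  obtain ⟨C, hC⟩ := hu.fderiv.decay (‖x‖ + 1) 1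
  exact hasFDerivAt_tsum_of_isPreconnected (summable_exp_neg_nat C)
    (Metric.isOpen_ball (x := (0 : E)) (ε := ‖x‖ + 1)) (convex_ball _ _).isPreconnected
    (fun n y _ => ((hu.smooth n).differentiable (by simp) y).hasFDerivAt)
    (fun n y hy => hC n y (by simpa using (mem_ball_zero_iff.1 hy).le))
    (mem_ball_zero_iff.2 (lt_add_one _)) (hu.summable x) (mem_ball_zero_iff.2 (lt_add_one _))

end RapidSeries

theorem RapidSeq.contDiff_tsum_nat.{v} (k : ℕ) {E : Type v} [NormedAddCommGroup E]
    [NormedSpace ℝ E] : ∀ {F : Type v} [NormedAddCommGroup F] [NormedSpace ℝ F] [CompleteSpace F]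
    {u : ℕ → E → F}, RapidSeq u → ContDiff ℝ k (fun x => ∑' n, u n x) := by
  induction k with
  | zero =>
    intro F _ _ _ u hu
    exact contDiff_zero.2 (continuous_iff_continuousAt.2 fun x =>
      (hu.hasFDerivAt_tsum x).continuousAt)
  | succ k ih =>
    intro F _ _ _ u hu
    push_cast
    rw [contDiff_succ_iff_hasFDerivAt]
    exact ⟨_, ih hu.fderiv, hu.hasFDerivAt_tsum⟩

theorem RapidSeq.contDiff_tsum.{v} {E F : Type v} [NormedAddCommGroup E]
    [NormedSpace ℝ E] [NormedAddCommGroup F] [NormedSpace ℝ F] [CompleteSpace F]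
    {u : ℕ → E → F} (hu : RapidSeq u) : ContDiff ℝ ∞ (fun x => ∑' n, u n x) :=
  contDiff_infty.2 fun k => RapidSeq.contDiff_tsum_nat k hu

section Tame

variable {E F G : Type*} [NormedAddCommGroup E] [NormedSpace ℝ E]
  [NormedAddCommGroup F] [NormedSpace ℝ F] [NormedAddCommGroup G] [NormedSpace ℝ G]

/-- All derivatives of positive order are globally bounded. -/
def Tame (f : E → F) : Prop :=
  ContDiff ℝ ∞ f ∧ ∀ k : ℕ, 1 ≤ k → ∃ C, ∀ x, ‖iteratedFDeriv ℝ k f x‖ ≤ C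

theorem norm_iteratedFDeriv_sub_const (h : E → G) (c : G) {i : ℕ} {y : E} (hi : 1 ≤ i) :
    ‖iteratedFDeriv ℝ i (fun z => h z - c) y‖ = ‖iteratedFDeriv ℝ i h y‖ := by
  obtain ⟨j, rfl⟩ := Nat.exists_eq_add_of_le' hi
  rw [← norm_iteratedFDeriv_fderiv, ← norm_iteratedFDeriv_fderiv]
  congr 2
  funext z
  exact fderiv_sub_const c

theorem contDiff_iterate {f : E → E} (hf : ContDiff ℝ ∞ f) (n : ℕ) : ContDiff ℝ ∞ f^[n] := by
  induction n with
  | zero => exact contDiff_id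
  | succ n ih => rw [Function.iterate_succ']; exact hf.comp ih

theorem norm_iteratedFDeriv_comp_le_of_pos {g : F → G} {f : E → F} {n : ℕ}
    (hg : ContDiff ℝ ∞ g) (hf : ContDiff ℝ ∞ f) (hn : 1 ≤ n) (x : E) {C D : ℝ} (hC0 : 0 ≤ C)
    (hC : ∀ i, 1 ≤ i → i ≤ n → ‖iteratedFDeriv ℝ i g (f x)‖ ≤ C)
    (hD : ∀ i, 1 ≤ i → i ≤ n → ‖iteratedFDeriv ℝ i f x‖ ≤ D ^ i) :
    ‖iteratedFDeriv ℝ n (g ∘ f) x‖ ≤ n.factorial * C * D ^ n := by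
  set c := g (f x)
  have key := norm_iteratedFDeriv_comp_le (𝕜 := ℝ) (g := fun z => g z - c) (f := f) (n := n)
    (N := ∞) (hg.sub contDiff_const) hf ENat.LEInfty.out x (C := C) (D := D) (fun i hi => by
      rcases Nat.eq_zero_or_pos i with rfl | hpos
      · simpa [c] using hC0
      · rw [norm_iteratedFDeriv_sub_const g c hpos]
        exact hC i hpos hi) hD
  have : ((fun z => g z - c) ∘ f) = fun z => (g ∘ f) z - c := rfl
  rwa [this, norm_iteratedFDeriv_sub_const (g ∘ f) c hn] at key

theorem norm_iteratedFDeriv_id_le (i : ℕ) (hi : 1 ≤ i) (x : E) :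
    ‖iteratedFDeriv ℝ i (id : E → E) x‖ ≤ 1 := by
  obtain ⟨j, rfl⟩ := Nat.exists_eq_add_of_le' hi
  have h1 : fderiv ℝ (id : E → E) = fun _ => ContinuousLinearMap.id ℝ E := by
    funext y; exact fderiv_id
  rw [← norm_iteratedFDeriv_fderiv, h1]
  rcases Nat.eq_zero_or_pos j with rfl | hj
  · rw [norm_iteratedFDeriv_zero]; exact ContinuousLinearMap.norm_id_le
  · rw [iteratedFDeriv_const_of_ne hj.ne']; simp

theorem Tame.iterate {f : E → E} (hf : Tame f) (K : ℕ) :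
    ∃ a : ℝ, 1 ≤ a ∧ ∀ (n : ℕ) x, ∀ i, 1 ≤ i → i ≤ K →
      ‖iteratedFDeriv ℝ i f^[n] x‖ ≤ (a ^ n) ^ i := by
  obtain ⟨C, hC1, hC⟩ : ∃ C : ℝ, 1 ≤ C ∧ ∀ i, 1 ≤ i → i ≤ K → ∀ x,
      ‖iteratedFDeriv ℝ i f x‖ ≤ C := by
    choose! c hc using hf.2
    refine ⟨1 + ∑ i ∈ Finset.Icc 1 K, |c i|, ?_, fun i h1 h2 x => (hc i h1 x).trans ?_⟩
    · linarith [Finset.sum_nonneg (s := Finset.Icc 1 K) (fun i _ => abs_nonneg (c i))]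
    · have := Finset.single_le_sum (s := Finset.Icc 1 K) (f := fun i => |c i|)
        (fun i _ => abs_nonneg (c i)) (Finset.mem_Icc.2 ⟨h1, h2⟩)
      linarith [le_abs_self (c i)]
  have hfac : (1 : ℝ) ≤ K.factorial := by
    exact_mod_cast Nat.one_le_iff_ne_zero.2 K.factorial_ne_zero
  have ha : 1 ≤ (K.factorial : ℝ) * C := one_le_mul_of_one_le_of_one_le hfac hC1
  refine ⟨K.factorial * C, ha, fun n => ?_⟩
  induction n with
  | zero =>
    intro x i h1 _
    simpa using norm_iteratedFDeriv_id_le i h1 x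
  | succ n ih =>
    intro x i h1 h2
    rw [Function.iterate_succ']
    have key := norm_iteratedFDeriv_comp_le_of_pos hf.1 (contDiff_iterate hf.1 n) h1 x (C := C)
      (by linarith) (fun j hj hj' => hC j hj (hj'.trans h2) _)
      (fun j hj hj' => ih x j hj (hj'.trans h2))
    refine key.trans ?_
    have hpow : 0 ≤ (((K.factorial : ℝ) * C) ^ n) ^ i := by positivity
    calc (i.factorial : ℝ) * C * (((K.factorial : ℝ) * C) ^ n) ^ i
        ≤ (K.factorial * C) * (((K.factorial : ℝ) * C) ^ n) ^ i := by
          gcongr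
      _ ≤ (K.factorial * C) ^ i * (((K.factorial : ℝ) * C) ^ n) ^ i := by
          gcongr
          exact le_self_pow₀ ha (by omega)
      _ = _ := by rw [pow_succ (_ * C) n, mul_pow _ _ i]; ring

end Tame

namespace IsSmoothFlow

variable {E : Type*} [NormedAddCommGroup E] [NormedSpace ℝ E]
variable {X Y : E → E} {Φ Ψ : ℝ → E → E} {L : NNReal}

theorem iterate (h : IsSmoothFlow X Φ) (hL : LipschitzWith L X) (t : ℝ) (n : ℕ) :
    (Φ t)^[n] = Φ (n * t) := by
  induction n with
  | zero => funext x; simp [h.zero]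
  | succ n ih =>
    funext x
    rw [Function.iterate_succ', Function.comp_apply, ih, ← h.add hL]
    congr 1; push_cast; ring

/-- The discrete wave maps of a pair of flows. -/
def waveSeq (Φ Ψ : ℝ → E → E) (n : ℕ) (x : E) : E := Φ (-n) (Ψ n x)

theorem waveSeq_increment_le (h : IsSmoothFlow X Φ) (h' : IsSmoothFlow Y Ψ)
    (hL : LipschitzWith L X) (hL' : LipschitzWith L Y)
    (hdec : ∀ N : ℕ, ∃ (M : ℕ) (C : ℝ), N ≤ M ∧ ∀ t x, 0 ≤ t →
      ‖X (Ψ t x) - Y (Ψ t x)‖ ≤ C * Real.exp (-(N * t)) * ‖x‖ ^ M) (N : ℕ) :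
    ∃ (M : ℕ) (C : ℝ), N ≤ M ∧ 0 ≤ C ∧ ∀ (n : ℕ) (x : E),
      ‖waveSeq Φ Ψ (n + 1) x - waveSeq Φ Ψ n x‖ ≤ C * Real.exp (-((N - L) * n)) * ‖x‖ ^ M := by
  obtain ⟨M, C', hNM, hC'⟩ := hdec N
  set C := max C' 0 with hCd
  have hC0 : 0 ≤ C := le_max_right _ _
  have hC : ∀ t x, 0 ≤ t → ‖X (Ψ t x) - Y (Ψ t x)‖ ≤ C * Real.exp (-(N * t)) * ‖x‖ ^ M :=
    fun t x ht => (hC' t x ht).trans (by gcongr; exact le_max_left _ _)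
  refine ⟨M, Real.exp L * (C * Real.exp (L + 1)), hNM, by positivity, fun n x => ?_⟩
  have e1 : waveSeq Φ Ψ (n + 1) x = Φ (-(n + 1)) (Ψ 1 (Ψ n x)) := by
    unfold waveSeq
    rw [← h'.add hL']
    push_cast
    rw [add_comm (1 : ℝ)]
  have e2 : waveSeq Φ Ψ n x = Φ (-(n + 1)) (Φ 1 (Ψ n x)) := by
    unfold waveSeq
    rw [← h.add hL]
    congr 1; ring
  have hcmp := h.dist_flow_le h' hL (y := Ψ n x) (ε := C * Real.exp (-(N * n)) * ‖x‖ ^ M)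
    (by positivity) (fun s hs => by
      rw [← h'.add hL']
      refine (hC (s + n) x (by have := hs.1; positivity)).trans ?_
      have := hs.1
      gcongr
      linarith) (t := 1) ⟨zero_le_one, le_rfl⟩
  have hl := h.dist_le hL (-(n + 1)) (Ψ 1 (Ψ n x)) (Φ 1 (Ψ n x))
  rw [← dist_eq_norm, e1, e2]
  refine hl.trans ?_
  rw [dist_comm (Ψ 1 _)]
  have habs : |(-(n + 1) : ℝ)| = n + 1 := by rw [abs_neg, abs_of_nonneg (by positivity)]
  rw [habs]
  calc Real.exp (L * (n + 1)) * dist (Φ 1 (Ψ n x)) (Ψ 1 (Ψ n x))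
      ≤ Real.exp (L * (n + 1)) * (C * Real.exp (-(N * n)) * ‖x‖ ^ M * Real.exp (L + 1)) := by gcongr
    _ = Real.exp L * (C * Real.exp (L + 1)) * (Real.exp (L * n) * Real.exp (-(N * n))) *
        ‖x‖ ^ M := by
      rw [mul_add, mul_one, Real.exp_add]; ring
    _ = _ := by
      rw [← Real.exp_add]
      congr 3; ring

theorem rapidSeq_waveSeq (h : IsSmoothFlow X Φ) (h' : IsSmoothFlow Y Ψ)
    (hL : LipschitzWith L X) (hL' : LipschitzWith L Y) (ht : Tame (Φ (-1))) (ht' : Tame (Ψ 1))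
    (hdec : ∀ N : ℕ, ∃ (M : ℕ) (C : ℝ), N ≤ M ∧ ∀ t x, 0 ≤ t →
      ‖X (Ψ t x) - Y (Ψ t x)‖ ≤ C * Real.exp (-(N * t)) * ‖x‖ ^ M) :
    RapidSeq (fun n x => waveSeq Φ Ψ (n + 1) x - waveSeq Φ Ψ n x) := by
  have hsm : ∀ n, ContDiff ℝ ∞ (waveSeq Φ Ψ n) := fun n =>
    (h.smooth_time _).comp (h'.smooth_time _)
  have hdecay : ∀ R N : ℝ, ∃ C, ∀ (n : ℕ) x, ‖x‖ ≤ R →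
      ‖waveSeq Φ Ψ (n + 1) x - waveSeq Φ Ψ n x‖ ≤ C * Real.exp (-(N * n)) := by
    intro R N
    obtain ⟨M, hM⟩ := exists_nat_ge (N + L)
    obtain ⟨M', C, _, hC0, hC⟩ := waveSeq_increment_le h h' hL hL' hdec M
    refine ⟨C * |R| ^ M', fun n x hx => (hC n x).trans ?_⟩
    have hx' : ‖x‖ ≤ |R| := hx.trans (le_abs_self R)
    calc C * Real.exp (-((M - L) * n)) * ‖x‖ ^ M'
        ≤ C * Real.exp (-(N * n)) * |R| ^ M' := by
          gcongr
          linarith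
      _ = _ := by ring
  refine ⟨fun n => (hsm (n + 1)).sub (hsm n), hdecay, fun k R => ?_⟩
  rcases Nat.eq_zero_or_pos k with rfl | hk
  · obtain ⟨C, hC⟩ := hdecay R 0
    exact ⟨C, 0, fun n x hx => by rw [norm_iteratedFDeriv_zero]; simpa using hC n x hx⟩
  · obtain ⟨a, ha1, ha⟩ := ht.iterate k
    obtain ⟨b, hb1, hb⟩ := ht'.iterate k
    have hbound : ∀ n x, ‖iteratedFDeriv ℝ k (waveSeq Φ Ψ n) x‖ ≤
        k.factorial * ((a * b) ^ k) ^ n := by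
      intro n x
      have e : waveSeq Φ Ψ n = (Φ (-1))^[n] ∘ (Ψ 1)^[n] := by
        rw [h.iterate hL, h'.iterate hL']
        funext y
        simp [waveSeq]
      rw [e]
      have han : 1 ≤ a ^ n := one_le_pow₀ ha1
      have := norm_iteratedFDeriv_comp_le_of_pos (contDiff_iterate ht.1 n) (contDiff_iterate ht'.1 n)
        hk x
        (C := (a ^ n) ^ k) (D := b ^ n) (by positivity)
        (fun i h1 h2 => (ha n _ i h1 h2).trans (pow_le_pow_right₀ han h2))
        (fun i h1 h2 => hb n x i h1 h2)
      refine this.trans (le_of_eq ?_)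
      ring
    set ρ : ℝ := (a * b) ^ k with hρ
    have hρ1 : 1 ≤ ρ := one_le_pow₀ (one_le_mul_of_one_le_of_one_le ha1 hb1)
    refine ⟨k.factorial * ρ + k.factorial, Real.log ρ, fun n x _ => ?_⟩
    have e : Real.exp (Real.log ρ * n) = ρ ^ n := by
      rw [mul_comm, Real.exp_nat_mul, Real.exp_log (by linarith)]
    rw [e]
    have hs : iteratedFDeriv ℝ k (fun x => waveSeq Φ Ψ (n + 1) x - waveSeq Φ Ψ n x) x =
        iteratedFDeriv ℝ k (waveSeq Φ Ψ (n + 1)) x - iteratedFDeriv ℝ k (waveSeq Φ Ψ n) x :=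
      iteratedFDeriv_sub_apply ((hsm (n + 1)).contDiffAt.of_le ENat.LEInfty.out)
        ((hsm n).contDiffAt.of_le ENat.LEInfty.out)
    rw [hs]
    refine (norm_sub_le _ _).trans ((add_le_add (hbound (n + 1) x) (hbound n x)).trans
      (le_of_eq ?_))
    ring

end IsSmoothFlow

namespace IsSmoothFlow

open Filter

variable {E : Type*} [NormedAddCommGroup E] [NormedSpace ℝ E] [CompleteSpace E]
variable {X Y : E → E} {Φ Ψ : ℝ → E → E} {L : NNReal}

/-- The wave map of a pair of flows. -/
noncomputable def waveMap (Φ Ψ : ℝ → E → E) (x : E) : E :=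
  x + ∑' n, (waveSeq Φ Ψ (n + 1) x - waveSeq Φ Ψ n x)

omit [CompleteSpace E] in
theorem waveSeq_zero (h : IsSmoothFlow X Φ) (h' : IsSmoothFlow Y Ψ) : waveSeq Φ Ψ 0 = id := by
  funext x
  simp [waveSeq, h.zero, h'.zero]

theorem tendsto_waveSeq (h : IsSmoothFlow X Φ) (h' : IsSmoothFlow Y Ψ)
    (hr : RapidSeq (fun n x => waveSeq Φ Ψ (n + 1) x - waveSeq Φ Ψ n x)) (x : E) :
    Tendsto (fun n => waveSeq Φ Ψ n x) atTop (𝓝 (waveMap Φ Ψ x)) := by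
  have := (hr.summable x).hasSum.tendsto_sum_nat.const_add x
  refine this.congr fun n => ?_
  rw [Finset.sum_range_sub (fun n => waveSeq Φ Ψ n x), waveSeq_zero h h']
  simp

theorem hasFDerivAt_waveMap
    (hr : RapidSeq (fun n x => waveSeq Φ Ψ (n + 1) x - waveSeq Φ Ψ n x)) (x : E) :
    HasFDerivAt (waveMap Φ Ψ) (ContinuousLinearMap.id ℝ E +
      ∑' n, fderiv ℝ (fun x => waveSeq Φ Ψ (n + 1) x - waveSeq Φ Ψ n x) x) x :=
  (hasFDerivAt_id x).add (hr.hasFDerivAt_tsum x)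

theorem tendsto_fderiv_waveSeq (h : IsSmoothFlow X Φ) (h' : IsSmoothFlow Y Ψ)
    (hr : RapidSeq (fun n x => waveSeq Φ Ψ (n + 1) x - waveSeq Φ Ψ n x)) (x : E) :
    Tendsto (fun n => fderiv ℝ (waveSeq Φ Ψ n) x) atTop (𝓝 (fderiv ℝ (waveMap Φ Ψ) x)) := by
  rw [(hasFDerivAt_waveMap hr x).fderiv]
  have := (hr.fderiv.summable x).hasSum.tendsto_sum_nat.const_add (ContinuousLinearMap.id ℝ E)
  refine this.congr fun n => ?_
  have hd : ∀ n, DifferentiableAt ℝ (waveSeq Φ Ψ n) x := fun n =>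
    ((h.smooth_time _).comp (h'.smooth_time _)).differentiable (by simp) x
  have e : ∀ n, fderiv ℝ (fun x => waveSeq Φ Ψ (n + 1) x - waveSeq Φ Ψ n x) x =
      fderiv ℝ (waveSeq Φ Ψ (n + 1)) x - fderiv ℝ (waveSeq Φ Ψ n) x := fun n =>
    fderiv_fun_sub (hd _) (hd _)
  simp_rw [e]
  rw [Finset.sum_range_sub (fun n => fderiv ℝ (waveSeq Φ Ψ n) x), waveSeq_zero h h', fderiv_id]
  simp

omit [CompleteSpace E] in
theorem norm_waveMap_sub_le (h : IsSmoothFlow X Φ) (h' : IsSmoothFlow Y Ψ)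
    (hL : LipschitzWith L X) (hL' : LipschitzWith L Y)
    (hdec : ∀ N : ℕ, ∃ (M : ℕ) (C : ℝ), N ≤ M ∧ ∀ t x, 0 ≤ t →
      ‖X (Ψ t x) - Y (Ψ t x)‖ ≤ C * Real.exp (-(N * t)) * ‖x‖ ^ M) (N : ℕ) :
    ∃ C, ∀ x, ‖x‖ ≤ 1 → ‖waveMap Φ Ψ x - x‖ ≤ C * ‖x‖ ^ N := by
  obtain ⟨M, hM⟩ := exists_nat_ge (N + L + 1 : ℝ)
  obtain ⟨M', C, hMM', hC0, hC⟩ := waveSeq_increment_le h h' hL hL' hdec M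
  have hs := (summable_exp_neg_nat C).hasSum
  refine ⟨∑' n : ℕ, C * Real.exp (-(1 * (n : ℝ))), fun x hx => ?_⟩
  have e : waveMap Φ Ψ x - x = ∑' n, (waveSeq Φ Ψ (n + 1) x - waveSeq Φ Ψ n x) := by
    simp [waveMap]
  rw [e]
  refine tsum_of_norm_bounded (hs.mul_right (‖x‖ ^ N)) fun n => (hC n x).trans ?_
  have hNM : N ≤ M' := by
    refine le_trans ?_ hMM'
    have : (N : ℝ) ≤ M := by linarith [L.2, show (0 : ℝ) ≤ L from L.2]
    exact_mod_cast this
  have hp : ‖x‖ ^ M' ≤ ‖x‖ ^ N := pow_le_pow_of_le_one (norm_nonneg _) hx hNM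
  gcongr
  linarith [show (0 : ℝ) ≤ N from Nat.cast_nonneg N]

theorem waveMap_intertwines (h : IsSmoothFlow X Φ) (h' : IsSmoothFlow Y Ψ)
    (hL : LipschitzWith L X) (hL' : LipschitzWith L Y)
    (hdec : ∀ N : ℕ, ∃ (M : ℕ) (C : ℝ), N ≤ M ∧ ∀ t x, 0 ≤ t →
      ‖X (Ψ t x) - Y (Ψ t x)‖ ≤ C * Real.exp (-(N * t)) * ‖x‖ ^ M)
    (hr : RapidSeq (fun n x => waveSeq Φ Ψ (n + 1) x - waveSeq Φ Ψ n x))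
    {s : ℝ} (hs : s ∈ Set.Icc (0 : ℝ) 1) (x : E) :
    waveMap Φ Ψ (Ψ s x) = Φ s (waveMap Φ Ψ x) := by
  have t1 := tendsto_waveSeq h h' hr (Ψ s x)
  have t2 := ((h.smooth_time s).continuous.tendsto _).comp (tendsto_waveSeq h h' hr x)
  refine tendsto_nhds_unique (t1.congr_dist ?_) t2
  obtain ⟨M, hM⟩ := exists_nat_ge (L + 1 : ℝ)
  obtain ⟨M', C', _, hC'⟩ := hdec M
  set C := max C' 0 with hCd
  have hC0 : 0 ≤ C := le_max_right _ _
  have hC : ∀ t x, 0 ≤ t → ‖X (Ψ t x) - Y (Ψ t x)‖ ≤ C * Real.exp (-(M * t)) * ‖x‖ ^ M' :=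
    fun t x ht => (hC' t x ht).trans (by gcongr; exact le_max_left _ _)
  have hsum := (summable_exp_neg_nat (C * ‖x‖ ^ M' * Real.exp (L + 1))).tendsto_atTop_zero
  refine squeeze_zero (fun _ => dist_nonneg) (fun n => ?_) hsum
  have e1 : waveSeq Φ Ψ n (Ψ s x) = Φ (-n) (Ψ s (Ψ n x)) := by
    unfold waveSeq
    rw [← h'.add hL', ← h'.add hL', add_comm]
  have e2 : (Φ s ∘ fun n => waveSeq Φ Ψ n x) n = Φ (-n) (Φ s (Ψ n x)) := by
    simp only [Function.comp_apply, waveSeq]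
    rw [← h.add hL, ← h.add hL, add_comm]
  rw [e1, e2]
  have hcmp := h.dist_flow_le h' hL (y := Ψ n x) (ε := C * Real.exp (-(M * n)) * ‖x‖ ^ M')
    (by positivity) (fun s hs => by
      rw [← h'.add hL']
      refine (hC (s + n) x (by have := hs.1; positivity)).trans ?_
      have := hs.1
      gcongr
      linarith) hs
  have hl := h.dist_le hL (-n) (Ψ s (Ψ n x)) (Φ s (Ψ n x))
  have habs : |(-n : ℝ)| = n := by rw [abs_neg, abs_of_nonneg (by positivity)]
  rw [habs, dist_comm (Ψ s _)] at hl
  refine hl.trans ?_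
  calc Real.exp (L * n) * dist (Φ s (Ψ n x)) (Ψ s (Ψ n x))
      ≤ Real.exp (L * n) * (C * Real.exp (-(M * n)) * ‖x‖ ^ M' * Real.exp (L + 1)) := by gcongr
    _ = C * ‖x‖ ^ M' * Real.exp (L + 1) * Real.exp (L * n + -(M * n)) := by
      rw [Real.exp_add (L * n)]; ring
    _ ≤ _ := by
      gcongr
      nlinarith [show (0 : ℝ) ≤ n from Nat.cast_nonneg n]

theorem fderiv_waveMap_apply (h : IsSmoothFlow X Φ) (h' : IsSmoothFlow Y Ψ)
    (hL : LipschitzWith L X) (hL' : LipschitzWith L Y)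
    (hdec : ∀ N : ℕ, ∃ (M : ℕ) (C : ℝ), N ≤ M ∧ ∀ t x, 0 ≤ t →
      ‖X (Ψ t x) - Y (Ψ t x)‖ ≤ C * Real.exp (-(N * t)) * ‖x‖ ^ M)
    (hr : RapidSeq (fun n x => waveSeq Φ Ψ (n + 1) x - waveSeq Φ Ψ n x)) (x : E) :
    fderiv ℝ (waveMap Φ Ψ) x (Y x) = X (waveMap Φ Ψ x) := by
  have hd : HasFDerivAt (waveMap Φ Ψ) (fderiv ℝ (waveMap Φ Ψ) x) (Ψ 0 x) := by
    rw [h'.zero]; exact (hasFDerivAt_waveMap hr x).differentiableAt.hasFDerivAt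
  have d1 : HasDerivAt (fun s => waveMap Φ Ψ (Ψ s x)) (fderiv ℝ (waveMap Φ Ψ) x (Y x)) 0 := by
    have := hd.comp_hasDerivAt 0 (h'.hasDerivAt 0 x)
    rwa [h'.zero] at this
  have d2 : HasDerivAt (fun s => Φ s (waveMap Φ Ψ x)) (X (waveMap Φ Ψ x)) 0 := by
    simpa [h.zero] using h.hasDerivAt 0 (waveMap Φ Ψ x)
  have hmem : (0 : ℝ) ∈ Set.Icc (0 : ℝ) 1 := ⟨le_rfl, zero_le_one⟩
  have d3 : HasDerivWithinAt (fun s => waveMap Φ Ψ (Ψ s x)) (X (waveMap Φ Ψ x))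
      (Set.Icc (0 : ℝ) 1) 0 :=
    d2.hasDerivWithinAt.congr (fun s hs => waveMap_intertwines h h' hL hL' hdec hr hs x)
      (waveMap_intertwines h h' hL hL' hdec hr hmem x)
  exact (uniqueDiffOn_Icc zero_lt_one 0 hmem).eq_deriv _ d1.hasDerivWithinAt d3

theorem waveMap_preserves (h : IsSmoothFlow X Φ) (h' : IsSmoothFlow Y Ψ)
    (hX : ContDiff ℝ ∞ X) (hY : ContDiff ℝ ∞ Y)
    (hr : RapidSeq (fun n x => waveSeq Φ Ψ (n + 1) x - waveSeq Φ Ψ n x))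
    (Ω : E →L[ℝ] E →L[ℝ] ℝ) {c : ℝ}
    (hcX : ∀ x u v, Ω (fderiv ℝ X x u) v + Ω u (fderiv ℝ X x v) = c * Ω u v)
    (hcY : ∀ x u v, Ω (fderiv ℝ Y x u) v + Ω u (fderiv ℝ Y x v) = c * Ω u v) (x u v : E) :
    Ω (fderiv ℝ (waveMap Φ Ψ) x u) (fderiv ℝ (waveMap Φ Ψ) x v) = Ω u v := by
  have ht := tendsto_fderiv_waveSeq h h' hr x
  have hev : ∀ w : E, Tendsto (fun n => fderiv ℝ (waveSeq Φ Ψ n) x w) atTop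
      (𝓝 (fderiv ℝ (waveMap Φ Ψ) x w)) := fun w =>
    ((ContinuousLinearMap.apply ℝ E w).continuous.tendsto _).comp ht
  have hΩ : Continuous fun p : E × E => Ω p.1 p.2 := Ω.isBoundedBilinearMap.continuous
  have hlim := (hΩ.tendsto (_, _)).comp ((hev u).prodMk_nhds (hev v))
  refine tendsto_nhds_unique hlim (tendsto_const_nhds.congr fun n => ?_)
  have hc : fderiv ℝ (waveSeq Φ Ψ n) x =
      (fderiv ℝ (Φ (-n)) (Ψ n x)).comp (fderiv ℝ (Ψ n) x) :=
    fderiv_comp x (h.differentiableAt _ _) (h'.differentiableAt _ _)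
  simp only [Function.comp_apply, hc, ContinuousLinearMap.comp_apply]
  rw [h.conformal hX Ω hcX, h'.conformal hY Ω hcY, ← mul_assoc, ← Real.exp_add]
  simp

end IsSmoothFlow

/-- If the flow of `Y` contracts the difference of two vector fields superexponentially, then the
fields are conjugate by a map that is tangent to the identity to infinite order. -/
theorem exists_conjugacy_of_decay.{u} {E : Type u} [NormedAddCommGroup E] [NormedSpace ℝ E]
    [CompleteSpace E] {X Y : E → E} {Φ Ψ : ℝ → E → E} {L : NNReal}
    (h : IsSmoothFlow X Φ) (h' : IsSmoothFlow Y Ψ)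
    (hX : ContDiff ℝ ∞ X) (hY : ContDiff ℝ ∞ Y)
    (hL : LipschitzWith L X) (hL' : LipschitzWith L Y) (ht : Tame (Φ (-1))) (ht' : Tame (Ψ 1))
    (hdec : ∀ N : ℕ, ∃ (M : ℕ) (C : ℝ), N ≤ M ∧ ∀ t x, 0 ≤ t →
      ‖X (Ψ t x) - Y (Ψ t x)‖ ≤ C * Real.exp (-(N * t)) * ‖x‖ ^ M)
    (Ω : E →L[ℝ] E →L[ℝ] ℝ) {c : ℝ}
    (hcX : ∀ x u v, Ω (fderiv ℝ X x u) v + Ω u (fderiv ℝ X x v) = c * Ω u v)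
    (hcY : ∀ x u v, Ω (fderiv ℝ Y x u) v + Ω u (fderiv ℝ Y x v) = c * Ω u v) :
    ∃ W : E → E, ContDiff ℝ ∞ W ∧ (∀ N : ℕ, ∃ C, ∀ x, ‖x‖ ≤ 1 → ‖W x - x‖ ≤ C * ‖x‖ ^ N) ∧
      (∀ x, fderiv ℝ W x (Y x) = X (W x)) ∧
      (∀ x u v, Ω (fderiv ℝ W x u) (fderiv ℝ W x v) = Ω u v) ∧
      ∀ t ∈ Set.Icc (0 : ℝ) 1, ∀ x, W (Ψ t x) = Φ t (W x) := by
  have hr := h.rapidSeq_waveSeq h' hL hL' ht ht' hdec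
  exact ⟨IsSmoothFlow.waveMap Φ Ψ, contDiff_id.add hr.contDiff_tsum,
    h.norm_waveMap_sub_le h' hL hL' hdec, h.fderiv_waveMap_apply h' hL hL' hdec hr,
    h.waveMap_preserves h' hX hY hr Ω hcX hcY,
    fun t ht x => h.waveMap_intertwines h' hL hL' hdec hr ht x⟩

section TameFlow

variable {E : Type*} [NormedAddCommGroup E] [NormedSpace ℝ E]

theorem norm_iteratedFDeriv_clm_le (B : E →L[ℝ] E) (i : ℕ) (hi : 1 ≤ i) (x : E) :
    ‖iteratedFDeriv ℝ i B x‖ ≤ ‖B‖ := by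
  obtain ⟨j, rfl⟩ := Nat.exists_eq_add_of_le' hi
  have h1 : fderiv ℝ B = fun _ => B := by
    funext y; exact B.fderiv
  rw [← norm_iteratedFDeriv_fderiv, h1]
  rcases Nat.eq_zero_or_pos j with rfl | hj
  · rw [norm_iteratedFDeriv_zero]
  · rw [iteratedFDeriv_const_of_ne hj.ne']; simp

namespace IsSmoothFlow

variable [CompleteSpace E] {X : E → E} {Φ : ℝ → E → E} {L : NNReal} {A : E →L[ℝ] E} {R : ℝ}

omit [CompleteSpace E] in
theorem apply_zero (h : IsSmoothFlow X Φ) (hL : LipschitzWith L X) (h0 : X 0 = 0) (t : ℝ) :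
    Φ t 0 = 0 := by
  have := h.eq_of_hasDerivAt hL (c := fun _ => 0) (fun t => by
    simpa [h0] using hasDerivAt_const t (0 : E))
  simpa using (this t).symm

omit [CompleteSpace E] in
theorem norm_le_exp_mul (h : IsSmoothFlow X Φ) (hL : LipschitzWith L X) (h0 : X 0 = 0) (t : ℝ)
    (x : E) : ‖x‖ ≤ Real.exp (L * |t|) * ‖Φ t x‖ := by
  have := h.dist_le hL (-t) (Φ t x) 0
  rwa [h.neg_add_self hL, h.apply_zero hL h0, dist_zero_right, dist_zero_right, abs_neg] at this

theorem eq_exp_of_nonneg (h : IsSmoothFlow X Φ) (hL : LipschitzWith L X) (h0 : X 0 = 0)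
    (hA : ∀ x, R ≤ ‖x‖ → X x = A x) {t : ℝ} (ht : 0 ≤ t) {x : E}
    (hx : Real.exp (L * t) * R ≤ ‖x‖) (hR : 0 ≤ R) : Φ t x = NormedSpace.exp (t • A) x := by
  have hout : ∀ s ∈ Set.Icc 0 t, R ≤ ‖Φ s x‖ := by
    intro s hs
    have h1 := h.norm_le_exp_mul hL h0 s x
    rw [abs_of_nonneg hs.1] at h1
    have h2 : Real.exp (L * s) * R ≤ Real.exp (L * s) * ‖Φ s x‖ := by
      refine le_trans ?_ (hx.trans h1)
      have := hs.2
      gcongr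
    exact le_of_mul_le_mul_left h2 (Real.exp_pos _)
  have hd : ∀ s, HasDerivAt (fun s : ℝ => NormedSpace.exp (s • A) x)
      (A (NormedSpace.exp (s • A) x)) s := by
    intro s
    have := (hasDerivAt_exp_smul_const' (𝕂 := ℝ) A s)
    exact (ContinuousLinearMap.apply ℝ E x).hasFDerivAt.comp_hasDerivAt s this
  have := ODE_solution_unique_of_mem_Icc_right (v := fun _ => A) (s := fun _ => Set.univ)
    (K := ‖A‖₊) (f := fun s => Φ s x) (g := fun s => NormedSpace.exp (s • A) x) (a := 0) (b := t)
    (fun _ _ => A.lipschitz.lipschitzOnWith) (h.continuous_curve x).continuousOn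
    (fun s hs => by
      have := h.hasDerivAt s x
      rw [hA _ (hout s ⟨hs.1, hs.2.le⟩)] at this
      exact this.hasDerivWithinAt) (fun _ _ => trivial)
    (fun s _ => (hd s).continuousAt.continuousWithinAt) (fun s _ => (hd s).hasDerivWithinAt)
    (fun _ _ => trivial) (by simp [h.zero])
  exact this ⟨ht, le_rfl⟩

theorem eq_exp (h : IsSmoothFlow X Φ) (hL : LipschitzWith L X) (h0 : X 0 = 0)
    (hA : ∀ x, R ≤ ‖x‖ → X x = A x) (t : ℝ) {x : E}
    (hx : Real.exp (L * |t|) * R ≤ ‖x‖) (hR : 0 ≤ R) : Φ t x = NormedSpace.exp (t • A) x := by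
  rcases le_total 0 t with ht | ht
  · rw [abs_of_nonneg ht] at hx
    exact h.eq_exp_of_nonneg hL h0 hA ht hx hR
  · rw [abs_of_nonpos ht] at hx
    have := h.reverse.eq_exp_of_nonneg (A := -A) (R := R) hL.neg (by simp [h0])
      (fun x hx => by simp [hA x hx]) (neg_nonneg.2 ht) hx hR
    simpa using this

/-- The flow of a compactly supported perturbation of a linear field is tame. -/
theorem tame [FiniteDimensional ℝ E] (h : IsSmoothFlow X Φ) (hL : LipschitzWith L X)
    (h0 : X 0 = 0) (hA : ∀ x, R ≤ ‖x‖ → X x = A x) (t : ℝ) : Tame (Φ t) := by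
  wlog hR : 0 ≤ R generalizing R
  · exact this (R := |R|) (fun x hx => hA x ((le_abs_self R).trans hx)) (abs_nonneg R)
  refine ⟨h.smooth_time t, fun k hk => ?_⟩
  set B : E →L[ℝ] E := NormedSpace.exp (t • A)
  have hg : ContDiff ℝ ∞ (fun x => Φ t x - B x) := (h.smooth_time t).sub B.contDiff
  have hcs : HasCompactSupport (fun x => Φ t x - B x) := by
    refine HasCompactSupport.of_support_subset_isCompact
      (isCompact_closedBall 0 (Real.exp (L * |t|) * R)) fun x hx => ?_
    rw [mem_closedBall_zero_iff]
    by_contra! hlt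
    exact hx (sub_eq_zero.2 (h.eq_exp hL h0 hA t hlt.le hR))
  obtain ⟨C, hC⟩ :=
    (hg.continuous_iteratedFDeriv (m := k) ENat.LEInfty.out).bounded_above_of_compact_support
    (hcs.iteratedFDeriv k)
  refine ⟨C + ‖B‖, fun x => ?_⟩
  have e : Φ t = (fun x => (Φ t x - B x) + B x) := by funext y; simp
  rw [e, show (fun x => (Φ t x - B x) + B x) = (fun x => Φ t x - B x) + B from rfl,
    iteratedFDeriv_add_apply (hg.contDiffAt.of_le ENat.LEInfty.out)
      (B.contDiff.contDiffAt.of_le le_top)]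
  exact (norm_add_le _ _).trans (add_le_add (hC x) (norm_iteratedFDeriv_clm_le B k hk x))

end IsSmoothFlow

end TameFlow

section Dynamics

variable {E : Type*} [NormedAddCommGroup E] [NormedSpace ℝ E]

/-- Lyapunov-type conditions on a pair of functions along a vector field: `a` is contracted at rate
`c` where it dominates or near the origin, and `b` is expanded where it dominates. -/
structure SaddlePair (Y : E → E) (a b : E → ℝ) (c ρ : ℝ) : Prop where
  diff_left : Differentiable ℝ a
  diff_right : Differentiable ℝ b
  nonneg_left : ∀ x, 0 ≤ a x
  nonneg_right : ∀ x, 0 ≤ b x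
  contract : ∀ x, b x ≤ a x → fderiv ℝ a x (Y x) ≤ -c * a x
  expand : ∀ x, a x ≤ b x → 0 ≤ fderiv ℝ b x (Y x)
  compare : ∀ x, fderiv ℝ a x (Y x) ≤ fderiv ℝ b x (Y x)
  contract_near : ∀ x, a x + b x ≤ 2 * ρ → fderiv ℝ a x (Y x) ≤ -c * a x

theorem SaddlePair.decay {Y : E → E} {a b : E → ℝ} {c ρ : ℝ} (H : SaddlePair Y a b c ρ)
    {Ψ : ℝ → E → E} (h : IsSmoothFlow Y Ψ) {T : ℝ} (hT : 0 ≤ T) {x : E} (hb : b (Ψ T x) ≤ ρ) :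
    a (Ψ T x) ≤ Real.exp (-(c * T)) * a x := by
  have da : ∀ s, HasDerivAt (fun s => a (Ψ s x)) (fderiv ℝ a (Ψ s x) (Y (Ψ s x))) s := fun s =>
    (H.diff_left _).hasFDerivAt.comp_hasDerivAt s (h.hasDerivAt s x)
  have db : ∀ s, HasDerivAt (fun s => b (Ψ s x)) (fderiv ℝ b (Ψ s x) (Y (Ψ s x))) s := fun s =>
    (H.diff_right _).hasFDerivAt.comp_hasDerivAt s (h.hasDerivAt s x)
  have hmono : Monotone (fun s => b (Ψ s x) - a (Ψ s x)) :=
    monotone_of_hasDerivAt_nonneg (fun s => (db s).sub (da s)) fun s => sub_nonneg.2 (H.compare _)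
  have hcon : ∀ s ∈ Set.Icc 0 T, fderiv ℝ a (Ψ s x) (Y (Ψ s x)) ≤ -c * a (Ψ s x) := by
    intro s hs
    rcases le_total (b (Ψ s x)) (a (Ψ s x)) with hle | hle
    · exact H.contract _ hle
    · have hge : ∀ τ, s ≤ τ → a (Ψ τ x) ≤ b (Ψ τ x) := fun τ hτ => by
        have := hmono hτ
        simp only at this
        linarith
      have hbm : MonotoneOn (fun τ => b (Ψ τ x)) (Set.Ici s) := by
        refine monotoneOn_of_hasDerivWithinAt_nonneg (convex_Ici s)
          (fun τ _ => (db τ).continuousAt.continuousWithinAt)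
          (fun τ _ => (db τ).hasDerivWithinAt) fun τ hτ => H.expand _ (hge τ ?_)
        rw [interior_Ici] at hτ
        exact (Set.mem_Ioi.1 hτ).le
      have h1 : b (Ψ s x) ≤ b (Ψ T x) := hbm (Set.mem_Ici.2 le_rfl) (Set.mem_Ici.2 hs.2) hs.2
      exact H.contract_near _ (by linarith)
  have hanti : AntitoneOn (fun s => Real.exp (c * s) * a (Ψ s x)) (Set.Icc 0 T) := by
    have hd : ∀ s, HasDerivAt (fun s => Real.exp (c * s) * a (Ψ s x))
        (Real.exp (c * s) * (c * 1) * a (Ψ s x) +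
          Real.exp (c * s) * fderiv ℝ a (Ψ s x) (Y (Ψ s x))) s := fun s =>
      (((hasDerivAt_id s).const_mul c).exp).mul (da s)
    refine antitoneOn_of_hasDerivWithinAt_nonpos (convex_Icc 0 T)
      (fun τ _ => (hd τ).continuousAt.continuousWithinAt)
      (fun τ _ => (hd τ).hasDerivWithinAt) fun τ hτ => ?_
    rw [interior_Icc] at hτ
    have h1 := hcon τ ⟨hτ.1.le, hτ.2.le⟩
    have h2 := mul_le_mul_of_nonneg_left h1 (Real.exp_pos (c * τ)).le
    linarith
  have := hanti ⟨le_rfl, hT⟩ ⟨hT, le_rfl⟩ hT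
  simp only [mul_zero, Real.exp_zero, one_mul, h.zero] at this
  rw [Real.exp_neg, ← div_eq_inv_mul, le_div_iff₀ (Real.exp_pos _)]
  linarith

/-- A smooth field that is linear outside a ball is Lipschitz. -/
theorem exists_lipschitzWith_of_eq_clm [FiniteDimensional ℝ E] {Y : E → E} (hY : ContDiff ℝ ∞ Y)
    {A : E →L[ℝ] E} {R : ℝ} (hA : ∀ x, R ≤ ‖x‖ → Y x = A x) : ∃ L, LipschitzWith L Y := by
  have hcs : HasCompactSupport (fun x => Y x - A x) := by
    refine HasCompactSupport.of_support_subset_isCompact (isCompact_closedBall 0 R) fun x hx => ?_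
    rw [mem_closedBall_zero_iff]
    by_contra! hlt
    exact hx (sub_eq_zero.2 (hA x hlt.le))
  obtain ⟨C, hC⟩ := ContDiff.lipschitzWith_of_hasCompactSupport hcs
    ((hY.sub A.contDiff).of_le ENat.LEInfty.out) (one_ne_zero : (1 : WithTop ℕ∞) ≠ 0)
  have := hC.add A.lipschitz
  exact ⟨_, by simpa using this⟩

/-- A perturbation of `Y` supported where `a` controls the norm, flat at the origin, can be removed
by a conjugacy tangent to the identity to infinite order. -/
theorem SaddlePair.exists_conjugacy.{u} {E : Type u} [NormedAddCommGroup E] [NormedSpace ℝ E]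
    [FiniteDimensional ℝ E] {Y Z : E → E} {a b : E → ℝ} {c ρ : ℝ} (H : SaddlePair Y a b c ρ)
    (hc : 0 < c) (hY : ContDiff ℝ ∞ Y) (hZ : ContDiff ℝ ∞ Z) (hY0 : Y 0 = 0)
    {A : E →L[ℝ] E} {R : ℝ} (hA : ∀ x, R ≤ ‖x‖ → Y x = A x) (hZR : ∀ x, R ≤ ‖x‖ → Z x = 0)
    {K C : ℝ} (hK : ∀ x, a x ≤ K * ‖x‖ ^ 2)
    (hsupp : ∀ x, Z x ≠ 0 → ‖x‖ ^ 2 ≤ C * a x ∧ b x ≤ ρ)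
    (hflat : ∀ N : ℕ, ∃ C, ∀ x, ‖Z x‖ ≤ C * ‖x‖ ^ N)
    (Ω : E →L[ℝ] E →L[ℝ] ℝ) {κ : ℝ}
    (hcY : ∀ x u v, Ω (fderiv ℝ Y x u) v + Ω u (fderiv ℝ Y x v) = κ * Ω u v)
    (hcZ : ∀ x u v, Ω (fderiv ℝ Z x u) v + Ω u (fderiv ℝ Z x v) = 0) :
    ∃ W : E → E, ContDiff ℝ ∞ W ∧ (∀ N : ℕ, ∃ C, ∀ x, ‖x‖ ≤ 1 → ‖W x - x‖ ≤ C * ‖x‖ ^ N) ∧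
      (∀ x, fderiv ℝ W x (Y x) = Y (W x) + Z (W x)) ∧
      (∀ x u v, Ω (fderiv ℝ W x u) (fderiv ℝ W x v) = Ω u v) := by
  have : CompleteSpace E := FiniteDimensional.complete ℝ E
  have hX : ContDiff ℝ ∞ (fun x => Y x + Z x) := hY.add hZ
  have hXA : ∀ x, R ≤ ‖x‖ → Y x + Z x = A x := fun x hx => by rw [hA x hx, hZR x hx, add_zero]
  have hZ0 : Z 0 = 0 := by
    obtain ⟨C, hC⟩ := hflat 1
    simpa using hC 0
  obtain ⟨L₁, hL₁⟩ := exists_lipschitzWith_of_eq_clm hY hA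
  obtain ⟨L₂, hL₂⟩ := exists_lipschitzWith_of_eq_clm hX hXA
  have hLY := hL₁.weaken (le_max_left L₁ L₂)
  have hLX := hL₂.weaken (le_max_right L₁ L₂)
  obtain ⟨Ψ, p1, p2, p3⟩ := exists_smooth_flow hY hLY
  obtain ⟨Φ, q1, q2, q3⟩ := exists_smooth_flow hX hLX
  have hΨ : IsSmoothFlow Y Ψ := ⟨p1, p2, p3⟩
  have hΦ : IsSmoothFlow (fun x => Y x + Z x) Φ := ⟨q1, q2, q3⟩
  have hdec : ∀ N : ℕ, ∃ (M : ℕ) (C : ℝ), N ≤ M ∧ ∀ t x, 0 ≤ t →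
      ‖(Y (Ψ t x) + Z (Ψ t x)) - Y (Ψ t x)‖ ≤ C * Real.exp (-(N * t)) * ‖x‖ ^ M := by
    intro N
    obtain ⟨m, hm⟩ := exists_nat_ge (max (N : ℝ) (N / c))
    have hmN : N ≤ m := by exact_mod_cast (le_max_left _ _).trans hm
    have hmc : (N : ℝ) ≤ c * m := by
      have := (le_max_right _ _).trans hm
      rwa [div_le_iff₀ hc, mul_comm] at this
    obtain ⟨D, hD⟩ := hflat (2 * m)
    refine ⟨2 * m, |D| * (|C| * |K|) ^ m, by omega, fun t x ht => ?_⟩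
    rw [add_sub_cancel_left]
    by_cases hz : Z (Ψ t x) = 0
    · rw [hz, norm_zero]; positivity
    obtain ⟨h1, h2⟩ := hsupp _ hz
    have h3 := H.decay hΨ ht h2
    have h4 : ‖Ψ t x‖ ^ 2 ≤ |C| * (Real.exp (-(c * t)) * (|K| * ‖x‖ ^ 2)) := by
      have ha := H.nonneg_left (Ψ t x)
      have hKx : a x ≤ |K| * ‖x‖ ^ 2 :=
        (hK x).trans (by gcongr; exact le_abs_self K)
      calc ‖Ψ t x‖ ^ 2 ≤ C * a (Ψ t x) := h1
        _ ≤ |C| * a (Ψ t x) := by gcongr; exact le_abs_self C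
        _ ≤ |C| * (Real.exp (-(c * t)) * a x) := by gcongr
        _ ≤ _ := by gcongr
    calc ‖Z (Ψ t x)‖ ≤ D * ‖Ψ t x‖ ^ (2 * m) := hD _
      _ ≤ |D| * (‖Ψ t x‖ ^ 2) ^ m := by rw [pow_mul]; gcongr; exact le_abs_self D
      _ ≤ |D| * (|C| * (Real.exp (-(c * t)) * (|K| * ‖x‖ ^ 2))) ^ m := by gcongr
      _ = |D| * (|C| * |K|) ^ m * Real.exp (-(c * t)) ^ m * ‖x‖ ^ (2 * m) := by
        rw [pow_mul]; ring
      _ ≤ _ := by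
        rw [← Real.exp_nat_mul]
        gcongr
        nlinarith
  have hcX : ∀ x u v, Ω (fderiv ℝ (fun x => Y x + Z x) x u) v +
      Ω u (fderiv ℝ (fun x => Y x + Z x) x v) = κ * Ω u v := by
    intro x u v
    rw [fderiv_fun_add (hY.differentiable (by simp) x) (hZ.differentiable (by simp) x)]
    simp only [_root_.add_apply, map_add]
    linarith [hcY x u v, hcZ x u v]
  obtain ⟨W, w1, w2, w3, w4, -⟩ := exists_conjugacy_of_decay hΦ hΨ hX hY hLX hLY
    (hΦ.tame hLX (by simp [hY0, hZ0]) hXA _) (hΨ.tame hLY hY0 hA _) hdec Ω hcX hcY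
  exact ⟨W, w1, w2, w3, w4⟩

end Dynamics

section Order

open Asymptotics

variable {E F : Type*} [NormedAddCommGroup E] [NormedSpace ℝ E]
  [NormedAddCommGroup F] [NormedSpace ℝ F]

/-- Taylor's theorem with a remainder bound that is uniform in the base point near the origin. -/
theorem exists_taylor_bound [CompleteSpace F] {f : E → F} (hf : ContDiff ℝ ∞ f) (n : ℕ) :
    ∃ r > 0, ∃ C, 0 ≤ C ∧ ∀ x y, ‖x‖ ≤ r → ‖y‖ ≤ r →
      ‖f (x + y) - ∑ k ∈ Finset.range (n + 1),
        ((k.factorial : ℝ)⁻¹ • iteratedFDeriv ℝ k f x (fun _ => y))‖ ≤ C * ‖y‖ ^ (n + 1) := by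
  have hcont : Continuous (iteratedFDeriv ℝ (n + 1) f) :=
    hf.continuous_iteratedFDeriv (m := (n + 1 : ℕ)) ENat.LEInfty.out
  set B := ‖iteratedFDeriv ℝ (n + 1) f 0‖ + 1 with hBd
  have hev : ∀ᶠ x in 𝓝 (0 : E), ‖iteratedFDeriv ℝ (n + 1) f x‖ < B :=
    (hcont.norm.tendsto 0).eventually_lt_const (by simp [hBd])
  obtain ⟨ρ, hρ, hball⟩ := Metric.eventually_nhds_iff.1 hev
  refine ⟨ρ / 3, by positivity, B, by positivity, fun x y hx hy => ?_⟩
  have hT := map_add_eq_sum_add_integral_iteratedFDeriv (f := f) (n := n) (x := x) (y := y)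
    (fun t _ => hf.contDiffAt.of_le (by exact_mod_cast
      (ENat.LEInfty.out : ((n + 1 : ℕ) : WithTop ℕ∞) ≤ ∞)))
  rw [hT, add_sub_cancel_left, norm_smul]
  have hI : ‖∫ t in (0 : ℝ)..1, (1 - t) ^ n •
      iteratedFDeriv ℝ (n + 1) f (x + t • y) (fun _ ↦ y)‖ ≤ B * ‖y‖ ^ (n + 1) * |(1 : ℝ) - 0| := by
    refine intervalIntegral.norm_integral_le_of_norm_le_const fun t ht => ?_
    rw [Set.uIoc_of_le zero_le_one] at ht
    have h1 : ‖(1 - t) ^ n‖ ≤ 1 := by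
      rw [norm_pow]
      refine pow_le_one₀ (norm_nonneg _) ?_
      rw [Real.norm_eq_abs, abs_le]
      constructor <;> linarith [ht.1, ht.2]
    have h2 : ‖iteratedFDeriv ℝ (n + 1) f (x + t • y) (fun _ ↦ y)‖ ≤ B * ‖y‖ ^ (n + 1) := by
      refine (ContinuousMultilinearMap.le_opNorm _ _).trans ?_
      rw [Finset.prod_const, Finset.card_univ, Fintype.card_fin]
      gcongr
      refine (hball ?_).le
      rw [dist_zero_right]
      have : ‖t • y‖ ≤ ‖y‖ := by
        rw [norm_smul, Real.norm_eq_abs, abs_of_pos ht.1]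
        nlinarith [norm_nonneg y, ht.2]
      linarith [norm_add_le x (t • y)]
    rw [norm_smul]
    calc _ ≤ 1 * (B * ‖y‖ ^ (n + 1)) := by gcongr
      _ = _ := one_mul _
  rw [sub_zero, abs_one, mul_one] at hI
  have hfac : ‖((n.factorial : ℝ))⁻¹‖ ≤ 1 := by
    rw [norm_inv, Real.norm_natCast]
    exact inv_le_one_of_one_le₀ (by exact_mod_cast Nat.one_le_iff_ne_zero.2 n.factorial_ne_zero)
  calc _ ≤ 1 * (B * ‖y‖ ^ (n + 1)) := by gcongr
    _ = _ := one_mul _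

/-- Weights of a finite difference formula for the first derivative. -/
theorem exists_finiteDifference_weights (m : ℕ) :
    ∃ w : Fin m → ℝ, ∀ k < m, ∑ j, w j * ((j : ℕ) : ℝ) ^ k = if k = 1 then 1 else 0 := by
  set V := Matrix.vandermonde (fun j : Fin m => ((j : ℕ) : ℝ))
  have hV : IsUnit V.det := by
    rw [isUnit_iff_ne_zero, Matrix.det_vandermonde_ne_zero_iff]
    intro i j hij
    exact Fin.ext (Nat.cast_injective (R := ℝ) hij)
  set e : Fin m → ℝ := fun k => if (k : ℕ) = 1 then 1 else 0
  refine ⟨Matrix.vecMul e V⁻¹, fun k hk => ?_⟩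
  have h : Matrix.vecMul (Matrix.vecMul e V⁻¹) V = e := by
    rw [Matrix.vecMul_vecMul, Matrix.nonsing_inv_mul _ hV, Matrix.vecMul_one]
  exact congrFun h ⟨k, hk⟩

/-- For smooth functions, vanishing to order `d + 1` passes to order `d` for the derivative. -/
theorem ContDiff.fderiv_isBigO_pow [CompleteSpace F] {f : E → F} (hf : ContDiff ℝ ∞ f) {d : ℕ}
    (h : f =O[𝓝 0] fun x => ‖x‖ ^ (d + 1)) : fderiv ℝ f =O[𝓝 0] fun x => ‖x‖ ^ d := by
  have hfd : Continuous (fderiv ℝ f) := (contDiff_infty_iff_fderiv.1 hf).2.continuous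
  rcases Nat.eq_zero_or_pos d with rfl | hd
  · simpa using (hfd.tendsto 0).isBigO_one ℝ
  have h00 : fderiv ℝ f 0 = 0 := by
    have : f =O[𝓝 0] fun x => ‖x - 0‖ ^ (d + 1) := by simpa using h
    exact (this.hasFDerivAt (𝕜 := ℝ) (by omega)).fderiv
  obtain ⟨r, hr, C, hC0, hC⟩ := exists_taylor_bound hf (d + 1)
  obtain ⟨B, hB0, hB⟩ := h.exists_pos
  obtain ⟨ρ, hρ, hball⟩ := Metric.eventually_nhds_iff.1 hB.bound
  obtain ⟨w, hw⟩ := exists_finiteDifference_weights (d + 2)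
  set s : ℝ := min (min r ρ) 1 / (2 * (d + 3)) with hs
  have hs0 : 0 < s := by positivity
  set M : ℝ := (∑ j, |w j|) * (B * (d + 3) ^ (d + 1) + C * (d + 3) ^ (d + 2)) with hM
  refine IsBigO.of_bound M (Metric.eventually_nhds_iff.2 ⟨s, hs0, fun x hx => ?_⟩)
  rw [dist_zero_right] at hx
  have hx0 : 0 ≤ ‖x‖ := norm_nonneg x
  have hxs : (d + 3) * ‖x‖ < min (min r ρ) 1 := by
    have h1 : (d + 3) * ‖x‖ ≤ (d + 3) * s := by gcongr
    have h2 : (d + 3) * s = min (min r ρ) 1 / 2 := by rw [hs]; field_simp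
    have h3 : 0 < min (min r ρ) 1 := by positivity
    linarith
  have hd0 : (0 : ℝ) ≤ d := Nat.cast_nonneg d
  have hxr : (d + 3) * ‖x‖ < r := hxs.trans_le ((min_le_left _ _).trans (min_le_left _ _))
  have hxρ : (d + 3) * ‖x‖ < ρ := hxs.trans_le ((min_le_left _ _).trans (min_le_right _ _))
  have hx1 : ‖x‖ ≤ 1 := by
    have : (d + 3) * ‖x‖ < 1 := hxs.trans_le (min_le_right _ _)
    nlinarith
  rcases eq_or_ne x 0 with rfl | hxne
  · simp [h00, hd.ne']
  have hxpos : 0 < ‖x‖ := norm_pos_iff.2 hxne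
  have hMnn : 0 ≤ M := by positivity
  rw [norm_pow, norm_norm]
  refine ContinuousLinearMap.opNorm_le_of_unit_norm (by positivity) fun v hv => ?_
  set y : E := ‖x‖ • v with hy
  have hyn : ‖y‖ = ‖x‖ := by rw [hy, norm_smul, hv, norm_norm, mul_one]
  set T : Fin (d + 2) → F := fun j => ∑ k ∈ Finset.range (d + 1 + 1),
    ((k.factorial : ℝ)⁻¹ • iteratedFDeriv ℝ k f x (fun _ => ((j : ℕ) : ℝ) • y)) with hT
  have hsum : ∑ j, w j • T j = fderiv ℝ f x y := by
    have e1 : ∀ j, w j • T j = ∑ k ∈ Finset.range (d + 2), (w j * ((j : ℕ) : ℝ) ^ k) •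
        ((k.factorial : ℝ)⁻¹ • iteratedFDeriv ℝ k f x (fun _ => y)) := by
      intro j
      simp only [hT]
      rw [Finset.smul_sum]
      refine Finset.sum_congr rfl fun k _ => ?_
      rw [ContinuousMultilinearMap.map_smul_univ _ (fun _ => ((j : ℕ) : ℝ)) (fun _ => y),
        Finset.prod_const, Finset.card_univ, Fintype.card_fin, smul_smul, smul_smul, smul_smul]
      congr 1; ring
    simp_rw [e1]
    rw [Finset.sum_comm]
    simp_rw [← Finset.sum_smul]
    rw [Finset.sum_congr rfl fun k hk => by rw [hw k (Finset.mem_range.1 hk)]]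
    simp only [ite_smul, one_smul, zero_smul, Finset.sum_ite_eq', Finset.mem_range]
    rw [if_pos (by omega)]
    simp [iteratedFDeriv_one_apply]
  have hjn : ∀ j : Fin (d + 2), ‖((j : ℕ) : ℝ) • y‖ ≤ (d + 3) * ‖x‖ := by
    intro j
    rw [norm_smul, hyn, Real.norm_natCast]
    have : ((j : ℕ) : ℝ) ≤ d + 2 := by exact_mod_cast j.2.le
    gcongr
    linarith
  have hjn' : ∀ j : Fin (d + 2), ‖x + ((j : ℕ) : ℝ) • y‖ ≤ (d + 3) * ‖x‖ := by
    intro j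
    refine (norm_add_le _ _).trans ?_
    rw [norm_smul, hyn, Real.norm_natCast]
    have : ((j : ℕ) : ℝ) ≤ d + 2 := by exact_mod_cast j.2.le
    nlinarith
  have hTj : ∀ j, ‖T j‖ ≤ (B * (d + 3) ^ (d + 1) + C * (d + 3) ^ (d + 2)) * ‖x‖ ^ (d + 1) := by
    intro j
    have h1 := hC x (((j : ℕ) : ℝ) • y) (by nlinarith) ((hjn j).trans hxr.le)
    have h2 := hball (y := x + ((j : ℕ) : ℝ) • y)
      (by rw [dist_zero_right]; exact (hjn' j).trans_lt hxρ)
    rw [norm_pow, norm_norm] at h2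
    have h3 : B * ‖x + ((j : ℕ) : ℝ) • y‖ ^ (d + 1) ≤ B * ((d + 3) * ‖x‖) ^ (d + 1) := by
      gcongr; exact hjn' j
    have h4 : C * ‖((j : ℕ) : ℝ) • y‖ ^ (d + 1 + 1) ≤ C * ((d + 3) * ‖x‖) ^ (d + 1 + 1) := by
      gcongr; exact hjn j
    have h5 : C * ((d + 3) * ‖x‖) ^ (d + 1 + 1) ≤ C * (d + 3) ^ (d + 2) * ‖x‖ ^ (d + 1) := by
      rw [mul_pow, pow_succ ‖x‖, mul_assoc C]
      gcongr
      nlinarith [pow_nonneg hx0 (d + 1)]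
    have h6 : T j = f (x + ((j : ℕ) : ℝ) • y) - (f (x + ((j : ℕ) : ℝ) • y) - T j) := by abel
    rw [h6]
    refine (norm_sub_le _ _).trans ?_
    rw [mul_pow] at h3
    linarith
  have hfin : ‖fderiv ℝ f x y‖ ≤ M * ‖x‖ ^ (d + 1) := by
    rw [← hsum]
    refine (norm_sum_le _ _).trans ?_
    calc ∑ j, ‖w j • T j‖ ≤ ∑ j, |w j| *
          ((B * (d + 3) ^ (d + 1) + C * (d + 3) ^ (d + 2)) * ‖x‖ ^ (d + 1)) := by
          refine Finset.sum_le_sum fun j _ => ?_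
          rw [norm_smul, Real.norm_eq_abs]
          gcongr
          exact hTj j
      _ = _ := by rw [← Finset.sum_mul, hM]; ring
  rw [hy, map_smul, norm_smul, norm_norm, pow_succ] at hfin
  have : ‖x‖ * ‖fderiv ℝ f x v‖ ≤ ‖x‖ * (M * ‖x‖ ^ d) := by linarith
  exact le_of_mul_le_mul_left this hxpos

end Order

section Cone

open Asymptotics Filter

/-- Smooth away from the origin, with all derivatives vanishing to infinite order there. -/
structure FlatOff {E F : Type*} [NormedAddCommGroup E] [NormedSpace ℝ E]
    [NormedAddCommGroup F] [NormedSpace ℝ F] (f : E → F) : Prop where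
  zero : f 0 = 0
  smooth : ∀ x ≠ 0, ContDiffAt ℝ ∞ f x
  flat : ∀ k N : ℕ, iteratedFDeriv ℝ k f =O[𝓝[≠] 0] fun x => ‖x‖ ^ N

section

variable {E F : Type*} [NormedAddCommGroup E] [NormedSpace ℝ E]
  [NormedAddCommGroup F] [NormedSpace ℝ F] {f : E → F}

theorem FlatOff.hasFDerivAt_zero (hf : FlatOff f) : HasFDerivAt f (0 : E →L[ℝ] F) 0 := by
  refine IsBigO.hasFDerivAt (n := 2) ?_ one_lt_two
  have h := hf.flat 0 2
  have h2 : f =O[𝓝[≠] 0] fun x => ‖x‖ ^ 2 :=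
    (IsBigO.of_norm_left (h.norm_left.congr_left fun x => norm_iteratedFDeriv_zero))
  rw [← nhdsNE_sup_pure, isBigO_sup]
  refine ⟨by simpa using h2, ?_⟩
  rw [isBigO_pure]
  simp [hf.zero]

theorem FlatOff.fderiv (hf : FlatOff f) : FlatOff (fderiv ℝ f) where
  zero := hf.hasFDerivAt_zero.fderiv
  smooth x hx := (hf.smooth x hx).fderiv_right (m := ∞) (by simp)
  flat k N := by
    refine IsBigO.of_norm_left ?_
    simp_rw [norm_iteratedFDeriv_fderiv]
    exact (hf.flat (k + 1) N).norm_left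

theorem FlatOff.differentiable (hf : FlatOff f) : Differentiable ℝ f := fun x => by
  rcases eq_or_ne x 0 with rfl | hx
  · exact hf.hasFDerivAt_zero.differentiableAt
  · exact (hf.smooth x hx).differentiableAt (by simp)

end

theorem FlatOff.contDiff_nat.{v} (k : ℕ) {E : Type v} [NormedAddCommGroup E]
    [NormedSpace ℝ E] : ∀ {F : Type v} [NormedAddCommGroup F] [NormedSpace ℝ F]
    {f : E → F}, FlatOff f → ContDiff ℝ k f := by
  induction k with
  | zero => exact fun hf => contDiff_zero.2 hf.differentiable.continuous
  | succ k ih =>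
    intro F _ _ f hf
    exact contDiff_succ_iff_hasFDerivAt.2 ⟨_, ih hf.fderiv, fun x =>
      (hf.differentiable x).hasFDerivAt⟩

theorem FlatOff.contDiff.{v} {E F : Type v} [NormedAddCommGroup E]
    [NormedSpace ℝ E] [NormedAddCommGroup F] [NormedSpace ℝ F]
    {f : E → F} (hf : FlatOff f) : ContDiff ℝ ∞ f :=
  contDiff_infty.2 fun k => hf.contDiff_nat k

section

variable {E F : Type*} [NormedAddCommGroup E] [NormedSpace ℝ E]
  [NormedAddCommGroup F] [NormedSpace ℝ F] [CompleteSpace F]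

theorem ContDiff.iteratedFDeriv_isBigO {f : E → F} (hf : ContDiff ℝ ∞ f)
    (h : ∀ N : ℕ, f =O[𝓝 0] fun x => ‖x‖ ^ N) (k N : ℕ) :
    iteratedFDeriv ℝ k f =O[𝓝 0] fun x => ‖x‖ ^ N := by
  induction k generalizing N with
  | zero =>
    refine IsBigO.of_norm_left ?_
    simp_rw [norm_iteratedFDeriv_zero]
    exact (h N).norm_left
  | succ k ih =>
    have hs : ContDiff ℝ ∞ (iteratedFDeriv ℝ k f) :=
      hf.iteratedFDeriv_right (m := ∞) (i := k) (by exact_mod_cast le_top)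
    have := (hs.fderiv_isBigO_pow (ih (N + 1))).norm_left
    simp_rw [norm_fderiv_iteratedFDeriv] at this
    exact IsBigO.of_norm_left this

end

variable {E : Type*} [NormedAddCommGroup E] [NormedSpace ℝ E]

/-- Derivatives of functions that are homogeneous of degree zero. -/
theorem iteratedFDeriv_isBigO_of_homogeneous [FiniteDimensional ℝ E] {θ : E → ℝ}
    (hθ : ∀ x ≠ 0, ContDiffAt ℝ ∞ θ x) (hhom : ∀ t : ℝ, 0 < t → ∀ x, θ (t • x) = θ x) (j : ℕ) :
    iteratedFDeriv ℝ j θ =O[𝓝[≠] 0] fun x => (‖x‖ ^ j)⁻¹ := by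
  have hcont : ContinuousOn (iteratedFDeriv ℝ j θ) (Metric.sphere 0 1) := by
    intro x hx
    have hx0 : x ≠ 0 := fun h => by simp [h] at hx
    have h1 : ContDiffAt ℝ 0 (iteratedFDeriv ℝ j θ) x :=
      (hθ x hx0).iteratedFDeriv_right (m := 0) (i := j)
        (by rw [zero_add]; exact ENat.LEInfty.out)
    exact h1.continuousAt.continuousWithinAt
  obtain ⟨C, hC⟩ := (isCompact_sphere (0 : E) 1).exists_bound_of_continuousOn hcont
  refine IsBigO.of_bound C (eventually_nhdsWithin_of_forall fun x hx => ?_)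
  have hx0 : 0 < ‖x‖ := norm_pos_iff.2 hx
  set t := ‖x‖⁻¹ with ht
  have ht0 : 0 < t := inv_pos.2 hx0
  set g : E ≃L[ℝ] E := ContinuousLinearEquiv.smulLeft (Units.mk0 t ht0.ne') with hg
  have hgx : ∀ y, g y = t • y := fun y => rfl
  have e : θ = θ ∘ g := by funext y; simp [hgx, hhom t ht0]
  have key := g.iteratedFDerivWithin_comp_right θ (s := Set.univ) uniqueDiffOn_univ
    (x := x) (Set.mem_univ _) j
  simp only [Set.preimage_univ, iteratedFDerivWithin_univ] at key
  rw [← e] at key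
  rw [key]
  refine (ContinuousMultilinearMap.norm_compContinuousLinearMap_le _ _).trans ?_
  rw [Finset.prod_const, Finset.card_univ, Fintype.card_fin]
  have hgn : ‖(g : E →L[ℝ] E)‖ ≤ t := by
    refine ContinuousLinearMap.opNorm_le_bound _ ht0.le fun y => ?_
    change ‖t • y‖ ≤ _
    rw [norm_smul, Real.norm_eq_abs, abs_of_pos ht0]
  have hs : g x ∈ Metric.sphere (0 : E) 1 := by
    rw [hgx, mem_sphere_zero_iff_norm, norm_smul, Real.norm_eq_abs, abs_of_pos ht0, ht,
      inv_mul_cancel₀ hx0.ne']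
  have hb := hC _ hs
  have hC0 : 0 ≤ C := (norm_nonneg _).trans hb
  rw [norm_inv, norm_pow, norm_norm, ← inv_pow, ← ht]
  gcongr

theorem FlatOff.of_homogeneous_mul [FiniteDimensional ℝ E] {θ h : E → ℝ}
    (hθ : ∀ x ≠ 0, ContDiffAt ℝ ∞ θ x) (hhom : ∀ t : ℝ, 0 < t → ∀ x, θ (t • x) = θ x)
    (hh : ContDiff ℝ ∞ h) (hflat : ∀ N : ℕ, h =O[𝓝 0] fun x => ‖x‖ ^ N) :
    FlatOff (fun x => θ x * h x) where
  zero := by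
    have h0 : h 0 = 0 := by
      obtain ⟨C, hC⟩ := (hflat 1).bound
      have := hC.self_of_nhds
      simpa using this
    simp [h0]
  smooth x hx := (hθ x hx).mul hh.contDiffAt
  flat k N := by
    have hopen : IsOpen ({0}ᶜ : Set E) := isOpen_compl_singleton
    have hle : ∀ x ∈ ({0}ᶜ : Set E), ‖iteratedFDeriv ℝ k (fun x => θ x * h x) x‖ ≤
        ∑ i ∈ Finset.range (k + 1), (k.choose i : ℝ) * ‖iteratedFDeriv ℝ i θ x‖ *
          ‖iteratedFDeriv ℝ (k - i) h x‖ := by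
      intro x hx
      have := norm_iteratedFDerivWithin_mul_le (𝕜 := ℝ) (s := ({0}ᶜ : Set E)) (N := ∞)
        (f := θ) (g := h) (fun x hx => (hθ x hx).contDiffWithinAt) hh.contDiffOn
        hopen.uniqueDiffOn hx (n := k) ENat.LEInfty.out
      simpa only [iteratedFDerivWithin_of_isOpen _ hopen hx] using this
    have hbig : (fun x => ∑ i ∈ Finset.range (k + 1), (k.choose i : ℝ) * ‖iteratedFDeriv ℝ i θ x‖ *
          ‖iteratedFDeriv ℝ (k - i) h x‖) =O[𝓝[≠] 0] fun x => ‖x‖ ^ N := by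
      refine IsBigO.fun_sum fun i _ => ?_
      have h1 := (iteratedFDeriv_isBigO_of_homogeneous hθ hhom i).norm_left
      have h2 := ((hh.iteratedFDeriv_isBigO hflat (k - i) (N + i)).norm_left).mono
        (nhdsWithin_le_nhds (s := {0}ᶜ))
      refine ((h1.const_mul_left _).mul h2).trans_eventuallyEq
        (eventually_nhdsWithin_of_forall fun x hx => ?_)
      have hx0 : ‖x‖ ≠ 0 := norm_ne_zero_iff.2 hx
      simp only
      rw [pow_add]
      field_simp
    refine IsBigO.trans (IsBigO.of_bound 1 (eventually_nhdsWithin_of_forall fun x hx => ?_)) hbig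
    rw [one_mul]
    exact (hle x hx).trans (le_abs_self _)

/-- A flat function splits into two flat pieces supported in complementary cones. -/
theorem exists_cone_splitting {E : Type} [NormedAddCommGroup E] [NormedSpace ℝ E]
    [FiniteDimensional ℝ E] {a b : E → ℝ} (ha : ContDiff ℝ ∞ a) (hb : ContDiff ℝ ∞ b)
    (ha0 : ∀ x, 0 ≤ a x) (hb0 : ∀ x, 0 ≤ b x) (hpos : ∀ x ≠ 0, 0 < a x + b x)
    (hha : ∀ (t : ℝ) x, a (t • x) = t ^ 2 * a x) (hhb : ∀ (t : ℝ) x, b (t • x) = t ^ 2 * b x)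
    {h : E → ℝ} (hh : ContDiff ℝ ∞ h) (hflat : ∀ N : ℕ, h =O[𝓝 0] fun x => ‖x‖ ^ N) :
    ∃ θ : E → ℝ, ContDiff ℝ ∞ (fun x => θ x * h x) ∧ (∀ x, 0 ≤ θ x) ∧ (∀ x, θ x ≤ 1) ∧
      (∀ x, a x ≤ b x / 4 → θ x = 0) ∧ (∀ x ≠ 0, b x ≤ a x / 4 → θ x = 1) := by
  set s : E → ℝ := fun x => (a x / (a x + b x) - 1 / 5) / (3 / 5)
  have hs : ∀ x ≠ 0, ContDiffAt ℝ ∞ s x := fun x hx =>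
    ((ha.contDiffAt.div (ha.contDiffAt.add hb.contDiffAt) (hpos x hx).ne').sub
      contDiffAt_const).div_const _
  have hθ : ∀ x ≠ 0, ContDiffAt ℝ ∞ (fun x => Real.smoothTransition (s x)) x := fun x hx =>
    Real.smoothTransition.contDiffAt.comp x (hs x hx)
  have hhom : ∀ t : ℝ, 0 < t → ∀ x, Real.smoothTransition (s (t • x)) =
      Real.smoothTransition (s x) := by
    intro t ht x
    simp only [s, hha, hhb]
    rw [← mul_add, mul_div_mul_left _ _ (by positivity)]
  refine ⟨fun x => Real.smoothTransition (s x),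
    (FlatOff.of_homogeneous_mul hθ hhom hh hflat).contDiff,
    fun x => Real.smoothTransition.nonneg _, fun x => Real.smoothTransition.le_one _,
    fun x hx => Real.smoothTransition.zero_of_nonpos ?_,
    fun x hx0 hx => Real.smoothTransition.one_of_one_le ?_⟩
  · have h1 : a x / (a x + b x) ≤ 1 / 5 :=
      div_le_of_le_mul₀ (add_nonneg (ha0 x) (hb0 x)) (by norm_num) (by linarith)
    simp only [s]
    apply div_nonpos_of_nonpos_of_nonneg <;> linarith
  · have h1 : 4 / 5 ≤ a x / (a x + b x) := by
      rw [le_div_iff₀ (hpos x hx0)]; linarith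
    simp only [s]
    rw [le_div_iff₀ (by norm_num)]
    linarith

end Cone

section Germ

open Asymptotics Filter

variable {E F : Type*} [NormedAddCommGroup E] [NormedSpace ℝ E]
  [NormedAddCommGroup F] [NormedSpace ℝ F]

/-- Local inverse of a smooth germ with invertible derivative. -/
theorem exists_openPartialHomeomorph_of_smooth [CompleteSpace E] {φ : E → E}
    (hφ : ∀ᶠ x in 𝓝 (0 : E), ContDiffAt ℝ ∞ φ x) {e' : E ≃L[ℝ] E}
    (he' : HasFDerivAt φ (e' : E →L[ℝ] E) 0) {s : Set E} (hs : s ∈ 𝓝 (0 : E)) :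
    ∃ e : OpenPartialHomeomorph E E, (e : E → E) = φ ∧ (0 : E) ∈ e.source ∧ e.source ⊆ s ∧
      (∀ x ∈ e.source, ContDiffAt ℝ ∞ φ x) ∧ ∀ y ∈ e.target, ContDiffAt ℝ ∞ e.symm y := by
  have h0 : ContDiffAt ℝ ∞ φ 0 := hφ.self_of_nhds
  set e := h0.toOpenPartialHomeomorph φ he' (by simp) with he
  have hcont : ContinuousAt (fderiv ℝ φ) 0 :=
    (h0.fderiv_right (m := ∞) (by simp)).continuousAt
  have hinv : ∀ᶠ x in 𝓝 (0 : E), fderiv ℝ φ x ∈ Set.range ((↑) : (E ≃L[ℝ] E) → E →L[ℝ] E) := by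
    refine hcont.eventually_mem (ContinuousLinearEquiv.isOpen.mem_nhds ⟨e', ?_⟩)
    exact he'.fderiv.symm
  obtain ⟨t, ht, hto, ht0⟩ := mem_nhds_iff.1 (hφ.and (hinv.and hs))
  have hc : (e : E → E) = φ := h0.toOpenPartialHomeomorph_coe he' (by simp)
  refine ⟨e.restrOpen t hto, by simpa using hc, ?_, ?_, ?_, ?_⟩
  · simpa using ⟨h0.mem_toOpenPartialHomeomorph_source he' (by simp), ht0⟩
  · intro x hx
    simp only [OpenPartialHomeomorph.restrOpen_source] at hx
    exact (ht hx.2).2.2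
  · intro x hx
    simp only [OpenPartialHomeomorph.restrOpen_source] at hx
    exact (ht hx.2).1
  · intro y hy
    have hx := (e.restrOpen t hto).map_target hy
    simp only [OpenPartialHomeomorph.restrOpen_source] at hx
    obtain ⟨h1, ⟨L, hL⟩, -⟩ := ht hx.2
    refine (e.restrOpen t hto).contDiffAt_symm hy (f₀' := L) ?_ ?_
    · change HasFDerivAt (e : E → E) _ _
      rw [hc, hL]
      exact (h1.differentiableAt (by simp)).hasFDerivAt
    · change ContDiffAt ℝ ∞ (e : E → E) _
      rw [hc]
      exact h1

/-- A smooth germ extends to a global smooth function. -/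
theorem exists_contDiff_eventuallyEq [FiniteDimensional ℝ E] {f : E → F}
    (hf : ∀ᶠ x in 𝓝 (0 : E), ContDiffAt ℝ ∞ f x) : ∃ g : E → F, ContDiff ℝ ∞ g ∧ g =ᶠ[𝓝 0] f := by
  obtain ⟨r, hr, h⟩ := Metric.eventually_nhds_iff_ball.1 hf
  let χ : ContDiffBump (0 : E) := ⟨r / 3, r / 2, by positivity, by linarith⟩
  refine ⟨fun x => χ x • f x, contDiff_iff_contDiffAt.2 fun x => ?_, ?_⟩
  · by_cases hx : x ∈ Metric.ball (0 : E) r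
    · exact χ.contDiffAt.smul (h x hx)
    · have hx' : x ∉ tsupport χ := by
        rw [χ.tsupport_eq]
        simp only [Metric.mem_ball, not_lt, Metric.mem_closedBall, not_le] at hx ⊢
        exact lt_of_lt_of_le (by change r / 2 < r; linarith) hx
      have : (fun x => χ x • f x) =ᶠ[𝓝 x] fun _ => 0 := by
        filter_upwards [notMem_tsupport_iff_eventuallyEq.1 hx'] with y hy
        simp [hy]
      exact contDiffAt_const.congr_of_eventuallyEq this
  · filter_upwards [χ.eventuallyEq_one] with x hx
    simp [hx]

end Germ

section Symp

open Asymptotics Filter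

variable {E : Type*} [NormedAddCommGroup E] [NormedSpace ℝ E]

/-- `Ω` is a nondegenerate skew form, and `J` is the inverse of `u ↦ Ω u`. -/
structure SympPair (Ω : E →L[ℝ] E →L[ℝ] ℝ) (J : (E →L[ℝ] ℝ) →L[ℝ] E) : Prop where
  skew : ∀ u v, Ω u v = -Ω v u
  form_apply : ∀ f v, Ω (J f) v = f v
  apply_form : ∀ u, J (Ω u) = u

/-- The germs of the vector fields `X` and `Y` at the origin are conjugate by a smooth map
preserving `Ω`. -/
def SympConj (Ω : E →L[ℝ] E →L[ℝ] ℝ) (X Y : E → E) : Prop :=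
  ∃ φ : E → E, φ 0 = 0 ∧ ∀ᶠ x in 𝓝 (0 : E), ContDiffAt ℝ ∞ φ x ∧
    (∀ u v, Ω (fderiv ℝ φ x u) (fderiv ℝ φ x v) = Ω u v) ∧ fderiv ℝ φ x (Y x) = X (φ x)

variable {Ω : E →L[ℝ] E →L[ℝ] ℝ} {J : (E →L[ℝ] ℝ) →L[ℝ] E}

theorem SympConj.trans {X Y Z : E → E} (h₁ : SympConj Ω X Y) (h₂ : SympConj Ω Y Z) :
    SympConj Ω X Z := by
  obtain ⟨φ, hφ0, hφ⟩ := h₁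
  obtain ⟨ψ, hψ0, hψ⟩ := h₂
  refine ⟨φ ∘ ψ, by simp [hφ0, hψ0], ?_⟩
  have hc : Tendsto ψ (𝓝 0) (𝓝 0) := by
    have := hψ.self_of_nhds.1.continuousAt.tendsto
    rwa [hψ0] at this
  filter_upwards [hψ, hc.eventually hφ] with x ⟨h1, h2, h3⟩ ⟨k1, k2, k3⟩
  have hd : fderiv ℝ (φ ∘ ψ) x = (fderiv ℝ φ (ψ x)).comp (fderiv ℝ ψ x) :=
    fderiv_comp x (k1.differentiableAt (by simp)) (h1.differentiableAt (by simp))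
  refine ⟨k1.comp x h1, fun u v => ?_, ?_⟩
  · simp [hd, k2, h2]
  · simp [hd, h3, k3]

theorem SympConj.congr {X X' Y Y' : E → E} (h : SympConj Ω X Y) (hX : X =ᶠ[𝓝 0] X')
    (hY : Y =ᶠ[𝓝 0] Y') : SympConj Ω X' Y' := by
  obtain ⟨φ, hφ0, hφ⟩ := h
  refine ⟨φ, hφ0, ?_⟩
  have hc : Tendsto φ (𝓝 0) (𝓝 0) := by
    have := hφ.self_of_nhds.1.continuousAt.tendsto
    rwa [hφ0] at this
  filter_upwards [hφ, hc.eventually hX, hY] with x ⟨h1, h2, h3⟩ k1 k2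
  exact ⟨h1, h2, by rw [← k2, ← k1, h3]⟩

namespace SympPair

variable (P : SympPair Ω J)
include P

theorem eq_of_form_eq {u v : E} (h : ∀ w, Ω u w = Ω v w) : u = v := by
  rw [← P.apply_form u, ← P.apply_form v, ContinuousLinearMap.ext h]

theorem injective_of_symplectic {L : E →L[ℝ] E} (h : ∀ u v, Ω (L u) (L v) = Ω u v) :
    Function.Injective L := fun u v huv => P.eq_of_form_eq fun w => by rw [← h u, ← h v, huv]

theorem surjective_of_symplectic [FiniteDimensional ℝ E] {L : E →L[ℝ] E}
    (h : ∀ u v, Ω (L u) (L v) = Ω u v) : Function.Surjective L :=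
  LinearMap.surjective_of_injective (f := (L : E →ₗ[ℝ] E)) (P.injective_of_symplectic h)

theorem apply_eq_of_form [FiniteDimensional ℝ E] {L : E →L[ℝ] E}
    (h : ∀ u v, Ω (L u) (L v) = Ω u v) {x y : E} (hxy : ∀ v, Ω y (L v) = Ω x v) : L x = y := by
  refine P.eq_of_form_eq fun w => ?_
  obtain ⟨v, rfl⟩ := P.surjective_of_symplectic h w
  rw [h, hxy]

omit P in
theorem hasFDerivAt_gradient {G : E → ℝ} (hG : ContDiff ℝ ∞ G) (x : E) :
    HasFDerivAt (fun x => J (fderiv ℝ G x)) (J.comp (fderiv ℝ (fderiv ℝ G) x)) x :=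
  J.hasFDerivAt.comp x (((hG.fderiv_right (m := ∞) (by simp)).differentiable
    (by simp)) x).hasFDerivAt

omit P in
theorem contDiff_gradient {G : E → ℝ} (hG : ContDiff ℝ ∞ G) :
    ContDiff ℝ ∞ (fun x => J (fderiv ℝ G x)) :=
  J.contDiff.comp (hG.fderiv_right (m := ∞) (by simp))

omit P in
theorem symm_fderiv_fderiv {G : E → ℝ} (hG : ContDiff ℝ ∞ G) (x u v : E) :
    fderiv ℝ (fderiv ℝ G) x u v = fderiv ℝ (fderiv ℝ G) x v u :=
  hG.contDiffAt.isSymmSndFDerivAt (by simp; exact ENat.LEInfty.out) u v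

theorem gradient_skew {G : E → ℝ} (hG : ContDiff ℝ ∞ G) (x u v : E) :
    Ω (fderiv ℝ (fun x => J (fderiv ℝ G x)) x u) v +
      Ω u (fderiv ℝ (fun x => J (fderiv ℝ G x)) x v) = 0 := by
  rw [(hasFDerivAt_gradient hG x).fderiv, P.skew u]
  simp only [ContinuousLinearMap.comp_apply, P.form_apply]
  rw [symm_fderiv_fderiv hG x u v]
  ring

theorem fderiv_gradient_comp [FiniteDimensional ℝ E] {φ : E → E} {H : E → ℝ} {x : E}
    (hφ : DifferentiableAt ℝ φ x) (hH : DifferentiableAt ℝ H (φ x))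
    (hs : ∀ u v, Ω (fderiv ℝ φ x u) (fderiv ℝ φ x v) = Ω u v) :
    fderiv ℝ φ x (J (fderiv ℝ (fun y => H (φ y)) x)) = J (fderiv ℝ H (φ x)) := by
  refine P.apply_eq_of_form hs fun v => ?_
  rw [P.form_apply, P.form_apply, show (fun y => H (φ y)) = H ∘ φ from rfl, fderiv_comp x hH hφ]
  rfl

end SympPair

/-- The discrepancy in the Hamilton–Jacobi equation for the symplectic map generated by `G`,
between the primitives `½ Ω x + dH` and `½ Ω x + dK`. -/
noncomputable def hjDefect (J : (E →L[ℝ] ℝ) →L[ℝ] E) (H G K : E → ℝ) (m : E) : ℝ :=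
  H (m + (1 / 2 : ℝ) • J (fderiv ℝ G m)) - K (m - (1 / 2 : ℝ) • J (fderiv ℝ G m)) + G m -
    (1 / 2 : ℝ) * fderiv ℝ G m m

theorem contDiff_hjDefect {H G K : E → ℝ} (hH : ContDiff ℝ ∞ H) (hG : ContDiff ℝ ∞ G)
    (hK : ContDiff ℝ ∞ K) : ContDiff ℝ ∞ (hjDefect J H G K) := by
  have hg := SympPair.contDiff_gradient (J := J) hG
  have hG' : ContDiff ℝ ∞ (fderiv ℝ G) := hG.fderiv_right (m := ∞) (by simp)
  refine (((hH.comp (contDiff_id.add (hg.const_smul _))).sub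
    (hK.comp (contDiff_id.sub (hg.const_smul _)))).add hG).sub
      (contDiff_const.mul (hG'.clm_apply contDiff_id))

theorem SympPair.exists_sympConj_of_hjDefect_flat [FiniteDimensional ℝ E] (P : SympPair Ω J)
    {H G K : E → ℝ} (hH : ContDiff ℝ ∞ H) (hG : ContDiff ℝ ∞ G) (hK : ContDiff ℝ ∞ K)
    (hG1 : fderiv ℝ G 0 = 0) (hG2 : fderiv ℝ (fderiv ℝ G) 0 = 0)
    (hflat : ∀ N : ℕ, hjDefect J H G K =O[𝓝 0] fun x => ‖x‖ ^ N) :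
    ∃ h : E → ℝ, ContDiff ℝ ∞ h ∧ (∀ N : ℕ, h =O[𝓝 0] fun x => ‖x‖ ^ N) ∧
      SympConj Ω (fun x => (1 / 2 : ℝ) • x + J (fderiv ℝ H x))
        (fun x => (1 / 2 : ℝ) • x + J (fderiv ℝ K x) + J (fderiv ℝ h x)) := by
  have : CompleteSpace E := FiniteDimensional.complete ℝ E
  set g : E → E := fun x => J (fderiv ℝ G x) with hg
  set B : E → E →L[ℝ] E := fun x => J.comp (fderiv ℝ (fderiv ℝ G) x) with hB
  have hgd : ∀ x, HasFDerivAt g (B x) x := fun x => SympPair.hasFDerivAt_gradient hG x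
  have hgs : ContDiff ℝ ∞ g := SympPair.contDiff_gradient hG
  set a : E → E := fun m => m - (1 / 2 : ℝ) • g m with ha
  set b : E → E := fun m => m + (1 / 2 : ℝ) • g m with hb
  have has : ContDiff ℝ ∞ a := contDiff_id.sub (hgs.const_smul _)
  have hbs : ContDiff ℝ ∞ b := contDiff_id.add (hgs.const_smul _)
  have had : ∀ x, HasFDerivAt a (ContinuousLinearMap.id ℝ E - (1 / 2 : ℝ) • B x) x := fun x =>
    (hasFDerivAt_id x).sub ((hgd x).const_smul _)
  have hbd : ∀ x, HasFDerivAt b (ContinuousLinearMap.id ℝ E + (1 / 2 : ℝ) • B x) x := fun x =>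
    (hasFDerivAt_id x).add ((hgd x).const_smul _)
  have hg0 : g 0 = 0 := by simp [hg, hG1]
  have ha0 : a 0 = 0 := by simp [ha, hg0]
  have hB0 : B 0 = 0 := by simp [hB, hG2]
  have hBskew : ∀ x u v, Ω (B x u) v = fderiv ℝ (fderiv ℝ G) x u v := fun x u v => by
    simp [hB, P.form_apply]
  have hBskew' : ∀ x u v, Ω u (B x v) = - fderiv ℝ (fderiv ℝ G) x v u := fun x u v => by
    rw [P.skew, hBskew]
  have hgΩ : ∀ x v, Ω (g x) v = fderiv ℝ G x v := fun x v => by simp [hg, P.form_apply]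
  obtain ⟨e, hea, he0, -, hes, het⟩ := exists_openPartialHomeomorph_of_smooth (φ := a)
    (e' := ContinuousLinearEquiv.refl ℝ E) (Eventually.of_forall fun x => has.contDiffAt)
    (by simpa [hB0] using had 0) Filter.univ_mem
  have h0t : (0 : E) ∈ e.target := by
    have := e.map_source he0
    rwa [hea, ha0] at this
  have hs0 : e.symm 0 = 0 := by
    have := e.left_inv he0
    rwa [hea, ha0] at this
  have htn : e.target ∈ 𝓝 (0 : E) := e.open_target.mem_nhds h0t
  set F := hjDefect J H G K with hF
  have hFs : ContDiff ℝ ∞ F := contDiff_hjDefect hH hG hK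
  obtain ⟨h, hhs, hhe⟩ := exists_contDiff_eventuallyEq (f := F ∘ e.symm) (by
    filter_upwards [htn] with y hy
    exact hFs.contDiffAt.comp y (het y hy))
  refine ⟨h, hhs, fun N => ?_, b ∘ e.symm, by simp [hs0, hb, hg0], ?_⟩
  · have h1 : e.symm =O[𝓝 0] fun x : E => x := by
      have := ((het 0 h0t).differentiableAt (by simp)).isBigO_sub
      simpa [hs0] using this
    have h2 : Tendsto e.symm (𝓝 0) (𝓝 0) := by
      have := (het 0 h0t).continuousAt.tendsto
      rwa [hs0] at this
    exact (hhe.trans_isBigO ((hflat N).comp_tendsto h2)).trans (h1.norm_norm.pow N)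
  filter_upwards [htn, hhe.eventuallyEq_nhds] with x hx hhx
  set y := e.symm x with hy
  have hax : a y = x := by rw [← hea]; exact e.right_inv hx
  have hsd : HasFDerivAt e.symm (fderiv ℝ e.symm x) x :=
    ((het x hx).differentiableAt (by simp)).hasFDerivAt
  set L := fderiv ℝ e.symm x with hL
  have hDa : ∀ v, L v - (1 / 2 : ℝ) • B y (L v) = v := by
    have h1 : HasFDerivAt (a ∘ e.symm) ((ContinuousLinearMap.id ℝ E - (1 / 2 : ℝ) • B y).comp L)
        x :=
      (had y).comp x hsd
    have h2 : HasFDerivAt (a ∘ e.symm) (ContinuousLinearMap.id ℝ E) x := by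
      refine (hasFDerivAt_id x).congr_of_eventuallyEq ?_
      filter_upwards [e.open_target.mem_nhds hx] with z hz
      rw [Function.comp_apply, ← hea]
      exact e.right_inv hz
    intro v
    simpa using DFunLike.congr_fun (h1.unique h2) v
  have hφd : fderiv ℝ (b ∘ e.symm) x = (ContinuousLinearMap.id ℝ E + (1 / 2 : ℝ) • B y).comp L :=
    ((hbd y).comp x hsd).fderiv
  have hφv : ∀ v, fderiv ℝ (b ∘ e.symm) x v = L v + (1 / 2 : ℝ) • B y (L v) := fun v => by
    simp [hφd]
  have hsymp : ∀ u v, Ω (fderiv ℝ (b ∘ e.symm) x u) (fderiv ℝ (b ∘ e.symm) x v) = Ω u v := by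
    intro u v
    rw [hφv, hφv]
    have h1 : Ω u v = Ω (L u - (1 / 2 : ℝ) • B y (L u)) (L v - (1 / 2 : ℝ) • B y (L v)) := by
      rw [hDa, hDa]
    rw [h1]
    simp only [map_add, map_sub, map_smul, _root_.add_apply, _root_.sub_apply,
      _root_.smul_apply, smul_eq_mul, hBskew, hBskew']
    rw [SympPair.symm_fderiv_fderiv hG y (L v) (L u)]
    ring
  refine ⟨hbs.contDiffAt.comp x (het x hx), hsymp, P.apply_eq_of_form hsymp fun v => ?_⟩
  have hG' := ((hG.fderiv_right (m := ∞) (by simp)).differentiable (by simp) y).hasFDerivAt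
  have hFd : ∀ w, fderiv ℝ F y w = fderiv ℝ H (b y) (w + (1 / 2 : ℝ) • B y w) -
      fderiv ℝ K (a y) (w - (1 / 2 : ℝ) • B y w) + fderiv ℝ G y w -
      (1 / 2) * (fderiv ℝ (fderiv ℝ G) y w y + fderiv ℝ G y w) := by
    intro w
    have k1 := ((hH.differentiable (by simp) (b y)).hasFDerivAt).comp y (hbd y)
    have k2 := ((hK.differentiable (by simp) (a y)).hasFDerivAt).comp y (had y)
    have k3 := (hG.differentiable (by simp) y).hasFDerivAt
    have k4 := (hG'.clm_apply (hasFDerivAt_id y)).const_mul (1 / 2 : ℝ)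
    have k5 : HasFDerivAt F _ y := ((k1.sub k2).add k3).sub k4
    rw [k5.fderiv]
    simp only [_root_.add_apply, _root_.sub_apply, _root_.smul_apply,
      ContinuousLinearMap.comp_apply, ContinuousLinearMap.id_apply, smul_eq_mul,
      ContinuousLinearMap.flip_apply, id_eq]
    ring
  have hhd : fderiv ℝ h x = (fderiv ℝ F y).comp L := by
    rw [hhx.fderiv_eq]
    exact ((hFs.differentiable (by simp) y).hasFDerivAt.comp x hsd).fderiv
  rw [hφv]
  simp only [Function.comp_apply, map_add, map_smul, _root_.add_apply,
      _root_.smul_apply, smul_eq_mul, P.form_apply, hhd,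
      ContinuousLinearMap.comp_apply]
  rw [hFd, hax]
  set w := L v with hw
  have hv : v = w - (1 / 2 : ℝ) • B y w := (hDa v).symm
  have hb' : b y = y + (1 / 2 : ℝ) • g y := rfl
  have hx' : x = y - (1 / 2 : ℝ) • g y := hax.symm
  have e1 : Ω x v = Ω y w - 1 / 2 * Ω y (B y w) - 1 / 2 * Ω (g y) w +
      1 / 4 * Ω (g y) (B y w) := by
    rw [hv, hx']
    simp only [map_sub, map_smul, _root_.sub_apply, _root_.smul_apply, smul_eq_mul]
    ring
  have e2 : fderiv ℝ K x v = fderiv ℝ K x (w - (1 / 2 : ℝ) • B y w) := by rw [← hv]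
  rw [e1, e2, ← hy, hb']
  simp only [map_add, map_smul, _root_.add_apply,
      _root_.smul_apply, smul_eq_mul, hBskew', hgΩ]
  ring

end Symp

section Lin

open Module

theorem LinearMap.aeval_lcomp_apply {E : Type*} [AddCommGroup E] [Module ℝ E] (S : E →ₗ[ℝ] E)
    (p : Polynomial ℝ) (z : E →ₗ[ℝ] ℂ) :
    Polynomial.aeval (LinearMap.lcomp ℂ ℂ S : End ℂ (E →ₗ[ℝ] ℂ)) (p.map (algebraMap ℝ ℂ)) z =
      z ∘ₗ Polynomial.aeval (R := ℝ) (A := End ℝ E) S p := by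
  induction p using Polynomial.induction_on' with
  | add p q hp hq =>
    rw [Polynomial.map_add, map_add, map_add, LinearMap.comp_add, ← hp, ← hq]
    rfl
  | monomial n a =>
    have h : ∀ n : ℕ, ((LinearMap.lcomp ℂ ℂ S : End ℂ (E →ₗ[ℝ] ℂ)) ^ n) z =
        z ∘ₗ ((S : End ℝ E) ^ n) := by
      intro n
      induction n generalizing z with
      | zero => ext; simp
      | succ n ih =>
        rw [pow_succ, Module.End.mul_apply, ih, pow_succ']
        ext
        simp
    ext x
    simp [Polynomial.aeval_monomial, h]

/-- A semisimple real endomorphism has a spanning family of complex eigenfunctionals. -/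
theorem Module.End.IsSemisimple.exists_eigenfunctionals {E : Type*} [AddCommGroup E] [Module ℝ E]
    [FiniteDimensional ℝ E] {S : E →ₗ[ℝ] E} (hS : End.IsSemisimple S) :
    ∃ (n : ℕ) (z : Fin n → E →ₗ[ℝ] ℂ) (l : Fin n → ℂ), (∀ i x, z i (S x) = l i * z i x) ∧
      (∀ i, z i ≠ 0) ∧
      ∀ f : E →ₗ[ℝ] ℂ, ∃ c : Fin n → ℂ, ∀ x, f x = ∑ i, c i * z i x := by
  set T : End ℂ (E →ₗ[ℝ] ℂ) := LinearMap.lcomp ℂ ℂ S with hT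
  have hTs : T.IsSemisimple := by
    have h1 := hS.minpoly_squarefree
    rw [← PerfectField.separable_iff_squarefree] at h1
    refine Module.End.isSemisimple_of_squarefree_aeval_eq_zero
      (h1.map (f := algebraMap ℝ ℂ)).squarefree ?_
    ext z x
    rw [hT, LinearMap.aeval_lcomp_apply, minpoly.aeval]
    simp
  have htop := hTs.iSup_eigenspace_eq_top
  set s : Set (E →ₗ[ℝ] ℂ) := ⋃ μ, (T.eigenspace μ : Set (E →ₗ[ℝ] ℂ)) with hs
  have hspan : Submodule.span ℂ s = ⊤ := by
    rw [eq_top_iff, ← htop, iSup_le_iff]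
    exact fun μ => (Set.subset_iUnion (fun μ => (T.eigenspace μ : Set (E →ₗ[ℝ] ℂ))) μ).trans
      Submodule.subset_span
  obtain ⟨b, hbs, hb, hli⟩ := exists_linearIndependent ℂ s
  have hfin : b.Finite := hli.setFinite
  have := hfin.fintype
  let e := (Fintype.equivFin b).symm
  have hl : ∀ i, ∃ μ, (e i : E →ₗ[ℝ] ℂ) ∈ T.eigenspace μ := fun i =>
    Set.mem_iUnion.1 (hbs (e i).2)
  choose l hl using hl
  refine ⟨Fintype.card b, fun i => e i, l, fun i x => ?_,
    fun i => hli.ne_zero (e i), fun f => ?_⟩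
  · exact DFunLike.congr_fun (Module.End.mem_eigenspace_iff.1 (hl i)) x
  · have hf : f ∈ Submodule.span ℂ (Set.range fun i => (e i : E →ₗ[ℝ] ℂ)) := by
      have : Set.range (fun i => (e i : E →ₗ[ℝ] ℂ)) = b := by
        rw [show (fun i => (e i : E →ₗ[ℝ] ℂ)) = Subtype.val ∘ e from rfl, e.surjective.range_comp]
        simp
      rw [this, hb, hspan]
      trivial
    obtain ⟨c, hc⟩ := (Submodule.mem_span_range_iff_exists_fun ℂ).1 hf
    exact ⟨c, fun x => by rw [← hc]; simp⟩

variable {E : Type*} [NormedAddCommGroup E] [NormedSpace ℝ E] [FiniteDimensional ℝ E]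
  {Ω : E →L[ℝ] E →L[ℝ] ℝ} {J : (E →L[ℝ] ℝ) →L[ℝ] E}

/-- The semisimple part of a conformal endomorphism is conformal. -/
theorem SympPair.conformal_of_isSemisimple (P : SympPair Ω J) {A S N : E →ₗ[ℝ] E}
    (hA : ∀ u v, Ω (A u) v + Ω u (A v) = Ω u v) (hSN : A = S + N)
    (hS : End.IsSemisimple S) (hN : IsNilpotent N) (hc : Commute S N) (u v : E) :
    Ω (S u) v + Ω u (S v) = Ω u v := by
  have hadj : ∀ T : End ℝ E, ∃ T' : End ℝ E, ∀ u v, Ω (T' u) v = Ω u (T v) := fun T =>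
    ⟨{ toFun := fun u => J ((Ω u).comp (LinearMap.toContinuousLinearMap T))
       map_add' := fun u v => by rw [map_add, ContinuousLinearMap.add_comp, map_add]
       map_smul' := fun c u => by rw [map_smul, ContinuousLinearMap.smul_comp, map_smul]; rfl },
      fun u v => by simp [P.form_apply]⟩
  obtain ⟨S', hS'⟩ := hadj S
  obtain ⟨N', hN'⟩ := hadj N
  have hpow : ∀ T T' : End ℝ E, (∀ u v, Ω (T' u) v = Ω u (T v)) → ∀ (n : ℕ) u v,
      Ω ((T' ^ n) u) v = Ω u ((T ^ n) v) := by
    intro T T' h n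
    induction n with
    | zero => simp
    | succ n ih =>
      intro u v
      rw [pow_succ, pow_succ', Module.End.mul_apply, Module.End.mul_apply, ih, h]
  have hpoly : ∀ (p : Polynomial ℝ) u v, Ω (Polynomial.aeval S' p u) v =
      Ω u (Polynomial.aeval (R := ℝ) (A := End ℝ E) S p v) := by
    intro p
    induction p using Polynomial.induction_on' with
    | add p q hp hq => intro u v; simp [hp, hq]
    | monomial n a => intro u v; simp [Polynomial.aeval_monomial, hpow S S' hS']
  have hS's : S'.IsSemisimple := by
    refine Module.End.isSemisimple_of_squarefree_aeval_eq_zero hS.minpoly_squarefree ?_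
    ext u
    refine P.eq_of_form_eq fun w => ?_
    rw [hpoly, minpoly.aeval]
    simp
  have hN'n : IsNilpotent N' := by
    obtain ⟨k, hk⟩ := hN
    refine ⟨k, ?_⟩
    ext u
    refine P.eq_of_form_eq fun w => ?_
    rw [hpow N N' hN', hk]
    simp
  have hc' : Commute S' N' := by
    refine LinearMap.ext fun u => P.eq_of_form_eq fun w => ?_
    rw [Module.End.mul_apply, Module.End.mul_apply, hS', hN', hN', hS']
    exact congrArg (Ω u) (DFunLike.congr_fun hc.eq w).symm
  have h1s : (1 - S : End ℝ E).IsSemisimple :=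
    (Module.End.isSemisimple_id (R := ℝ) (M := E)).sub_of_commute (Commute.one_left S) hS
  have := (Module.End.isNilpotent_isSemisimple_unique (n₁ := N') (s₁ := S') (n₂ := -N)
    (s₂ := 1 - S) hN'n hS's hN.neg h1s hc'.symm
    ((Commute.one_right (-N)).sub_right hc.symm.neg_left) (by
      refine LinearMap.ext fun u => P.eq_of_form_eq fun w => ?_
      have := hA u w
      rw [hSN] at this
      simp only [LinearMap.add_apply, map_add, _root_.add_apply] at this
      simp only [LinearMap.add_apply, map_add, _root_.add_apply, LinearMap.neg_apply,
        LinearMap.sub_apply, Module.End.one_apply, map_sub, map_neg, _root_.sub_apply,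
        _root_.neg_apply, hS', hN']
      linarith)).2
  rw [← hS', this]
  simp

/-- Spanning complex coordinates which are eigenfunctionals of `S` and on which `N` acts as a
shift, up to a factor `δ`. -/
structure SpectralCoords (S N : E →ₗ[ℝ] E) (δ : ℝ) {n K : ℕ} (z : Fin n × Fin K → E →L[ℝ] ℂ)
    (l : Fin n → ℂ) : Prop where
  eig : ∀ i x, z i (S x) = l i.1 * z i x
  shift : ∀ i (k : Fin K) x, z (i, k) (N x) =
    δ * (if h : (k : ℕ) + 1 < K then z (i, ⟨k + 1, h⟩) x else 0)
  span : ∀ f : E →ₗ[ℝ] ℂ, ∃ c : Fin n × Fin K → ℂ, ∀ x, f x = ∑ i, c i * z i x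

theorem exists_spectralCoords {S N : E →ₗ[ℝ] E} (hS : End.IsSemisimple S) (hN : IsNilpotent N)
    (hc : Commute S N) {δ : ℝ} (hδ : δ ≠ 0) :
    ∃ (n K : ℕ) (z : Fin n × Fin K → E →L[ℝ] ℂ) (l : Fin n → ℂ), SpectralCoords S N δ z l ∧
      ∀ i, ∃ y : E →ₗ[ℝ] ℂ, y ≠ 0 ∧ ∀ x, y (S x + N x) = l i * y x := by
  obtain ⟨n, z, l, hz, hz0, hspan⟩ := hS.exists_eigenfunctionals
  obtain ⟨K, hK⟩ := hN
  have hδ' : (δ : ℂ) ≠ 0 := Complex.ofReal_ne_zero.2 hδ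
  have hcomm : ∀ (k : ℕ) x, (N ^ k) (S x) = S ((N ^ k) x) := fun k x =>
    (DFunLike.congr_fun (hc.pow_right k).eq x).symm
  have hK1 : N ^ (K + 1) = 0 := by rw [pow_succ, hK, zero_mul]
  have hsuc : ∀ (k : ℕ) x, (N ^ k) (N x) = (N ^ (k + 1)) x := fun k x => by
    rw [pow_succ]; rfl
  refine ⟨n, K + 1, fun i => LinearMap.toContinuousLinearMap
    (((δ : ℂ)⁻¹ ^ (i.2 : ℕ)) • (z i.1 ∘ₗ (N ^ (i.2 : ℕ)))), l, ⟨?_, ?_, ?_⟩, ?_⟩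
  · intro i x
    simp only [LinearMap.coe_toContinuousLinearMap', LinearMap.smul_apply,
      LinearMap.comp_apply, smul_eq_mul, hcomm, hz]
    ring
  · intro i k x
    simp only [LinearMap.coe_toContinuousLinearMap', LinearMap.smul_apply,
      LinearMap.comp_apply, smul_eq_mul, hsuc]
    split_ifs with h
    · rw [pow_succ (δ : ℂ)⁻¹]
      field_simp
    · have : (k : ℕ) + 1 = K + 1 := by omega
      rw [this, hK1]
      simp
  · intro f
    obtain ⟨c, hc⟩ := hspan f
    refine ⟨fun i => if (i.2 : ℕ) = 0 then c i.1 else 0, fun x => ?_⟩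
    rw [hc, Fintype.sum_prod_type]
    refine Finset.sum_congr rfl fun i _ => ?_
    rw [Fin.sum_univ_succ]
    simp
  · intro i
    have hex : ∃ k, z i ∘ₗ (N ^ k) = 0 := ⟨K, by rw [hK, LinearMap.comp_zero]⟩
    classical
    obtain ⟨k, hk⟩ : ∃ k, Nat.find hex = k + 1 := by
      refine Nat.exists_eq_succ_of_ne_zero fun h => hz0 i ?_
      have := Nat.find_spec hex
      rw [h] at this
      exact this
    refine ⟨z i ∘ₗ (N ^ k), Nat.find_min hex (by omega), fun x => ?_⟩
    have h1 := Nat.find_spec hex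
    rw [hk] at h1
    have h2 := DFunLike.congr_fun h1 x
    simp only [LinearMap.comp_apply, LinearMap.zero_apply, map_add, hcomm, hz, hsuc] at h2 ⊢
    rw [h2, add_zero]

end Lin

section Saddle

open Asymptotics Filter

variable {E : Type*} [NormedAddCommGroup E] [NormedSpace ℝ E]

/-- The sum of squared moduli of a finite set of complex functionals. -/
noncomputable def quadSum {κ : Type*} (z : κ → E →L[ℝ] ℂ) (s : Finset κ) (x : E) : ℝ :=
  ∑ i ∈ s, ‖z i x‖ ^ 2

section

variable {κ : Type*} (z : κ → E →L[ℝ] ℂ) (s : Finset κ)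

theorem quadSum_nonneg (x : E) : 0 ≤ quadSum z s x := Finset.sum_nonneg fun _ _ => sq_nonneg _

theorem contDiff_quadSum : ContDiff ℝ ∞ (quadSum z s) :=
  ContDiff.sum fun i _ => (z i).contDiff.norm_sq ℝ

theorem quadSum_smul (t : ℝ) (x : E) : quadSum z s (t • x) = t ^ 2 * quadSum z s x := by
  simp only [quadSum, map_smul, norm_smul, mul_pow, Finset.mul_sum, Real.norm_eq_abs, sq_abs]

theorem fderiv_quadSum (x v : E) :
    fderiv ℝ (quadSum z s) x v = ∑ i ∈ s, 2 * inner ℝ (z i x) (z i v) := by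
  have h : HasFDerivAt (quadSum z s) _ x :=
    HasFDerivAt.fun_sum fun i (_ : i ∈ s) => ((z i).hasFDerivAt (x := x)).norm_sq
  rw [h.fderiv]
  simp [mul_add]

theorem norm_sq_le_quadSum {i : κ} (hi : i ∈ s) (x : E) : ‖z i x‖ ^ 2 ≤ quadSum z s x :=
  Finset.single_le_sum (f := fun i => ‖z i x‖ ^ 2) (fun _ _ => sq_nonneg _) hi

theorem norm_le_sqrt_quadSum {i : κ} (hi : i ∈ s) (x : E) : ‖z i x‖ ≤ √(quadSum z s x) :=
  Real.le_sqrt_of_sq_le (norm_sq_le_quadSum z s hi x)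

theorem abs_fderiv_quadSum_le {x v : E} {b : ℝ} (hb : ∀ i ∈ s, ‖z i v‖ ≤ b) :
    |fderiv ℝ (quadSum z s) x v| ≤ 2 * s.card * (√(quadSum z s x) * b) := by
  rw [fderiv_quadSum]
  refine (Finset.abs_sum_le_sum_abs _ _).trans ?_
  rw [mul_comm (2 : ℝ), mul_assoc, ← nsmul_eq_mul]
  refine Finset.sum_le_card_nsmul _ _ _ fun i hi => ?_
  rw [abs_mul, abs_two]
  have h1 := abs_real_inner_le_norm (z i x) (z i v)
  have h2 := norm_le_sqrt_quadSum z s hi x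
  have h3 := mul_le_mul h2 (hb i hi) (norm_nonneg _) (Real.sqrt_nonneg _)
  linarith

end

theorem Fin.sum_shift_le {K : ℕ} (f : Fin K → ℝ) (hf : ∀ k, 0 ≤ f k) :
    ∑ k : Fin K, (if h : (k : ℕ) + 1 < K then f ⟨k + 1, h⟩ else 0) ≤ ∑ k, f k := by
  set F : ℕ → ℝ := fun m => if h : m < K then f ⟨m, h⟩ else 0 with hF
  have h1 : ∑ k, f k = ∑ m ∈ Finset.range K, F m := by
    rw [← Fin.sum_univ_eq_sum_range]
    exact Finset.sum_congr rfl fun k _ => by simp [hF]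
  have h2 : ∑ k : Fin K, (if h : (k : ℕ) + 1 < K then f ⟨k + 1, h⟩ else 0) =
      ∑ m ∈ Finset.range K, F (m + 1) := by
    rw [← Fin.sum_univ_eq_sum_range (fun m => F (m + 1))]
  have h3 := Finset.sum_range_succ F K
  rw [Finset.sum_range_succ'] at h3
  have h4 : F K = 0 := by simp [hF]
  have h5 : 0 ≤ F 0 := by
    simp only [hF]
    split_ifs
    exacts [hf _, le_rfl]
  rw [h1, h2]
  linarith

namespace SpectralCoords

variable {S N : E →ₗ[ℝ] E} {δ : ℝ} {n K : ℕ} {z : Fin n × Fin K → E →L[ℝ] ℂ} {l : Fin n → ℂ}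

theorem neg (h : SpectralCoords S N δ z l) : SpectralCoords (-S) (-N) (-δ) z (-l) where
  eig i x := by simp [h.eig]
  shift i k x := by
    rw [LinearMap.neg_apply, map_neg, h.shift]
    split_ifs <;> simp
  span := h.span

/-- The coordinates with index in a given set of eigenvalues. -/
def block (n K : ℕ) (p : Finset (Fin n)) : Finset (Fin n × Fin K) := p ×ˢ Finset.univ

theorem fderiv_quadSum_le (h : SpectralCoords S N δ z l) {p : Finset (Fin n)} {c : ℝ}
    (hp : ∀ i ∈ p, (l i).re ≤ -c) (hδ : 2 * |δ| ≤ c) (x : E) :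
    fderiv ℝ (quadSum z (block n K p)) x (S x + N x) ≤ -c * quadSum z (block n K p) x := by
  set T : Fin n × Fin K → ℂ := fun i =>
    if h : (i.2 : ℕ) + 1 < K then z (i.1, ⟨i.2 + 1, h⟩) x else 0 with hT
  have hT2 : ∑ i ∈ block n K p, ‖T i‖ ^ 2 ≤ quadSum z (block n K p) x := by
    rw [quadSum, block, Finset.sum_product, Finset.sum_product]
    refine Finset.sum_le_sum fun i _ => ?_
    refine le_trans (le_of_eq (Finset.sum_congr rfl fun k _ => ?_))
      (Fin.sum_shift_le (fun k => ‖z (i, k) x‖ ^ 2) fun k => sq_nonneg _)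
    simp only [hT]
    split_ifs <;> simp
  have hterm : ∀ i ∈ block n K p, 2 * inner ℝ (z i x) (z i (S x + N x)) ≤
      (-2 * c + |δ|) * ‖z i x‖ ^ 2 + |δ| * ‖T i‖ ^ 2 := by
    intro i hi
    have hi' : (l i.1).re ≤ -c := hp _ (Finset.mem_product.1 hi).1
    have e1 : inner ℝ (z i x) (l i.1 * z i x) = (l i.1).re * ‖z i x‖ ^ 2 := by
      rw [Complex.inner, ← Complex.normSq_eq_norm_sq, Complex.normSq_apply]
      simp only [Complex.mul_re, Complex.conj_re, Complex.conj_im, Complex.mul_im]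
      ring
    have e2 : inner ℝ (z i x) ((δ : ℂ) * T i) = δ * inner ℝ (z i x) (T i) := by
      rw [← Complex.real_smul, real_inner_smul_right]
    have e3 : z i (N x) = (δ : ℂ) * T i := by rw [← Prod.mk.eta (p := i), h.shift]
    rw [map_add, inner_add_right, h.eig, e1, e3, e2]
    have h1 := abs_real_inner_le_norm (z i x) (T i)
    have h2 : δ * inner ℝ (z i x) (T i) ≤ |δ| * (‖z i x‖ * ‖T i‖) := by
      refine (le_abs_self _).trans ?_
      rw [abs_mul]
      gcongr
    have h3 : |δ| * (2 * (‖z i x‖ * ‖T i‖)) ≤ |δ| * (‖z i x‖ ^ 2 + ‖T i‖ ^ 2) := by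
      gcongr
      nlinarith [sq_nonneg (‖z i x‖ - ‖T i‖)]
    have h4 := mul_le_mul_of_nonneg_right hi' (sq_nonneg ‖z i x‖)
    nlinarith
  rw [fderiv_quadSum]
  refine (Finset.sum_le_sum hterm).trans ?_
  rw [Finset.sum_add_distrib, ← Finset.mul_sum, ← Finset.mul_sum]
  change (-2 * c + |δ|) * quadSum z (block n K p) x + _ ≤ _
  have h5 := mul_le_mul_of_nonneg_left hT2 (abs_nonneg δ)
  have h6 := quadSum_nonneg z (block n K p) x
  nlinarith

theorem le_fderiv_quadSum (h : SpectralCoords S N δ z l) {p : Finset (Fin n)} {c : ℝ}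
    (hp : ∀ i ∈ p, c ≤ (l i).re) (hδ : 2 * |δ| ≤ c) (x : E) :
    c * quadSum z (block n K p) x ≤ fderiv ℝ (quadSum z (block n K p)) x (S x + N x) := by
  have := h.neg.fderiv_quadSum_le (p := p) (c := c) (fun i hi => by simpa using hp i hi)
    (by simpa using hδ) x
  simp only [LinearMap.neg_apply] at this
  rw [← neg_add, map_neg] at this
  linarith

theorem exists_norm_sq_le [FiniteDimensional ℝ E] (h : SpectralCoords S N δ z l) :
    ∃ C : ℝ, 0 < C ∧ ∀ x, ‖x‖ ^ 2 ≤ C * quadSum z Finset.univ x := by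
  set L : E →ₗ[ℝ] (Fin n × Fin K → ℂ) := LinearMap.pi fun i => (z i : E →ₗ[ℝ] ℂ) with hL
  have hinj : Function.Injective L := by
    rw [← LinearMap.ker_eq_bot, LinearMap.ker_eq_bot']
    intro x hx
    by_contra hx0
    obtain ⟨f, hf⟩ := SeparatingDual.exists_ne_zero (R := ℝ) hx0
    obtain ⟨c, hc⟩ := h.span (Complex.ofRealCLM.toLinearMap ∘ₗ (f : E →ₗ[ℝ] ℝ))
    have h1 := hc x
    have h2 : ∀ i, z i x = 0 := fun i => congrFun hx i
    simp [h2, hf] at h1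
  obtain ⟨k, hk, hL'⟩ := LinearMap.exists_antilipschitzWith L (LinearMap.ker_eq_bot.2 hinj)
  refine ⟨k ^ 2, by positivity, fun x => ?_⟩
  have h1 := hL'.le_mul_dist x 0
  rw [dist_zero_right, map_zero, dist_zero_right] at h1
  have h2 : ‖L x‖ ≤ √(quadSum z Finset.univ x) :=
    (pi_norm_le_iff_of_nonneg (Real.sqrt_nonneg _)).2 fun i =>
      norm_le_sqrt_quadSum z _ (Finset.mem_univ i) x
  calc ‖x‖ ^ 2 ≤ (k * √(quadSum z Finset.univ x)) ^ 2 := by gcongr; exact h1.trans (by gcongr)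
    _ = _ := by rw [mul_pow, Real.sq_sqrt (quadSum_nonneg _ _ _)]

theorem exists_norm_sq_le_add [FiniteDimensional ℝ E] (h : SpectralCoords S N δ z l)
    {s u : Finset (Fin n)} (hsu : ∀ i, i ∈ s ∨ i ∈ u) :
    ∃ C : ℝ, 0 < C ∧ ∀ x, ‖x‖ ^ 2 ≤
      C * (quadSum z (block n K s) x + quadSum z (block n K u) x) := by
  classical
  obtain ⟨C, hC, hnorm⟩ := h.exists_norm_sq_le
  refine ⟨C, hC, fun x => (hnorm x).trans (mul_le_mul_of_nonneg_left ?_ hC.le)⟩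
  have hun : (Finset.univ : Finset (Fin n × Fin K)) = block n K s ∪ block n K u := by
    ext i
    simp [block, hsu i.1]
  rw [hun]
  exact le_of_le_of_eq (le_add_of_nonneg_right (Finset.sum_nonneg fun i _ => sq_nonneg _))
    (Finset.sum_union_inter (f := fun i => ‖z i x‖ ^ 2))

end SpectralCoords

/-- Distance to the common zero set of finitely many functionals. -/
theorem exists_approx_kernel [FiniteDimensional ℝ E] {κ : Type*} (z : κ → E →L[ℝ] ℂ)
    (s : Finset κ) : ∃ C : ℝ, 0 ≤ C ∧ ∀ x, ∃ x', (∀ i ∈ s, z i x' = 0) ∧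
      ‖x - x'‖ ≤ C * √(quadSum z s x) := by
  set L : E →ₗ[ℝ] (s → ℂ) := LinearMap.pi fun i => (z i : E →ₗ[ℝ] ℂ) with hL
  obtain ⟨g, hg⟩ := L.rangeRestrict.exists_rightInverse_of_surjective L.range_rangeRestrict
  have hgc : ∀ y, ‖g y‖ ≤ ‖LinearMap.toContinuousLinearMap g‖ * ‖y‖ := fun y =>
    (LinearMap.toContinuousLinearMap g).le_opNorm y
  refine ⟨‖LinearMap.toContinuousLinearMap g‖, by positivity, fun x =>
    ⟨x - g (L.rangeRestrict x), fun i hi => ?_, ?_⟩⟩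
  · have h1 : L (g (L.rangeRestrict x)) = L x :=
      congrArg Subtype.val (DFunLike.congr_fun hg (L.rangeRestrict x))
    have h2 : z i (g (L.rangeRestrict x)) = z i x := congrFun h1 ⟨i, hi⟩
    rw [map_sub, h2, sub_self]
  · rw [sub_sub_cancel]
    refine (hgc _).trans ?_
    gcongr
    exact (pi_norm_le_iff_of_nonneg (Real.sqrt_nonneg _)).2 fun i =>
      norm_le_sqrt_quadSum z _ i.2 x

theorem SpectralCoords.exists_saddlePair [FiniteDimensional ℝ E] {S N : E →ₗ[ℝ] E} {δ : ℝ}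
    {n K : ℕ} {z : Fin n × Fin K → E →L[ℝ] ℂ} {l : Fin n → ℂ} (h : SpectralCoords S N δ z l)
    {c : ℝ} (hc : 0 < c) {s u : Finset (Fin n)} (hs : ∀ i ∈ s, (l i).re ≤ -c)
    (hu : ∀ i ∈ u, c ≤ (l i).re) (hsu : ∀ i, i ∈ s ∨ i ∈ u) (hδ : 2 * |δ| ≤ c) :
    ∃ ε > 0, ∀ P : E → E, (∀ x y, ‖P x - P y‖ ≤ ε * ‖x - y‖) → P 0 = 0 → ∀ r > 0,
      (∀ x, ‖x‖ ≤ r → (∀ i ∈ block n K s, z i x = 0) → ∀ i ∈ block n K s, z i (P x) = 0) →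
      ∃ ρ₀ > 0, ∀ ρ ≤ ρ₀, SaddlePair (fun x => S x + N x + P x) (quadSum z (block n K s))
        (quadSum z (block n K u)) (c / 2) ρ := by
  obtain ⟨C₁, hC₁, hab⟩ := h.exists_norm_sq_le_add hsu
  obtain ⟨C₂, hC₂, hker⟩ := exists_approx_kernel z (block n K s)
  set a := quadSum z (block n K s) with ha
  set b := quadSum z (block n K u) with hb
  have ha0 : ∀ x, 0 ≤ a x := quadSum_nonneg z _
  have hb0 : ∀ x, 0 ≤ b x := quadSum_nonneg z _
  set M : ℝ := ∑ i, ‖z i‖ with hM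
  have hM0 : 0 ≤ M := Finset.sum_nonneg fun i _ => norm_nonneg _
  have hzM : ∀ i v, ‖z i v‖ ≤ M * ‖v‖ := fun i v => (z i).le_of_opNorm_le
    (Finset.single_le_sum (f := fun i => ‖z i‖) (fun _ _ => norm_nonneg _) (Finset.mem_univ i)) v
  set m : ℝ := ((Fintype.card (Fin n × Fin K) : ℕ) : ℝ) with hm
  have hcard : ∀ p, ((block n K p).card : ℝ) ≤ m := fun p =>
    Nat.cast_le.2 (Finset.card_le_univ _)
  have hm0 : 0 ≤ m := Nat.cast_nonneg _
  have hgen : ∀ (p : Finset (Fin n)) x v t, 0 ≤ t → (∀ i ∈ block n K p, ‖z i v‖ ≤ M * t) →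
      |fderiv ℝ (quadSum z (block n K p)) x v| ≤
        2 * m * M * (√(quadSum z (block n K p) x) * t) := by
    intro p x v t ht hi
    refine (abs_fderiv_quadSum_le z _ hi).trans ?_
    have h1 : 0 ≤ √(quadSum z (block n K p) x) * (M * t) := by positivity
    have h2 := mul_le_mul_of_nonneg_right (hcard p) h1
    nlinarith
  set B : ℝ := 2 * m * M * (√C₁ + C₂) + 1 with hB
  have hB0 : 0 < B := by positivity
  refine ⟨c / (4 * B), by positivity, fun P hP hP0 r hr hinv => ?_⟩
  set ε := c / (4 * B) with hε
  have hεB : ε * B = c / 4 := by rw [hε]; field_simp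
  have hε0 : 0 ≤ ε := by positivity
  have hPx : ∀ x, ‖P x‖ ≤ ε * ‖x‖ := fun x => by simpa [hP0] using hP x 0
  have hxs : ∀ x, ‖x‖ ≤ √C₁ * √(a x + b x) := fun x => by
    rw [← Real.sqrt_mul hC₁.le]
    exact Real.le_sqrt_of_sq_le (hab x)
  have hpert : ∀ (p : Finset (Fin n)) x, quadSum z (block n K p) x ≤ a x + b x →
      |fderiv ℝ (quadSum z (block n K p)) x (P x)| ≤ c / 4 * (a x + b x) := by
    intro p x hp
    refine (hgen p x (P x) (ε * (√C₁ * √(a x + b x))) (by positivity) fun i _ =>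
      (hzM i _).trans ?_).trans ?_
    · gcongr
      exact (hPx x).trans (by gcongr; exact hxs x)
    · have h1 : √(quadSum z (block n K p) x) ≤ √(a x + b x) := Real.sqrt_le_sqrt hp
      have h2 : √(a x + b x) * √(a x + b x) = a x + b x :=
        Real.mul_self_sqrt (add_nonneg (ha0 x) (hb0 x))
      calc 2 * m * M * (√(quadSum z (block n K p) x) * (ε * (√C₁ * √(a x + b x))))
          ≤ 2 * m * M * (√(a x + b x) * (ε * (√C₁ * √(a x + b x)))) := by gcongr
        _ = ε * (2 * m * M * √C₁) * (√(a x + b x) * √(a x + b x)) := by ring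
        _ ≤ ε * B * (√(a x + b x) * √(a x + b x)) := by
          gcongr
          have : 0 ≤ 2 * m * M * C₂ := by positivity
          rw [hB]; linarith
        _ = _ := by rw [hεB, h2]
  have hDa : ∀ x, fderiv ℝ a x (S x + N x + P x) ≤ -c * a x + fderiv ℝ a x (P x) := fun x => by
    rw [map_add]
    exact add_le_add_left (h.fderiv_quadSum_le hs hδ x) _
  have hDb : ∀ x, c * b x + fderiv ℝ b x (P x) ≤ fderiv ℝ b x (S x + N x + P x) := fun x => by
    rw [map_add]
    exact add_le_add_left (h.le_fderiv_quadSum hu hδ x) _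
  have hpa : ∀ x, |fderiv ℝ a x (P x)| ≤ c / 4 * (a x + b x) := fun x =>
    hpert s x (le_add_of_nonneg_right (hb0 x))
  have hpb : ∀ x, |fderiv ℝ b x (P x)| ≤ c / 4 * (a x + b x) := fun x =>
    hpert u x (le_add_of_nonneg_left (ha0 x))
  have hnear : ∀ x, ‖x‖ + C₂ * √(a x) ≤ r → |fderiv ℝ a x (P x)| ≤ c / 4 * a x := by
    intro x hx
    obtain ⟨x', hx'0, hx'⟩ := hker x
    have hx'r : ‖x'‖ ≤ r := by
      have : ‖x'‖ ≤ ‖x‖ + ‖x - x'‖ := by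
        rw [norm_sub_rev]
        simpa using norm_add_le x (x' - x)
      linarith
    refine (hgen s x (P x) (ε * (C₂ * √(a x))) (by positivity) fun i hi => ?_).trans ?_
    · have h1 : z i (P x) = z i (P x - P x') := by rw [map_sub, hinv x' hx'r hx'0 i hi, sub_zero]
      rw [h1]
      refine (hzM i _).trans ?_
      gcongr
      exact (hP x x').trans (by gcongr)
    · have h2 : √(a x) * √(a x) = a x := Real.mul_self_sqrt (ha0 x)
      calc 2 * m * M * (√(a x) * (ε * (C₂ * √(a x))))
          = ε * (2 * m * M * C₂) * (√(a x) * √(a x)) := by ring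
        _ ≤ ε * B * (√(a x) * √(a x)) := by
          gcongr
          have : 0 ≤ 2 * m * M * √C₁ := by positivity
          rw [hB]; linarith
        _ = _ := by rw [hεB, h2]
  refine ⟨(r / (√C₁ + C₂)) ^ 2 / 2, by positivity, fun ρ hρ =>
    ⟨(contDiff_quadSum z _).differentiable (by simp), (contDiff_quadSum z _).differentiable
      (by simp), ha0, hb0, fun x hx => ?_, fun x hx => ?_, fun x => ?_, fun x hx => ?_⟩⟩
  · have h1 := hDa x
    have h2 := abs_le.1 (hpa x)
    nlinarith
  · have h1 := hDb x
    have h2 := abs_le.1 (hpb x)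
    nlinarith
  · have h1 := hDa x
    have h2 := abs_le.1 (hpa x)
    have h3 := hDb x
    have h4 := abs_le.1 (hpb x)
    have h5 := mul_nonneg hc.le (ha0 x)
    have h6 := mul_nonneg hc.le (hb0 x)
    linarith
  · have hsq : √(a x + b x) ≤ r / (√C₁ + C₂) := by
      refine Real.sqrt_le_iff.2 ⟨by positivity, ?_⟩
      linarith
    have h3 : √(a x) ≤ √(a x + b x) := Real.sqrt_le_sqrt (le_add_of_nonneg_right (hb0 x))
    have h4 : ‖x‖ + C₂ * √(a x) ≤ r := by
      have h5 : (√C₁ + C₂) * √(a x + b x) ≤ r := by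
        have : 0 < √C₁ + C₂ := by positivity
        rw [le_div_iff₀ this] at hsq
        linarith
      have h6 := hxs x
      have h7 := mul_le_mul_of_nonneg_left h3 hC₂
      linarith
    have h1 := hDa x
    have h2 := abs_le.1 (hnear x h4)
    have h5 := mul_nonneg hc.le (ha0 x)
    linarith

end Saddle

section HamiltonJacobiStep

open Asymptotics Filter

variable {E F : Type*} [NormedAddCommGroup E] [NormedAddCommGroup F]

theorem isBigO_norm_pow_of_le {f : E → F} {m k : ℕ} (h : f =O[𝓝 0] fun x => ‖x‖ ^ k)
    (hmk : m ≤ k) : f =O[𝓝 0] fun x => ‖x‖ ^ m := by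
  refine h.trans (IsBigO.of_bound 1 ?_)
  filter_upwards [Metric.closedBall_mem_nhds (0 : E) one_pos] with x hx
  rw [mem_closedBall_zero_iff] at hx
  simpa using pow_le_pow_of_le_one (norm_nonneg x) hx hmk

theorem tendsto_zero_of_isBigO_norm_pow {f : E → F} {k : ℕ} (hk : k ≠ 0)
    (h : f =O[𝓝 0] fun x => ‖x‖ ^ k) : Tendsto f (𝓝 0) (𝓝 0) := by
  refine h.trans_tendsto ?_
  have : Tendsto (fun x : E => ‖x‖ ^ k) (𝓝 0) (𝓝 (‖(0 : E)‖ ^ k)) :=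
    (continuous_norm.pow k).tendsto 0
  simpa [hk] using this

theorem isBigO_sub_id_tendsto {a : E → E} (ha : (fun x => a x - x) =O[𝓝 0] fun x => ‖x‖ ^ 2) :
    Tendsto a (𝓝 0) (𝓝 0) := by
  have := (tendsto_zero_of_isBigO_norm_pow two_ne_zero ha).add tendsto_id
  simpa using this

theorem isBigO_sub_id_norm {a : E → E} (ha : (fun x => a x - x) =O[𝓝 0] fun x => ‖x‖ ^ 2) :
    a =O[𝓝 0] fun x => ‖x‖ := by
  have h1 : (fun x => a x - x) =O[𝓝 0] fun x => ‖x‖ := by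
    simpa using isBigO_norm_pow_of_le ha one_le_two
  have h2 : (fun x : E => x) =O[𝓝 0] fun x => ‖x‖ := (isBigO_refl _ _).norm_right
  simpa using h1.add h2

variable [NormedSpace ℝ E] [NormedSpace ℝ F] [CompleteSpace F]

/-- The effect on `f` of an additional displacement `v` of order `e ≥ 2`, where the derivative of
`f` agrees with the linear map `B` up to second order. -/
theorem displacement_isBigO {f : E → F} (hf : ContDiff ℝ ∞ f) {B : E →L[ℝ] E →L[ℝ] F}
    (hB : (fun x => fderiv ℝ f x - B x) =O[𝓝 0] fun x => ‖x‖ ^ 2) {a v : E → E}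
    (ha : (fun x => a x - x) =O[𝓝 0] fun x => ‖x‖ ^ 2) {e : ℕ} (he : 2 ≤ e)
    (hv : v =O[𝓝 0] fun x => ‖x‖ ^ e) :
    (fun x => f (a x + v x) - f (a x) - B x (v x)) =O[𝓝 0] fun x => ‖x‖ ^ (e + 2) := by
  obtain ⟨r, hr, C, hC, hT⟩ := exists_taylor_bound hf 1
  have hat := isBigO_sub_id_tendsto ha
  have han := isBigO_sub_id_norm ha
  have hvt := tendsto_zero_of_isBigO_norm_pow (by omega) hv
  have h1 : (fun x => f (a x + v x) - f (a x) - fderiv ℝ f (a x) (v x)) =O[𝓝 0]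
      fun x => ‖v x‖ ^ 2 := by
    refine IsBigO.of_bound C ?_
    filter_upwards [hat.eventually (Metric.closedBall_mem_nhds 0 hr),
      hvt.eventually (Metric.closedBall_mem_nhds 0 hr)] with x h1 h2
    have := hT (a x) (v x) (by simpa using h1) (by simpa using h2)
    simpa [Finset.sum_range_succ, sub_sub] using this
  have h2 : (fun x => ‖v x‖ ^ 2) =O[𝓝 0] fun x => ‖x‖ ^ (e + 2) := by
    have := (hv.norm_left.pow 2)
    simp only [← pow_mul] at this
    exact isBigO_norm_pow_of_le this (by omega)
  have h3 : (fun x => fderiv ℝ f (a x) - B (a x)) =O[𝓝 0] fun x => ‖x‖ ^ 2 :=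
    (hB.comp_tendsto hat).trans (han.norm_left.pow 2)
  have h4 : (fun x => B (a x) - B x) =O[𝓝 0] fun x => ‖x‖ ^ 2 := by
    simp_rw [← map_sub]
    exact (B.isBigO_comp _ _).trans ha
  have h5 : (fun x => (fderiv ℝ f (a x) - B x) (v x)) =O[𝓝 0] fun x => ‖x‖ ^ (e + 2) := by
    have h6 : (fun x => fderiv ℝ f (a x) - B x) =O[𝓝 0] fun x => ‖x‖ ^ 2 := by
      simpa using h3.add h4
    have h7 := h6.norm_left.mul hv.norm_left
    refine (IsBigO.of_bound 1 (.of_forall fun x => ?_)).trans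
      (h7.trans (isBigO_of_le _ fun x => by simp only [← pow_add, add_comm e]; rfl))
    rw [Real.norm_of_nonneg (by positivity), one_mul]
    exact ContinuousLinearMap.le_opNorm _ _
  refine ((h1.trans h2).add h5).congr_left fun x => ?_
  rw [_root_.sub_apply]
  abel

/-- A function of order `e + 1` changes by `O(‖x‖ ^ (e + 2))` under a quadratic displacement. -/
theorem comp_sub_isBigO {q : E → F} (hq : ContDiff ℝ ∞ q) {e : ℕ}
    (hqO : q =O[𝓝 0] fun x => ‖x‖ ^ (e + 1)) {a : E → E}
    (ha : (fun x => a x - x) =O[𝓝 0] fun x => ‖x‖ ^ 2) :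
    (fun x => q (a x) - q x) =O[𝓝 0] fun x => ‖x‖ ^ (e + 2) := by
  obtain ⟨C, hC, hd⟩ := (hq.fderiv_isBigO_pow hqO).exists_pos
  obtain ⟨r, hr, hdr⟩ := Metric.eventually_nhds_iff.1 hd.bound
  obtain ⟨D, hD, haD⟩ := (isBigO_sub_id_norm ha).exists_pos
  have h1 : (fun x => q (a x) - q x) =O[𝓝 0] fun x => ‖x‖ ^ e * ‖a x - x‖ := by
    refine IsBigO.of_bound (C * (D + 1) ^ e) ?_
    filter_upwards [haD.bound, Metric.ball_mem_nhds (0 : E) (show 0 < r / (D + 1) by positivity)]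
      with x hx hxr
    rw [norm_norm] at hx
    rw [mem_ball_zero_iff, lt_div_iff₀ (by positivity)] at hxr
    have hb : ∀ y ∈ Metric.closedBall (0 : E) ((D + 1) * ‖x‖),
        ‖fderiv ℝ q y‖ ≤ C * ((D + 1) * ‖x‖) ^ e := fun y hy => by
      rw [mem_closedBall_zero_iff] at hy
      refine (hdr (by rw [dist_zero_right]; linarith)).trans ?_
      rw [norm_pow, norm_norm]
      gcongr
    have := (convex_closedBall (0 : E) ((D + 1) * ‖x‖)).norm_image_sub_le_of_norm_fderiv_le
      (fun y _ => (hq.differentiable (by simp)) y) hb (x := x) (y := a x)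
      (by rw [mem_closedBall_zero_iff]; nlinarith [norm_nonneg x])
      (by rw [mem_closedBall_zero_iff]; nlinarith [norm_nonneg x])
    refine this.trans (le_of_eq ?_)
    rw [Real.norm_of_nonneg (by positivity), mul_pow]
    ring
  refine h1.trans (((isBigO_refl _ _).mul ha.norm_left).trans (isBigO_of_le _ fun x => ?_))
  rw [← pow_add]

end HamiltonJacobiStep

section

open Asymptotics Filter

variable {E : Type*} [NormedAddCommGroup E] [NormedSpace ℝ E]
variable {Ω : E →L[ℝ] E →L[ℝ] ℝ} {J : (E →L[ℝ] ℝ) →L[ℝ] E}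

theorem SympPair.apply_gradient_skew (P : SympPair Ω J) (f g : E →L[ℝ] ℝ) : f (J g) = -g (J f) := by
  rw [← P.form_apply f, P.skew, P.form_apply]

/-- Change of the Hamilton–Jacobi discrepancy under perturbations of order `e + 1 ≥ 3`: modulo
higher order it is given by the linearised operator. -/
theorem SympPair.hjDefect_add_isBigO (P : SympPair Ω J) {H G K p q : E → ℝ}
    (hH : ContDiff ℝ ∞ H) (hG : ContDiff ℝ ∞ G) (hK : ContDiff ℝ ∞ K) (hp : ContDiff ℝ ∞ p)
    (hq : ContDiff ℝ ∞ q) {B : E →L[ℝ] E →L[ℝ] ℝ}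
    (hHB : (fun x => fderiv ℝ H x - B x) =O[𝓝 0] fun x => ‖x‖ ^ 2)
    (hKB : (fun x => fderiv ℝ K x - B x) =O[𝓝 0] fun x => ‖x‖ ^ 2)
    (hGO : G =O[𝓝 0] fun x => ‖x‖ ^ 3) {e : ℕ} (he : 2 ≤ e)
    (hpO : p =O[𝓝 0] fun x => ‖x‖ ^ (e + 1)) (hqO : q =O[𝓝 0] fun x => ‖x‖ ^ (e + 1)) :
    (fun x => hjDefect J H (fun y => G y + p y) (fun y => K y + q y) x - hjDefect J H G K x -
      (p x - fderiv ℝ p x ((1 / 2 : ℝ) • x + J (B x)) - q x)) =O[𝓝 0] fun x => ‖x‖ ^ (e + 2) := by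
  have hg : (fun x => (1 / 2 : ℝ) • J (fderiv ℝ G x)) =O[𝓝 0] fun x => ‖x‖ ^ 2 :=
    ((J.isBigO_comp _ _).trans (hG.fderiv_isBigO_pow hGO)).const_smul_left _
  have hv : (fun x => (1 / 2 : ℝ) • J (fderiv ℝ p x)) =O[𝓝 0] fun x => ‖x‖ ^ e :=
    ((J.isBigO_comp _ _).trans (hp.fderiv_isBigO_pow hpO)).const_smul_left _
  have h1 := displacement_isBigO hH hHB (a := fun x => x + (1 / 2 : ℝ) • J (fderiv ℝ G x))
    (by simpa using hg) he hv
  have h2 := displacement_isBigO hK hKB (a := fun x => x - (1 / 2 : ℝ) • J (fderiv ℝ G x))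
    (by simpa using hg.neg_left) he hv.neg_left
  have h3 := comp_sub_isBigO hq hqO (a := fun x => x - (1 / 2 : ℝ) • J (fderiv ℝ G x) -
      (1 / 2 : ℝ) • J (fderiv ℝ p x))
    (by simpa [sub_sub, ← sub_eq_add_neg] using (hg.add (isBigO_norm_pow_of_le hv he)).neg_left)
  refine ((h1.sub h2).sub h3).congr_left fun x => ?_
  have hd : fderiv ℝ (fun y => G y + p y) x = fderiv ℝ G x + fderiv ℝ p x :=
    fderiv_fun_add ((hG.differentiable (by simp)) x) ((hp.differentiable (by simp)) x)
  simp only [hjDefect, hd, map_add, smul_add, map_neg, map_smul, P.apply_gradient_skew (B x),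
    ← add_assoc, ← sub_sub, ← sub_eq_add_neg, _root_.add_apply, smul_eq_mul]
  ring

end

section HomologicalEquation

namespace MvPolynomial

variable {σ R : Type*} [CommRing R]

theorem IsWeightedHomogeneous.mkDerivation {M : Type*} [AddCommMonoid M] {w : σ → M}
    {f : σ → MvPolynomial σ R} (hf : ∀ i, IsWeightedHomogeneous w (f i) (w i))
    {p : MvPolynomial σ R} {m : M} (hp : IsWeightedHomogeneous w p m) :
    IsWeightedHomogeneous w (MvPolynomial.mkDerivation R f p) m := by
  induction hp using IsWeightedHomogeneous.induction_on with
  | zero => simpa using isWeightedHomogeneous_zero R w m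
  | add p q hp hq h1 h2 => simpa using h1.add h2
  | monomial d r hr =>
    rw [mkDerivation_monomial, smul_eq_C_mul]
    refine IsWeightedHomogeneous.C_mul (IsWeightedHomogeneous.sum _ _ _ fun i hi => ?_) r
    have h1 : Finsupp.single i 1 ≤ d := Finsupp.single_le_iff.2
      (Nat.one_le_iff_ne_zero.2 (Finsupp.mem_support_iff.1 hi))
    have h2 : Finsupp.weight w (d - Finsupp.single i 1) + w i = m := by
      conv_rhs => rw [← hr, ← tsub_add_cancel_of_le h1, map_add]
      simp [Finsupp.weight_single]
    beta_reduce
    rw [smul_eq_mul, ← h2]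
    exact (isWeightedHomogeneous_monomial w _ _ rfl).mul (hf i)

theorem IsWeightedHomogeneous.mkDerivation_diagonal {l : σ → R} {p : MvPolynomial σ R} {c : R}
    (hp : IsWeightedHomogeneous l p c) :
    MvPolynomial.mkDerivation R (fun i => C (l i) * X i) p = c • p := by
  induction hp using IsWeightedHomogeneous.induction_on with
  | zero => simp
  | add p q hp hq h1 h2 => rw [map_add, h1, h2, smul_add]
  | monomial d r hr =>
    rw [mkDerivation_monomial, ← hr, Finsupp.weight_apply, Finsupp.sum, Finsupp.sum,
      Finset.sum_smul, Finset.smul_sum]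
    refine Finset.sum_congr rfl fun i hi => ?_
    have h1 : Finsupp.single i 1 ≤ d := Finsupp.single_le_iff.2
      (Nat.one_le_iff_ne_zero.2 (Finsupp.mem_support_iff.1 hi))
    rw [smul_eq_mul, mul_left_comm, X, monomial_mul, tsub_add_cancel_of_le h1, ← smul_eq_C_mul,
      smul_monomial, smul_monomial, smul_monomial]
    congr 1
    simp only [smul_eq_mul, nsmul_eq_mul, mul_one]
    ring

theorem exists_iterate_derivation_eq_zero (D : Derivation R (MvPolynomial σ R) (MvPolynomial σ R))
    (h : ∀ i, ∃ k, D^[k] (X i) = 0) (p : MvPolynomial σ R) : ∃ k, D^[k] p = 0 := by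
  have hzero : ∀ k, D^[k] 0 = 0 := fun k => Function.iterate_fixed (map_zero D) k
  have hadd : ∀ k p q, D^[k] (p + q) = D^[k] p + D^[k] q := fun k p q => by
    induction k generalizing p q with
    | zero => rfl
    | succ k ih => simp [Function.iterate_succ_apply, ih]
  have hmono : ∀ {k m p}, D^[k] p = 0 → k ≤ m → D^[m] p = 0 := by
    intro k m p hk hm
    rw [← Nat.sub_add_cancel hm, Function.iterate_add_apply, hk, hzero]
  have hmul : ∀ m a b p q, a + b = m → D^[a] p = 0 → D^[b] q = 0 → D^[m] (p * q) = 0 := by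
    intro m
    induction m with
    | zero =>
      intro a b p q hab hp hq
      obtain ⟨rfl, rfl⟩ := Nat.add_eq_zero_iff.1 hab
      simp_all
    | succ m ih =>
      intro a b p q hab hp hq
      rcases a with _ | a
      · have : p = 0 := hp
        simp [this, hzero]
      rcases b with _ | b
      · have : q = 0 := hq
        simp [this, hzero]
      rw [Function.iterate_succ_apply, D.leibniz, hadd, smul_eq_mul, smul_eq_mul,
        ih (a + 1) b p (D q) (by omega) hp hq, mul_comm, ih a (b + 1) (D p) q (by omega) hp hq,
        add_zero]
  induction p using MvPolynomial.induction_on with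
  | C a => exact ⟨1, by simp⟩
  | add p q hp hq =>
    obtain ⟨a, ha⟩ := hp
    obtain ⟨b, hb⟩ := hq
    exact ⟨max a b, by rw [hadd, hmono ha (le_max_left _ _), hmono hb (le_max_right _ _), add_zero]⟩
  | mul_X p i hp =>
    obtain ⟨a, ha⟩ := hp
    obtain ⟨b, hb⟩ := h i
    exact ⟨a + b, hmul _ a b _ _ rfl ha hb⟩

/-- Solvability of the homological equation up to resonant terms of weight `1`. -/
theorem exists_homological_solution {k : Type*} [Field k] {l : σ → k} {f : σ → MvPolynomial σ k}
    (hf1 : ∀ i, (f i).IsHomogeneous 1) (hfl : ∀ i, IsWeightedHomogeneous l (f i) (l i))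
    (hnil : ∀ i, ∃ m, (mkDerivation k f)^[m] (X i) = 0) {d : ℕ} {r : MvPolynomial σ k}
    (hr : r.IsHomogeneous d) :
    ∃ p q : MvPolynomial σ k, p.IsHomogeneous d ∧ q.IsHomogeneous d ∧
      IsWeightedHomogeneous l q 1 ∧
      r = mkDerivation k (fun i => C (l i) * X i + f i) p - p + q := by
  set D₀ := mkDerivation k (fun i : σ => C (l i) * X i) with hD₀
  set D₁ := mkDerivation k f with hD₁
  have hD : mkDerivation k (fun i => C (l i) * X i + f i) = D₀ + D₁ :=
    derivation_ext fun i => by simp [hD₀, hD₁, mkDerivation_X]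
  rw [hD]
  have hweight : ∀ m : ℕ, ∀ (c : k), c ≠ 1 → ∀ r : MvPolynomial σ k, r.IsHomogeneous d →
      IsWeightedHomogeneous l r c → D₁^[m] r = 0 → ∃ p : MvPolynomial σ k, p.IsHomogeneous d ∧
        r = (D₀ + D₁) p - p := by
    intro m c hc
    have hc' : c - 1 ≠ 0 := sub_ne_zero.2 hc
    induction m with
    | zero =>
      intro r _ _ h
      exact ⟨0, isWeightedHomogeneous_zero _ _ _, by simpa using h⟩
    | succ m ih =>
      intro r h1 h2 h3
      obtain ⟨p, hp, hpr⟩ := ih (D₁ r) (h1.mkDerivation hf1) (h2.mkDerivation hfl) h3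
      refine ⟨C (c - 1)⁻¹ * (r - p), (h1.sub hp).C_mul _, ?_⟩
      have e1 : D₀ r = c • r := h2.mkDerivation_diagonal
      have e2 : (D₀ + D₁) (r - p) = c • r + D₁ r - (D₀ + D₁) p := by
        rw [map_sub, Derivation.add_apply, e1]
      rw [← smul_eq_C_mul, Derivation.map_smul, e2]
      have e3 : c • r + D₁ r - (D₀ + D₁) p = (c - 1) • r + (r - p) := by
        rw [hpr, sub_smul, one_smul]
        ring
      rw [e3, smul_add, smul_smul, inv_mul_cancel₀ hc', one_smul, add_sub_cancel_right]
  induction hr using IsWeightedHomogeneous.induction_on with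
  | zero => exact ⟨0, 0, isWeightedHomogeneous_zero _ _ _, isWeightedHomogeneous_zero _ _ _,
      isWeightedHomogeneous_zero _ _ _, by simp⟩
  | add r s _ _ h1 h2 =>
    obtain ⟨p, q, hp, hq, hq', e⟩ := h1
    obtain ⟨p', q', kp, kq, kq', e'⟩ := h2
    refine ⟨p + p', q + q', hp.add kp, hq.add kq, hq'.add kq', ?_⟩
    rw [e, e', map_add]
    ring
  | monomial a c ha =>
    have h1 : (monomial a c).IsHomogeneous d := isWeightedHomogeneous_monomial _ _ _ ha
    have h2 := isWeightedHomogeneous_monomial l a c rfl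
    by_cases hw : Finsupp.weight l a = 1
    · exact ⟨0, monomial a c, isWeightedHomogeneous_zero _ _ _, h1, hw ▸ h2, by simp⟩
    · obtain ⟨m, hm⟩ := exists_iterate_derivation_eq_zero D₁ hnil (monomial a c)
      obtain ⟨p, hp, e⟩ := hweight m _ hw _ h1 h2 hm
      exact ⟨p, 0, hp, isWeightedHomogeneous_zero _ _ _, isWeightedHomogeneous_zero _ _ _, by
        rw [add_zero, ← e]⟩

end MvPolynomial

end HomologicalEquation

section CoordinatePolynomials

open Asymptotics Filter

variable {E : Type*} [NormedAddCommGroup E] [NormedSpace ℝ E] {κ : Type*}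

/-- The function on `E` given by a polynomial in the complex linear coordinates `z`. -/
noncomputable def coordEval (z : κ → E →L[ℝ] ℂ) (p : MvPolynomial κ ℂ) (x : E) : ℂ :=
  MvPolynomial.eval (fun i => z i x) p

variable (z : κ → E →L[ℝ] ℂ)

theorem contDiff_coordEval (p : MvPolynomial κ ℂ) : ContDiff ℝ ∞ (coordEval z p) := by
  have h : coordEval z p = fun x => ∑ d ∈ p.support, p.coeff d * ∏ i ∈ d.support, z i x ^ d i :=
    funext fun x => MvPolynomial.eval_eq _ _
  rw [h]
  exact ContDiff.sum fun d _ => contDiff_const.mul (contDiff_prod fun i _ => (z i).contDiff.pow _)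

theorem coordEval_isBigO {p : MvPolynomial κ ℂ} {N : ℕ} (hp : ∀ d ∈ p.support, N ≤ d.degree) :
    coordEval z p =O[𝓝 0] fun x => ‖x‖ ^ N := by
  have h : coordEval z p = fun x => ∑ d ∈ p.support, p.coeff d * ∏ i ∈ d.support, z i x ^ d i :=
    funext fun x => MvPolynomial.eval_eq _ _
  have hprod : ∀ (d : κ → ℕ) (s : Finset κ), (fun x => ∏ i ∈ s, z i x ^ d i) =O[𝓝 0]
      fun x => ‖x‖ ^ ∑ i ∈ s, d i := by
    classical
    intro d s
    induction s using Finset.induction_on with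
    | empty => exact IsBigO.of_bound 1 (by simp)
    | insert i s hi ih =>
      simp only [Finset.prod_insert hi, Finset.sum_insert hi, pow_add]
      exact (((z i).isBigO_id _).norm_right.pow _).mul ih
  rw [h]
  refine IsBigO.fun_sum fun d hd => IsBigO.const_mul_left ?_ _
  exact isBigO_norm_pow_of_le (hprod (⇑d) (Finsupp.support d)) (hp d hd)

theorem coordEval_isBigO_of_isHomogeneous {p : MvPolynomial κ ℂ} {N : ℕ} (hp : p.IsHomogeneous N) :
    coordEval z p =O[𝓝 0] fun x => ‖x‖ ^ N :=
  coordEval_isBigO z fun d hd => by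
    have := hp (MvPolynomial.mem_support_iff.1 hd)
    rw [Finsupp.degree_eq_weight_one]
    exact this.ge

theorem fderiv_coordEval (f : κ → MvPolynomial κ ℂ) {x v : E}
    (hf : ∀ i, z i v = coordEval z (f i) x) (p : MvPolynomial κ ℂ) :
    fderiv ℝ (coordEval z p) x v = coordEval z (MvPolynomial.mkDerivation ℂ f p) x := by
  have hd : ∀ p, DifferentiableAt ℝ (coordEval z p) x := fun p =>
    (contDiff_coordEval z p).differentiable (by simp) x
  induction p using MvPolynomial.induction_on with
  | C a =>
    have : coordEval z (MvPolynomial.C a) = fun _ => a := by ext; simp [coordEval]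
    simp [this, coordEval]
  | add p q hp hq =>
    have : coordEval z (p + q) = coordEval z p + coordEval z q := by ext; simp [coordEval]
    rw [this, fderiv_add (hd p) (hd q), _root_.add_apply, hp, hq, map_add]
    simp [coordEval]
  | mul_X p i hp =>
    have : coordEval z (p * MvPolynomial.X i) = coordEval z p * fun x => z i x := by
      ext; simp [coordEval]
    rw [this, fderiv_mul (hd p) (z i).differentiableAt, Derivation.leibniz,
      MvPolynomial.mkDerivation_X]
    simp [coordEval, hp, hf]

theorem contDiff_re_coordEval (p : MvPolynomial κ ℂ) :
    ContDiff ℝ ∞ (fun x => (coordEval z p x).re) :=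
  Complex.reCLM.contDiff.comp (contDiff_coordEval z p)

theorem fderiv_re {g : E → ℂ} {x : E} (hg : DifferentiableAt ℝ g x) (v : E) :
    fderiv ℝ (fun y => (g y).re) x v = (fderiv ℝ g x v).re := by
  have h : HasFDerivAt (fun y => (g y).re) _ x :=
    Complex.reCLM.hasFDerivAt.comp x hg.hasFDerivAt
  rw [h.fderiv]
  rfl

omit [NormedSpace ℝ E] in
theorem isBigO_re {g : E → ℂ} {N : ℕ} (hg : g =O[𝓝 0] fun x => ‖x‖ ^ N) :
    (fun x => (g x).re) =O[𝓝 0] fun x => ‖x‖ ^ N :=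
  (isBigO_of_le _ fun x => Complex.abs_re_le_norm (g x)).trans hg

theorem ContDiff.iteratedFDeriv_isBigO_pow {F : Type*} [NormedAddCommGroup F] [NormedSpace ℝ F]
    [CompleteSpace F] {f : E → F} (hf : ContDiff ℝ ∞ f) {k d : ℕ}
    (h : f =O[𝓝 0] fun x => ‖x‖ ^ (d + k)) : iteratedFDeriv ℝ k f =O[𝓝 0] fun x => ‖x‖ ^ d := by
  induction k generalizing d with
  | zero =>
    refine IsBigO.of_norm_left ?_
    simp_rw [norm_iteratedFDeriv_zero]
    exact h.norm_left
  | succ k ih =>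
    have hs : ContDiff ℝ ∞ (iteratedFDeriv ℝ k f) :=
      hf.iteratedFDeriv_right (m := ∞) (i := k) (by exact_mod_cast le_top)
    have := (hs.fderiv_isBigO_pow (ih (d := d + 1) (by convert h using 3; ring))).norm_left
    simp_rw [norm_fderiv_iteratedFDeriv] at this
    exact IsBigO.of_norm_left this

/-- The leading Taylor term of a function of order `d`, as a polynomial in spanning coordinates. -/
theorem exists_leading_polynomial [FiniteDimensional ℝ E] [Fintype κ]
    (hz : ∀ f : E →ₗ[ℝ] ℂ, ∃ c : κ → ℂ, ∀ x, f x = ∑ i, c i * z i x) {f : E → ℝ}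
    (hf : ContDiff ℝ ∞ f) {d : ℕ} (hd : f =O[𝓝 0] fun x => ‖x‖ ^ d) :
    ∃ r : MvPolynomial κ ℂ, r.IsHomogeneous d ∧
      (fun x => f x - (coordEval z r x).re) =O[𝓝 0] fun x => ‖x‖ ^ (d + 1) := by
  set b := Module.finBasis ℝ E
  choose c hc using fun j => hz (Complex.ofRealCLM.toLinearMap ∘ₗ b.coord j)
  set L : _ → MvPolynomial κ ℂ := fun j => ∑ i, MvPolynomial.C (c j i) * MvPolynomial.X i with hL
  have hLe : ∀ j x, coordEval z (L j) x = (b.coord j x : ℂ) := fun j x => by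
    have := hc j x
    simp only [LinearMap.comp_apply] at this
    simp [coordEval, hL, ← this]
  have hLh : ∀ j, (L j).IsHomogeneous 1 := fun j =>
    MvPolynomial.IsHomogeneous.sum _ _ _ fun i _ => (MvPolynomial.isHomogeneous_X ℂ i).C_mul _
  set T := iteratedFDeriv ℝ d f 0 with hT
  set r : MvPolynomial κ ℂ := ∑ s : Fin d → Fin (Module.finrank ℝ E),
    MvPolynomial.C (((d.factorial : ℝ)⁻¹ * T (fun i => b (s i)) : ℝ) : ℂ) * ∏ i, L (s i) with hr
  have hre : ∀ x, coordEval z r x = (((d.factorial : ℝ)⁻¹ * T (fun _ => x) : ℝ) : ℂ) := by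
    intro x
    have h1 : T (fun _ => x) = ∑ s : Fin d → Fin (Module.finrank ℝ E),
        (∏ i, b.coord (s i) x) * T (fun i => b (s i)) := by
      conv_lhs => rw [← b.sum_repr x]
      have := T.toMultilinearMap.map_sum (fun (_ : Fin d) j => b.repr x j • b j)
      refine this.trans (Finset.sum_congr rfl fun s _ => ?_)
      exact T.toMultilinearMap.map_smul_univ _ _
    rw [h1, Finset.mul_sum, hr]
    simp only [coordEval, map_sum, map_mul, MvPolynomial.eval_C, map_prod]
    simp only [← coordEval.eq_1, hLe]
    push_cast
    exact Finset.sum_congr rfl fun s _ => by ring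
  refine ⟨r, MvPolynomial.IsHomogeneous.sum _ _ _ fun s _ => ?_, ?_⟩
  · have := MvPolynomial.IsHomogeneous.prod Finset.univ (fun i => L (s i)) (fun _ => 1)
      fun i _ => hLh (s i)
    simp only [Finset.sum_const, Finset.card_univ, Fintype.card_fin, smul_eq_mul, mul_one] at this
    exact this.C_mul _
  · obtain ⟨ρ, hρ, C, hC, hTay⟩ := exists_taylor_bound hf d
    refine IsBigO.of_bound C ?_
    filter_upwards [Metric.closedBall_mem_nhds (0 : E) hρ] with x hx
    have h1 := hTay 0 x (by simpa using hρ.le) (by simpa using hx)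
    have h2 : ∀ k ∈ Finset.range d, ((k.factorial : ℝ)⁻¹ •
        iteratedFDeriv ℝ k f 0 (fun _ => x)) = 0 := by
      intro k hk
      have hk' := Finset.mem_range.1 hk
      have h3 := hf.iteratedFDeriv_isBigO_pow (k := k) (d := d - k)
        (by rwa [Nat.sub_add_cancel hk'.le])
      have h4 : iteratedFDeriv ℝ k f 0 = 0 := by
        obtain ⟨C, hC⟩ := h3.bound
        have := hC.self_of_nhds
        rw [norm_zero, zero_pow (by omega)] at this
        simpa using this
      simp [h4]
    rw [Finset.sum_range_succ, Finset.sum_eq_zero h2, zero_add, zero_add] at h1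
    rw [hre, Complex.ofReal_re, norm_pow, norm_norm]
    simpa using h1

end CoordinatePolynomials

section FormalNormalForm

open Asymptotics Filter MvPolynomial

variable {E : Type*} [NormedAddCommGroup E] [NormedSpace ℝ E]

theorem isBigO_pow_succ_of_fderiv {F : Type*} [NormedAddCommGroup F] [NormedSpace ℝ F] {f : E → F}
    (hf : Differentiable ℝ f) (h0 : f 0 = 0) {d : ℕ} (h : fderiv ℝ f =O[𝓝 0] fun x => ‖x‖ ^ d) :
    f =O[𝓝 0] fun x => ‖x‖ ^ (d + 1) := by
  obtain ⟨C, hC⟩ := h.bound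
  obtain ⟨r, hr, hCr⟩ := Metric.eventually_nhds_iff.1 hC
  refine IsBigO.of_bound C ?_
  filter_upwards [Metric.ball_mem_nhds (0 : E) hr] with x hx
  rw [mem_ball_zero_iff] at hx
  have hC0 : 0 ≤ C ∨ x = 0 := by
    by_contra! hcon
    have h1 := (norm_nonneg _).trans (hCr (y := x) (by simpa using hx))
    have h2 : 0 < ‖‖x‖ ^ d‖ := by simpa using pow_pos (norm_pos_iff.2 hcon.2) d
    nlinarith [hcon.1]
  rcases hC0 with hC0 | rfl
  · have := (convex_closedBall (0 : E) ‖x‖).norm_image_sub_le_of_norm_fderiv_le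
      (fun y _ => hf y) (C := C * ‖x‖ ^ d) (fun y hy => by
        rw [mem_closedBall_zero_iff] at hy
        refine (hCr (by rw [dist_zero_right]; linarith)).trans ?_
        rw [norm_pow, norm_norm]
        gcongr) (x := 0) (y := x) (by simp) (by simp)
    rw [h0, sub_zero, sub_zero] at this
    rw [norm_pow, norm_norm, pow_succ, ← mul_assoc]
    exact this
  · simp [h0]

theorem fderiv_half_quadratic {B : E →L[ℝ] E →L[ℝ] ℝ} (hB : ∀ u v, B u v = B v u) (x : E) :
    HasFDerivAt (fun y => (1 / 2 : ℝ) * B y y) (B x) x := by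
  have h := (B.hasFDerivAt.clm_apply (hasFDerivAt_id x)).const_mul (1 / 2 : ℝ)
  refine h.congr_fderiv (ContinuousLinearMap.ext fun v => ?_)
  simp [hB v x]
  ring

theorem contDiff_half_quadratic (B : E →L[ℝ] E →L[ℝ] ℝ) :
    ContDiff ℝ ∞ (fun y => (1 / 2 : ℝ) * B y y) :=
  contDiff_const.mul (B.contDiff.clm_apply contDiff_id)

variable {Ω : E →L[ℝ] E →L[ℝ] ℝ} {J : (E →L[ℝ] ℝ) →L[ℝ] E}
  {S N : E →ₗ[ℝ] E} {δ : ℝ} {n K : ℕ} {z : Fin n × Fin K → E →L[ℝ] ℂ} {l : Fin n → ℂ}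

/-- The action of the nilpotent part on the coordinates. -/
noncomputable def shiftPolynomial (δ : ℝ) (n K : ℕ) (i : Fin n × Fin K) :
    MvPolynomial (Fin n × Fin K) ℂ :=
  if h : (i.2 : ℕ) + 1 < K then C (δ : ℂ) * X (i.1, ⟨i.2 + 1, h⟩) else 0

theorem exists_iterate_shift_eq_zero (i : Fin n × Fin K) :
    ∃ m, (mkDerivation ℂ (shiftPolynomial δ n K))^[m] (X i) = 0 := by
  obtain ⟨i, k⟩ := i
  set D := mkDerivation ℂ (shiftPolynomial δ n K) with hD
  obtain ⟨m, hm⟩ : ∃ m, K = k + 1 + m := ⟨K - (k + 1), by omega⟩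
  induction m generalizing k with
  | zero =>
    refine ⟨1, ?_⟩
    simp [hD, mkDerivation_X, shiftPolynomial, hm]
  | succ m ih =>
    have hk : (k : ℕ) + 1 < K := by omega
    obtain ⟨j, hj⟩ := ih ⟨k + 1, hk⟩ (by simp only; omega)
    refine ⟨j + 1, ?_⟩
    have h1 : D (X (i, k)) = C (δ : ℂ) * X (i, ⟨k + 1, hk⟩) := by
      simp [hD, mkDerivation_X, shiftPolynomial, hk]
    have h2 : ∀ (j : ℕ) (p : MvPolynomial (Fin n × Fin K) ℂ),
        D^[j] (C (δ : ℂ) * p) = C (δ : ℂ) * D^[j] p := by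
      intro j
      induction j with
      | zero => exact fun p => rfl
      | succ j ih =>
        intro p
        rw [Function.iterate_succ_apply, Function.iterate_succ_apply, ← ih]
        simp [← smul_eq_C_mul]
    rw [Function.iterate_succ_apply, h1, h2, hj, mul_zero]

theorem SpectralCoords.apply_add (h : SpectralCoords S N δ z l) (i : Fin n × Fin K) (x : E) :
    z i (S x + N x) = coordEval z (C (l i.1) * X i + shiftPolynomial δ n K i) x := by
  rw [map_add, h.eig, ← Prod.mk.eta (p := i), h.shift]
  simp only [coordEval, shiftPolynomial, map_add, map_mul, eval_C, eval_X]
  split_ifs <;> simp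

/-- A formal symplectic change of coordinates removing all nonresonant terms. -/
theorem SympPair.exists_formal_normalForm [FiniteDimensional ℝ E] (P : SympPair Ω J)
    (h : SpectralCoords S N δ z l)
    {H : E → ℝ} (hH : ContDiff ℝ ∞ H) (hH0 : H 0 = 0) {B : E →L[ℝ] E →L[ℝ] ℝ}
    (hB : ∀ u v, B u v = B v u) (hHB : (fun x => fderiv ℝ H x - B x) =O[𝓝 0] fun x => ‖x‖ ^ 2)
    (hA : ∀ x, (1 / 2 : ℝ) • x + J (B x) = S x + N x) :
    ∃ p q : ℕ → MvPolynomial (Fin n × Fin K) ℂ, (∀ k, (p k).IsHomogeneous (k + 3)) ∧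
      (∀ k, (q k).IsHomogeneous (k + 3)) ∧
      (∀ k, IsWeightedHomogeneous (fun i => l i.1) (q k) 1) ∧
      ∀ k, hjDefect J H (fun x => (coordEval z (∑ i ∈ Finset.range k, p i) x).re)
        (fun x => 1 / 2 * B x x + (coordEval z (∑ i ∈ Finset.range k, q i) x).re)
        =O[𝓝 0] fun x => ‖x‖ ^ (k + 3) := by
  set G : MvPolynomial (Fin n × Fin K) ℂ → E → ℝ := fun p x => (coordEval z p x).re with hG
  set H₂ : E → ℝ := fun x => 1 / 2 * B x x with hH₂
  set good : ℕ → MvPolynomial (Fin n × Fin K) ℂ × MvPolynomial (Fin n × Fin K) ℂ → Prop :=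
    fun k s => G s.1 =O[𝓝 0] (fun x => ‖x‖ ^ 3) ∧ G s.2 =O[𝓝 0] (fun x => ‖x‖ ^ 3) ∧
      hjDefect J H (G s.1) (fun x => H₂ x + G s.2 x) =O[𝓝 0] fun x => ‖x‖ ^ (k + 3) with hgood
  have hGs : ∀ p, ContDiff ℝ ∞ (G p) := fun p => contDiff_re_coordEval z p
  have hGO : ∀ {p : MvPolynomial (Fin n × Fin K) ℂ} {k : ℕ}, p.IsHomogeneous k →
      G p =O[𝓝 0] fun x => ‖x‖ ^ k := fun hp =>
    isBigO_re (coordEval_isBigO_of_isHomogeneous z hp)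
  have hGadd : ∀ p q, G (p + q) = fun x => G p x + G q x := fun p q => by
    ext x
    simp [hG, coordEval]
  have hH₂s : ContDiff ℝ ∞ H₂ := contDiff_half_quadratic B
  have hbase : good 0 (0, 0) := by
    have h0 : G 0 = fun _ => 0 := by ext; simp [hG, coordEval]
    refine ⟨?_, ?_, ?_⟩
    · simpa [h0] using isBigO_zero _ _
    · simpa [h0] using isBigO_zero _ _
    · have h1 : (fun x => H x - H₂ x) =O[𝓝 0] fun x => ‖x‖ ^ 3 := by
        refine isBigO_pow_succ_of_fderiv ((hH.sub hH₂s).differentiable (by simp))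
          (by simp [hH0, hH₂])
          (hHB.congr_left fun x => ?_)
        rw [fderiv_fun_sub (hH.differentiable (by simp) x) (hH₂s.differentiable (by simp) x),
          (fderiv_half_quadratic hB x).fderiv]
      refine h1.congr_left fun x => ?_
      simp [hjDefect, h0]
  have hstep : ∀ k s, good k s → ∃ t : MvPolynomial (Fin n × Fin K) ℂ ×
      MvPolynomial (Fin n × Fin K) ℂ, t.1.IsHomogeneous (k + 3) ∧ t.2.IsHomogeneous (k + 3) ∧
        IsWeightedHomogeneous (fun i => l i.1) t.2 1 ∧ good (k + 1) (s + t) := by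
    rintro k ⟨s₁, s₂⟩ ⟨h1, h2, h3⟩
    have hKs : ContDiff ℝ ∞ (fun x => H₂ x + G s₂ x) := hH₂s.add (hGs _)
    obtain ⟨r, hr, hrO⟩ := exists_leading_polynomial z h.span
      (contDiff_hjDefect (J := J) hH (hGs s₁) hKs) h3
    obtain ⟨p, q, hp, hq, hq1, hrpq⟩ := exists_homological_solution (l := fun i => l i.1)
      (f := shiftPolynomial δ n K) (fun i => by
        rw [shiftPolynomial]
        split_ifs
        · exact (isHomogeneous_X ℂ _).C_mul _
        · exact isHomogeneous_zero _ _ _) (fun i => by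
        rw [shiftPolynomial]
        split_ifs
        · exact (isWeightedHomogeneous_X ℂ (fun i : Fin n × Fin K => l i.1) _).C_mul _
        · exact isWeightedHomogeneous_zero _ _ _) exists_iterate_shift_eq_zero hr
    have hle : ∀ {t : MvPolynomial (Fin n × Fin K) ℂ}, t.IsHomogeneous (k + 3) →
        G t =O[𝓝 0] fun x => ‖x‖ ^ 3 := fun ht => isBigO_norm_pow_of_le (hGO ht) (by omega)
    have hKB : (fun x => fderiv ℝ (fun x => H₂ x + G s₂ x) x - B x) =O[𝓝 0] fun x => ‖x‖ ^ 2 := by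
      refine ((hGs s₂).fderiv_isBigO_pow h2).congr_left fun x => ?_
      rw [fderiv_fun_add (hH₂s.differentiable (by simp) x) ((hGs s₂).differentiable (by simp) x),
        (fderiv_half_quadratic hB x).fderiv, add_sub_cancel_left]
    have hmain := P.hjDefect_add_isBigO hH (hGs s₁) hKs (hGs p) (hGs q) hHB hKB h1 (e := k + 2)
      (by omega) (hGO hp) (hGO hq)
    refine ⟨(p, q), hp, hq, hq1, ?_, ?_, ?_⟩
    · simp only [Prod.fst_add, hGadd]
      exact h1.add (hle hp)
    · simp only [Prod.snd_add, hGadd]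
      exact h2.add (hle hq)
    · simp only [Prod.fst_add, Prod.snd_add, hGadd]
      refine ((hmain.add hrO)).congr_left fun x => ?_
      have e1 : fderiv ℝ (G p) x (S x + N x) = (coordEval z (mkDerivation ℂ
          (fun i => C (l i.1) * X i + shiftPolynomial δ n K i) p) x).re := by
        rw [hG, fderiv_re ((contDiff_coordEval z p).differentiable (by simp) x),
          fderiv_coordEval z _ (fun i => h.apply_add i x)]
      have e2 : (coordEval z r x).re = fderiv ℝ (G p) x (S x + N x) - G p x + G q x := by
        rw [e1, hrpq]
        simp [coordEval, hG]
      rw [hA, e2]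
      simp only [← add_assoc]
      ring
  choose! t ht using hstep
  set s : ℕ → MvPolynomial (Fin n × Fin K) ℂ × MvPolynomial (Fin n × Fin K) ℂ :=
    fun k => Nat.rec (0, 0) (fun k s => s + t k s) k with hs
  have hgs : ∀ k, good k (s k) := by
    intro k
    induction k with
    | zero => exact hbase
    | succ k ih => exact (ht k _ ih).2.2.2
  have hsum : ∀ k, s k = ∑ i ∈ Finset.range k, t i (s i) := by
    intro k
    induction k with
    | zero => rfl
    | succ k ih => rw [Finset.sum_range_succ, ← ih]
  refine ⟨fun k => (t k (s k)).1, fun k => (t k (s k)).2, fun k => (ht k _ (hgs k)).1,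
    fun k => (ht k _ (hgs k)).2.1, fun k => (ht k _ (hgs k)).2.2.1, fun k => ?_⟩
  have := (hgs k).2.2
  rw [hsum, Prod.fst_sum, Prod.snd_sum] at this
  exact this

end FormalNormalForm

section Borel

open Asymptotics Filter

variable {V : Type*} [NormedAddCommGroup V] [NormedSpace ℝ V] [FiniteDimensional ℝ V]
  {F : Type*} [NormedAddCommGroup F] [NormedSpace ℝ F] [CompleteSpace F]

/-- A germ vanishing to order `o` has smooth representatives whose derivatives of order less
than `o` are uniformly small. -/
theorem exists_small_representative {p : V → F} (hp : ContDiff ℝ ∞ p) {o : ℕ}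
    (hO : p =O[𝓝 0] fun y => ‖y‖ ^ o) {η : ℝ} (hη : 0 < η) :
    ∃ g : V → F, ContDiff ℝ ∞ g ∧ HasCompactSupport g ∧ g =ᶠ[𝓝 0] p ∧
      (∀ k < o, ∀ y, ‖iteratedFDeriv ℝ k g y‖ ≤ η) ∧ ∀ m < o, ∀ y, ‖g y‖ ≤ η * ‖y‖ ^ m := by
  let χ : ContDiffBump (0 : V) := ⟨1, 2, by norm_num, by norm_num⟩
  have hχ : ContDiff ℝ ∞ χ := χ.contDiff
  have hB : ∀ i : ℕ, ∃ B, ∀ y, ‖iteratedFDeriv ℝ i χ y‖ ≤ B := fun i =>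
    (hχ.continuous_iteratedFDeriv (by exact_mod_cast le_top)).bounded_above_of_compact_support
      (χ.hasCompactSupport.iteratedFDeriv i)
  choose B hB using hB
  have hB0 : ∀ i, 0 ≤ B i := fun i => (norm_nonneg _).trans (hB i 0)
  have hD : ∀ i : ℕ, i ≤ o → ∃ C, 0 ≤ C ∧ ∀ᶠ y in 𝓝 (0 : V),
      ‖iteratedFDeriv ℝ i p y‖ ≤ C * ‖y‖ ^ (o - i) := by
    intro i hi
    obtain ⟨C, hC0, hC⟩ := (hp.iteratedFDeriv_isBigO_pow (k := i) (d := o - i)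
      (by rwa [Nat.sub_add_cancel hi])).exists_nonneg
    refine ⟨C, hC0, hC.bound.mono fun y hy => ?_⟩
    simpa using hy
  choose! C hC0 hC using hD
  obtain ⟨r, hr, hCr⟩ := Metric.eventually_nhds_iff.1
    ((eventually_all_finset (Finset.range (o + 1))).2 fun i hi =>
      hC i (Nat.lt_succ_iff.1 (Finset.mem_range.1 hi)))
  set M : ℕ → ℝ := fun k => ∑ i ∈ Finset.range (k + 1), (k.choose i : ℝ) * B i * C (k - i) * 2 ^ o
    with hM
  have hlim : ∀ c : ℝ, ∀ᶠ ε in 𝓝[>] (0 : ℝ), ε * c ≤ η := fun c => by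
    have h : Tendsto (fun ε : ℝ => ε * c) (𝓝[>] 0) (𝓝 (0 * c)) :=
      (continuous_mul_const c).continuousAt.tendsto.mono_left nhdsWithin_le_nhds
    rw [zero_mul] at h
    exact (h.eventually (gt_mem_nhds hη)).mono fun _ h => h.le
  obtain ⟨ε, ⟨⟨hε0, hε1⟩, hε2⟩, hεr, hε3⟩ := ((((eventually_mem_nhdsWithin
    (a := (0 : ℝ)) (s := Set.Ioi 0)).and (hlim (η * 1))).and (hlim (C 0 * 2 ^ o))).and
    (((hlim (2 * η / r * 2))).and ((eventually_all_finset (Finset.range o)).2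
      fun k _ => hlim (M k)))).exists
  have hε0 : 0 < ε := hε0
  have hε1 : ε ≤ 1 := by nlinarith
  have hεr : 2 * ε < r := by
    have h1 : ε * (2 * η / r * 2) = 2 * (2 * ε) * η / r := by ring
    rw [h1, div_le_iff₀ hr] at hεr
    nlinarith
  have hχε : ContDiff ℝ ∞ (fun y => χ (ε⁻¹ • y)) := hχ.comp (contDiff_const_smul _)
  have hsupp : ∀ y, y ∉ Metric.closedBall (0 : V) (2 * ε) →
      y ∉ tsupport (fun y => χ (ε⁻¹ • y) • p y) := by
    intro y hy hy'
    refine hy ((closure_minimal ?_ Metric.isClosed_closedBall) hy')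
    intro x hx
    have : χ (ε⁻¹ • x) ≠ 0 := fun h0 => hx (by simp [h0])
    have h2 : ε⁻¹ • x ∈ Metric.ball (0 : V) 2 := by
      rw [← show χ.rOut = 2 from rfl, ← χ.support_eq]
      exact this
    rw [mem_ball_zero_iff, norm_smul, norm_inv, Real.norm_of_nonneg hε0.le,
      inv_mul_lt_iff₀ hε0] at h2
    rw [mem_closedBall_zero_iff]
    linarith
  refine ⟨fun y => χ (ε⁻¹ • y) • p y, hχε.smul hp, .of_support_subset_isCompact
    (isCompact_closedBall 0 (2 * ε)) fun y hy => by_contra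
      fun h => hsupp y h (subset_tsupport _ hy),
    ?_, fun k hk y => ?_, fun m hm y => ?_⟩
  · have h1 : Tendsto (fun y : V => ε⁻¹ • y) (𝓝 0) (𝓝 0) := by
      simpa using (continuous_const_smul ε⁻¹).tendsto (0 : V)
    filter_upwards [h1.eventually χ.eventuallyEq_one] with y hy
    simp [hy]
  · by_cases hy : y ∈ Metric.closedBall (0 : V) (2 * ε)
    · rw [mem_closedBall_zero_iff] at hy
      refine (norm_iteratedFDeriv_smul_le hχε hp y (n := k)
        (by exact_mod_cast le_top)).trans (le_trans ?_ (hε3 k (Finset.mem_range.2 hk)))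
      rw [hM, Finset.mul_sum]
      refine Finset.sum_le_sum fun i hi => ?_
      rw [Finset.mem_range] at hi
      have h1 : ‖iteratedFDeriv ℝ i (fun y => χ (ε⁻¹ • y)) y‖ ≤ (ε⁻¹) ^ i * B i := by
        rw [iteratedFDeriv_comp_const_smul (i := i) ε⁻¹ (hχ.of_le (by exact_mod_cast le_top))]
        simp only [norm_smul, norm_pow, norm_inv, Real.norm_of_nonneg hε0.le]
        gcongr
        exact hB i _
      have h2 : ‖iteratedFDeriv ℝ (k - i) p y‖ ≤ C (k - i) * (2 * ε) ^ (o - (k - i)) := by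
        refine (hCr (y := y) (by rw [dist_zero_right]; linarith) (k - i)
          (Finset.mem_range.2 (by omega))).trans ?_
        have := hC0 (k - i) (by omega)
        gcongr
      have h3 : (2 * ε) ^ (o - (k - i)) ≤ 2 ^ o * (ε * ε ^ i) := by
        rw [mul_pow, ← pow_succ']
        have ha : (2 : ℝ) ^ (o - (k - i)) ≤ 2 ^ o := pow_le_pow_right₀ (by norm_num) (by omega)
        have hb : ε ^ (o - (k - i)) ≤ ε ^ (i + 1) := pow_le_pow_of_le_one hε0.le hε1 (by omega)
        gcongr
      have hCi := hC0 (k - i) (by omega)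
      calc (k.choose i : ℝ) * ‖iteratedFDeriv ℝ i (fun y => χ (ε⁻¹ • y)) y‖ *
            ‖iteratedFDeriv ℝ (k - i) p y‖
          ≤ (k.choose i : ℝ) * ((ε⁻¹) ^ i * B i) * (C (k - i) * (2 ^ o * (ε * ε ^ i))) := by
            have := hB0 i
            gcongr
            exact h2.trans (mul_le_mul_of_nonneg_left h3 hCi)
        _ = ((ε⁻¹) ^ i * ε ^ i) * (ε * ((k.choose i : ℝ) * B i * C (k - i) * 2 ^ o)) := by ring
        _ = ε * ((k.choose i : ℝ) * B i * C (k - i) * 2 ^ o) := by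
            rw [← mul_pow, inv_mul_cancel₀ hε0.ne', one_pow, one_mul]
    · have : iteratedFDeriv ℝ k (fun y => χ (ε⁻¹ • y) • p y) y = 0 := by
        by_contra hne
        exact hsupp y hy (support_iteratedFDeriv_subset k hne)
      rw [this, norm_zero]
      exact hη.le
  · by_cases hy : y ∈ Metric.closedBall (0 : V) (2 * ε)
    · rw [mem_closedBall_zero_iff] at hy
      have h1 : ‖p y‖ ≤ C 0 * ‖y‖ ^ o := by
        simpa using hCr (y := y) (by rw [dist_zero_right]; linarith) 0
          (Finset.mem_range.2 (by omega))
      have h2 : ‖y‖ ^ o ≤ (2 ^ o * ε) * ‖y‖ ^ m := by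
        obtain ⟨d, rfl⟩ := Nat.exists_eq_add_of_lt hm
        have e1 : ‖y‖ ^ (m + d + 1) = ‖y‖ ^ (d + 1) * ‖y‖ ^ m := by ring
        have e2 : ‖y‖ ^ (d + 1) ≤ (2 * ε) ^ (d + 1) := by gcongr
        have e3 : (2 * ε) ^ (d + 1) ≤ 2 ^ (m + d + 1) * ε := by
          rw [mul_pow]
          have ha : (2 : ℝ) ^ (d + 1) ≤ 2 ^ (m + d + 1) :=
            pow_le_pow_right₀ (by norm_num) (by omega)
          have hb : ε ^ (d + 1) ≤ ε := pow_le_of_le_one hε0.le hε1 (by omega)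
          gcongr
        rw [e1]
        gcongr
        exact e2.trans e3
      have hC00 := hC0 0 (by omega)
      calc ‖χ (ε⁻¹ • y) • p y‖ ≤ 1 * ‖p y‖ := by
            rw [norm_smul, Real.norm_of_nonneg χ.nonneg]
            gcongr
            exact χ.le_one
        _ ≤ C 0 * ((2 ^ o * ε) * ‖y‖ ^ m) := by
            rw [one_mul]
            exact h1.trans (mul_le_mul_of_nonneg_left h2 hC00)
        _ = ε * (C 0 * 2 ^ o) * ‖y‖ ^ m := by ring
        _ ≤ η * ‖y‖ ^ m := by gcongr
    · have : (fun y => χ (ε⁻¹ • y) • p y) y = 0 :=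
        image_eq_zero_of_notMem_tsupport (f := fun y => χ (ε⁻¹ • y) • p y) (hsupp y hy)
      rw [this, norm_zero]
      positivity

/-- Borel's lemma: a series of smooth germs with orders of vanishing tending to infinity is the
asymptotic expansion of a smooth function. -/
theorem exists_contDiff_asymptotic_series {p : ℕ → V → F} (hp : ∀ d, ContDiff ℝ ∞ (p d))
    (hO : ∀ m : ℕ, ∀ᶠ d in atTop, p d =O[𝓝 0] fun y => ‖y‖ ^ m) :
    ∃ f : V → F, ContDiff ℝ ∞ f ∧ ∀ m : ℕ, ∀ᶠ n in atTop,
      (fun y => f y - ∑ d ∈ Finset.range n, p d y) =O[𝓝 0] fun y => ‖y‖ ^ m := by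
  classical
  set o : ℕ → ℕ := fun d => Nat.findGreatest (fun m => p d =O[𝓝 0] fun y => ‖y‖ ^ m) d with ho
  have ho1 : ∀ d, p d =O[𝓝 0] fun y => ‖y‖ ^ o d := fun d => by
    refine Nat.findGreatest_spec (P := fun m => p d =O[𝓝 0] fun y => ‖y‖ ^ m) (Nat.zero_le d) ?_
    simpa using ((hp d).continuous.tendsto 0).isBigO_one ℝ
  have ho2 : ∀ m, ∀ᶠ d in atTop, m < o d := fun m => by
    filter_upwards [hO (m + 1), eventually_ge_atTop (m + 1)] with d h1 h2
    exact Nat.le_findGreatest h2 h1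
  choose g hg _ hge hgk hgm using fun d =>
    exists_small_representative (hp d) (ho1 d) (η := (1 / 2) ^ d) (by positivity)
  have hsum : Summable fun d : ℕ => (1 / 2 : ℝ) ^ d := summable_geometric_two
  refine ⟨fun y => ∑' d, g d y, contDiff_tsum_of_eventually (v := fun _ d => (1 / 2) ^ d) hg
    (fun _ _ => hsum) (fun k _ => ?_), fun m => ?_⟩
  · rw [Nat.cofinite_eq_atTop]
    exact (ho2 k).mono fun d hd => hgk d k hd
  · obtain ⟨n₀, hn₀⟩ := eventually_atTop.1 (ho2 m)
    filter_upwards [eventually_ge_atTop n₀] with n hn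
    have htail : ∀ y d, ‖g (d + n) y‖ ≤ (1 / 2) ^ (d + n) * ‖y‖ ^ m := fun y d =>
      hgm (d + n) m (hn₀ _ (by omega)) y
    have hs2 : ∀ y : V, Summable fun d => (1 / 2 : ℝ) ^ (d + n) * ‖y‖ ^ m := fun y =>
      ((summable_nat_add_iff n).2 hsum).mul_right _
    have hs : ∀ y, Summable fun d => g d y := fun y =>
      (summable_nat_add_iff n).1 (Summable.of_norm_bounded (hs2 y) (htail y))
    refine IsBigO.of_bound (∑' d, (1 / 2 : ℝ) ^ (d + n)) ?_
    filter_upwards [(eventually_all_finset (Finset.range n)).2 fun d _ =>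
      (hge d : ∀ᶠ y in 𝓝 (0 : V), g d y = p d y)] with y hy
    rw [← Finset.sum_congr rfl hy, ← (hs y).sum_add_tsum_nat_add n, add_sub_cancel_left,
      norm_pow, norm_norm, ← tsum_mul_right]
    exact tsum_of_norm_bounded (hs2 y).hasSum (htail y)

end Borel

section EquivariantRealization

open Asymptotics Filter MvPolynomial

variable {E : Type*} [NormedAddCommGroup E] [NormedSpace ℝ E] {κ : Type*} {z : κ → E →L[ℝ] ℂ}
  {l : κ → ℂ} {S : E → E}

theorem coordEval_add (p q : MvPolynomial κ ℂ) (x : E) :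
    coordEval z (p + q) x = coordEval z p x + coordEval z q x := map_add _ _ _

theorem coordEval_sum {α : Type*} (s : Finset α) (p : α → MvPolynomial κ ℂ) (x : E) :
    coordEval z (∑ i ∈ s, p i) x = ∑ i ∈ s, coordEval z (p i) x := map_sum _ _ _

theorem coordEval_mul (p q : MvPolynomial κ ℂ) (x : E) :
    coordEval z (p * q) x = coordEval z p x * coordEval z q x := map_mul _ _ _

theorem coordEval_bind₁ {ι : Type*} [Fintype ι] (f : ι → MvPolynomial κ ℂ) (p : MvPolynomial ι ℂ)
    (x : E) :
    coordEval z (bind₁ f p) x = coordEval (fun i => ContinuousLinearMap.proj (R := ℝ)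
      (φ := fun _ : ι => ℂ) i) p (fun i => coordEval z (f i) x) :=
  eval₂Hom_bind₁ _ _ _ _

theorem fderiv_coordEval_of_isWeightedHomogeneous (hS : ∀ i x, z i (S x) = l i * z i x)
    {p : MvPolynomial κ ℂ} {c : ℂ} (hp : IsWeightedHomogeneous l p c) (x : E) :
    fderiv ℝ (coordEval z p) x (S x) = c * coordEval z p x := by
  rw [fderiv_coordEval z (fun i => C (l i) * X i) (fun i => by simp [coordEval, hS]),
    hp.mkDerivation_diagonal]
  simp [coordEval]

/-- A formal series whose exponents lie in a linear set of resonances is the Taylor expansion of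
an equivariant function. -/
theorem exists_equivariant_realization_of_linear {ι : Type*} [Fintype ι]
    (hS : ∀ i x, z i (S x) = l i * z i x) {a : κ →₀ ℕ} {ρ : ι → κ →₀ ℕ}
    (ha : Finsupp.weight l a = 1) (hρ : ∀ i, Finsupp.weight l (ρ i) = 0) (hρ0 : ∀ i, ρ i ≠ 0)
    {q : ℕ → MvPolynomial κ ℂ} (hq : ∀ k, (q k).IsHomogeneous (k + 3))
    (hqs : ∀ k, ∀ α ∈ (q k).support, ∃ c : ι → ℕ, α = a + ∑ i, c i • ρ i) :
    ∃ K : E → ℂ, ContDiff ℝ ∞ K ∧ (∀ x, fderiv ℝ K x (S x) = K x) ∧ ∀ m : ℕ, ∀ᶠ N in atTop,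
      (fun x => K x - coordEval z (∑ i ∈ Finset.range N, q i) x) =O[𝓝 0] fun x => ‖x‖ ^ m := by
  classical
  choose! c hc using hqs
  set proj : ι → (ι → ℂ) →L[ℝ] ℂ := fun i => ContinuousLinearMap.proj (R := ℝ)
    (φ := fun _ : ι => ℂ) i with hproj
  set P : ℕ → MvPolynomial ι ℂ := fun k => ∑ α ∈ (q k).support,
    monomial (Finsupp.equivFunOnFinite.symm (c k α)) (coeff α (q k)) with hP
  set ζ : E → ι → ℂ := fun x i => coordEval z (monomial (ρ i) 1) x with hζ
  set w : E → ℂ := coordEval z (monomial a 1) with hw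
  have hζs : ContDiff ℝ ∞ ζ := contDiff_pi.2 fun i => contDiff_coordEval z _
  have hws : ContDiff ℝ ∞ w := contDiff_coordEval z _
  have hPq : ∀ k x, coordEval z (q k) x = w x * coordEval proj (P k) (ζ x) := by
    intro k x
    rw [hw, hζ, hproj, ← coordEval_bind₁ (fun i => monomial (ρ i) 1), ← coordEval_mul]
    congr 1
    conv_lhs => rw [(q k).as_sum]
    rw [hP, map_sum, Finset.mul_sum]
    refine Finset.sum_congr rfl fun α hα => ?_
    rw [bind₁_monomial, ← Finsupp.prod, Finsupp.prod_fintype _ _ (by simp)]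
    calc monomial α (coeff α (q k)) = monomial (a + ∑ i, c k α i • ρ i) (1 * coeff α (q k)) := by
          rw [← hc k α hα, one_mul]
      _ = _ := by
          rw [← monomial_mul, monomial_sum_index]
          simp [monomial_pow]
  have hPO : ∀ m : ℕ, ∀ᶠ k in atTop, coordEval proj (P k) =O[𝓝 0] fun y => ‖y‖ ^ m := by
    intro m
    filter_upwards [eventually_ge_atTop (a.degree + (∑ i, (ρ i).degree) * m)] with k hk
    refine coordEval_isBigO proj fun e he => ?_
    obtain ⟨α, hα, he⟩ := Finset.mem_biUnion.1 (support_sum he)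
    have he : e = Finsupp.equivFunOnFinite.symm (c k α) := by
      by_contra hne
      rw [mem_support_iff, coeff_monomial, if_neg (Ne.symm hne)] at he
      exact he rfl
    have hdeg : α.degree = k + 3 := by
      rw [Finsupp.degree_eq_weight_one]
      exact hq k (mem_support_iff.1 hα)
    have he' : e.degree = ∑ i, c k α i := by
      rw [he, Finsupp.degree_eq_sum]
      rfl
    have h1 : α.degree = a.degree + ∑ i, c k α i * (ρ i).degree := by
      conv_lhs => rw [hc k α hα]
      simp [map_add, map_sum]
    have h2 : ∑ i, c k α i * (ρ i).degree ≤ e.degree * ∑ i, (ρ i).degree := by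
      rw [he', Finset.sum_mul]
      refine Finset.sum_le_sum fun i _ => Nat.mul_le_mul_left _ ?_
      exact Finset.single_le_sum (f := fun i => (ρ i).degree) (fun _ _ => Nat.zero_le _)
        (Finset.mem_univ i)
    by_contra! hlt
    have h3 : e.degree * ∑ i, (ρ i).degree ≤ m * ∑ i, (ρ i).degree :=
      Nat.mul_le_mul_right _ hlt.le
    rw [mul_comm m] at h3
    omega
  obtain ⟨f, hf, hfO⟩ := exists_contDiff_asymptotic_series (fun k => contDiff_coordEval proj (P k))
    hPO
  have hζO : ζ =O[𝓝 0] fun x => ‖x‖ := by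
    refine isBigO_pi.2 fun i => ?_
    have := coordEval_isBigO z (p := monomial (ρ i) 1) (N := 1) fun d hd => by
      have hd : d = ρ i := by
        by_contra hne
        rw [mem_support_iff, coeff_monomial, if_neg (Ne.symm hne)] at hd
        exact hd rfl
      rw [hd, Nat.one_le_iff_ne_zero, Ne, Finsupp.degree_eq_zero_iff]
      exact hρ0 i
    simpa using this
  have hζ0 : Tendsto ζ (𝓝 0) (𝓝 0) := by
    refine hζO.trans_tendsto ?_
    simpa using (continuous_norm (E := E)).tendsto 0
  refine ⟨fun x => w x * f (ζ x), hws.mul (hf.comp hζs), fun x => ?_, fun m => ?_⟩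
  · have hζx : fderiv ℝ ζ x (S x) = 0 := by
      ext i
      rw [fderiv_pi (fun i => (contDiff_coordEval z _).differentiable (by simp) x)]
      simpa using fderiv_coordEval_of_isWeightedHomogeneous hS
        (isWeightedHomogeneous_monomial l (ρ i) 1 (hρ i)) x
    have hwx : fderiv ℝ w x (S x) = w x := by
      simpa using fderiv_coordEval_of_isWeightedHomogeneous hS
        (isWeightedHomogeneous_monomial l a 1 ha) x
    have hfζ : HasFDerivAt (fun x => f (ζ x)) ((fderiv ℝ f (ζ x)).comp (fderiv ℝ ζ x)) x :=
      ((hf.differentiable (by simp) _).hasFDerivAt).comp x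
        (hζs.differentiable (by simp) x).hasFDerivAt
    rw [((hws.differentiable (by simp) x).hasFDerivAt.fun_mul hfζ).fderiv]
    simp [hζx, hwx, mul_comm]
  · filter_upwards [hfO m] with N hN
    have h1 : (fun x => w x * (f (ζ x) - ∑ d ∈ Finset.range N, coordEval proj (P d) (ζ x)))
        =O[𝓝 0] fun x => (1 : ℝ) * ‖x‖ ^ m :=
      ((hws.continuous.tendsto 0).isBigO_one ℝ).mul
        ((hN.comp_tendsto hζ0).trans (hζO.norm_left.pow m))
    simp only [one_mul] at h1
    refine h1.congr_left fun x => ?_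
    rw [coordEval_sum, mul_sub, Finset.mul_sum]
    simp only [hPq]

theorem MvPolynomial.exists_add_support_subset (p : MvPolynomial κ ℂ) (t : Set (κ →₀ ℕ)) :
    ∃ p₁ p₂ : MvPolynomial κ ℂ, p = p₁ + p₂ ∧ (∀ α ∈ p₁.support, α ∈ p.support ∧ α ∈ t) ∧
      ∀ α ∈ p₂.support, α ∈ p.support ∧ α ∉ t := by
  classical
  have key : ∀ (s : Set (κ →₀ ℕ)), ∀ β ∈ (∑ α ∈ p.support with α ∈ s,
      monomial α (coeff α p)).support, β ∈ p.support ∧ β ∈ s := by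
    intro s β hβ
    obtain ⟨α, hα, he⟩ := Finset.mem_biUnion.1 (support_sum hβ)
    have he : β = α := by
      by_contra hne
      rw [mem_support_iff, coeff_monomial, if_neg (Ne.symm hne)] at he
      exact he rfl
    rw [he]
    exact Finset.mem_filter.1 hα
  refine ⟨_, _, ?_, key t, key tᶜ⟩
  conv_lhs => rw [p.as_sum]
  convert (Finset.sum_filter_add_sum_filter_not _ (· ∈ t) _).symm

theorem exists_equivariant_realization_of_linear_family (hS : ∀ i x, z i (S x) = l i * z i x)
    (T : Finset (Set (κ →₀ ℕ))) (hT : ∀ t ∈ T, IsLinearSet t)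
    (hTw : ∀ t ∈ T, ∀ α ∈ t, Finsupp.weight l α = 1)
    {q : ℕ → MvPolynomial κ ℂ} (hq : ∀ k, (q k).IsHomogeneous (k + 3))
    (hqs : ∀ k, ∀ α ∈ (q k).support, ∃ t ∈ T, α ∈ t) :
    ∃ K : E → ℂ, ContDiff ℝ ∞ K ∧ (∀ x, fderiv ℝ K x (S x) = K x) ∧ ∀ m : ℕ, ∀ᶠ N in atTop,
      (fun x => K x - coordEval z (∑ i ∈ Finset.range N, q i) x) =O[𝓝 0] fun x => ‖x‖ ^ m := by
  classical
  induction T using Finset.induction_on generalizing q with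
  | empty =>
    have hq0 : ∀ k, q k = 0 := fun k => by
      rw [← support_eq_empty]
      refine Finset.eq_empty_of_forall_notMem fun α hα => ?_
      simpa using hqs k α hα
    refine ⟨fun _ => 0, contDiff_const, by simp, fun m => Eventually.of_forall fun N => ?_⟩
    simpa [hq0, coordEval] using isBigO_zero _ _
  | insert t T ht ih =>
    choose q₁ q₂ hq12 hq1 hq2 using fun k => (q k).exists_add_support_subset t
    obtain ⟨K₂, hK2, hK2S, hK2O⟩ := ih (fun t ht => hT t (Finset.mem_insert_of_mem ht))
      (fun t ht => hTw t (Finset.mem_insert_of_mem ht)) (q := q₂)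
      (fun k α hα => hq k (mem_support_iff.1 (hq2 k α (mem_support_iff.2 hα)).1)) (fun k α hα => by
        obtain ⟨t', ht', hα'⟩ := hqs k α (hq2 k α hα).1
        rcases Finset.mem_insert.1 ht' with rfl | ht'
        · exact absurd hα' (hq2 k α hα).2
        · exact ⟨t', ht', hα'⟩)
    obtain ⟨a, u, hu⟩ := isLinearSet_iff.1 (hT t (Finset.mem_insert_self t T))
    have hmem : ∀ α, α ∈ t ↔ ∃ β ∈ AddSubmonoid.closure (u : Set (κ →₀ ℕ)), a + β = α := by
      intro α
      rw [hu, Set.mem_vadd_set]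
      rfl
    have hw := hTw t (Finset.mem_insert_self t T)
    have ha : Finsupp.weight l a = 1 := hw a ((hmem a).2 ⟨0, zero_mem _, add_zero a⟩)
    have hρ : ∀ ρ ∈ u, Finsupp.weight l ρ = 0 := fun ρ hρ => by
      have := hw (a + ρ) ((hmem _).2 ⟨ρ, AddSubmonoid.subset_closure hρ, rfl⟩)
      rw [map_add, ha] at this
      simpa using this
    obtain ⟨K₁, hK1, hK1S, hK1O⟩ := exists_equivariant_realization_of_linear hS
      (ι := (u.erase 0 : Finset (κ →₀ ℕ))) (ρ := fun i => i.1) ha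
      (fun i => hρ i.1 (Finset.mem_of_mem_erase i.2)) (fun i => Finset.ne_of_mem_erase i.2)
      (q := q₁) (fun k α hα => hq k (mem_support_iff.1 (hq1 k α (mem_support_iff.2 hα)).1))
      (fun k α hα => by
        obtain ⟨β, hβ, rfl⟩ := (hmem α).1 (hq1 k α hα).2
        rw [← AddSubmonoid.closure_sdiff_singleton_zero, ← Finset.coe_erase] at hβ
        obtain ⟨c, hc⟩ := AddSubmonoid.mem_closure_finset'.1 hβ
        refine ⟨c, ?_⟩
        rw [hc])
    refine ⟨fun x => K₁ x + K₂ x, hK1.add hK2, fun x => ?_, fun m => ?_⟩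
    · rw [fderiv_fun_add (hK1.differentiable (by simp) x) (hK2.differentiable (by simp) x),
        _root_.add_apply, hK1S, hK2S]
    · filter_upwards [hK1O m, hK2O m] with N h1 h2
      refine (h1.add h2).congr_left fun x => ?_
      simp only [hq12, Finset.sum_add_distrib, coordEval_add]
      ring

/-- A formal resonant series is the Taylor expansion of an equivariant smooth function. -/
theorem exists_equivariant_realization [Finite κ] (hS : ∀ i x, z i (S x) = l i * z i x)
    {q : ℕ → MvPolynomial κ ℂ} (hq : ∀ k, (q k).IsHomogeneous (k + 3))
    (hq1 : ∀ k, IsWeightedHomogeneous l (q k) 1) :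
    ∃ K : E → ℝ, ContDiff ℝ ∞ K ∧ (∀ x, fderiv ℝ K x (S x) = K x) ∧ ∀ m : ℕ, ∀ᶠ N in atTop,
      (fun x => K x - (coordEval z (∑ i ∈ Finset.range N, q i) x).re)
        =O[𝓝 0] fun x => ‖x‖ ^ m := by
  have : AddMonoid.FG (κ →₀ ℕ) := Module.Finite.iff_addMonoid_fg.1 inferInstance
  obtain ⟨T, hT, hT1⟩ := isSemilinearSet_iff.1 (isSemilinearSet_setOfPred_eq (M := κ →₀ ℕ)
    (0 : ℂ) 1 (Finsupp.weight l) (0 : (κ →₀ ℕ) →+ ℂ))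
  have hT2 : ∀ α, Finsupp.weight l α = 1 ↔ ∃ t ∈ T, α ∈ t := by
    intro α
    have := Set.ext_iff.1 hT1 α
    simpa using this
  obtain ⟨K, hK, hKS, hKO⟩ := exists_equivariant_realization_of_linear_family hS T hT
    (fun t ht α hα => (hT2 α).2 ⟨t, ht, hα⟩) hq
    (fun k α hα => (hT2 α).1 (hq1 k (mem_support_iff.1 hα)))
  refine ⟨fun x => (K x).re, Complex.reCLM.contDiff.comp hK, fun x => ?_, fun m => ?_⟩
  · rw [fderiv_re (hK.differentiable (by simp) x), hKS]
  · filter_upwards [hKO m] with N hN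
    exact (isBigO_re hN).congr_left fun x => by simp

end EquivariantRealization

section SmoothRealization

open Asymptotics Filter MvPolynomial

variable {E : Type*} [NormedAddCommGroup E] [NormedSpace ℝ E] [FiniteDimensional ℝ E]
  {Ω : E →L[ℝ] E →L[ℝ] ℝ} {J : (E →L[ℝ] ℝ) →L[ℝ] E}
  {S N : E →ₗ[ℝ] E} {δ : ℝ} {n K : ℕ} {z : Fin n × Fin K → E →L[ℝ] ℂ} {l : Fin n → ℂ}

omit [FiniteDimensional ℝ E] in
theorem re_coordEval_sum_isBigO {κ : Type*} (z : κ → E →L[ℝ] ℂ) {p : ℕ → MvPolynomial κ ℂ}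
    (hp : ∀ k, (p k).IsHomogeneous (k + 3)) (n : ℕ) :
    (fun x => (coordEval z (∑ i ∈ Finset.range n, p i) x).re) =O[𝓝 0] fun x => ‖x‖ ^ 3 := by
  have h : (fun x => ∑ i ∈ Finset.range n, coordEval z (p i) x) =O[𝓝 0] fun x => ‖x‖ ^ 3 :=
    IsBigO.fun_sum fun i _ =>
      isBigO_norm_pow_of_le (coordEval_isBigO_of_isHomogeneous z (hp i)) (by omega)
  exact isBigO_re (h.congr_left fun x => (coordEval_sum _ _ x).symm)

theorem SympPair.hjDefect_isBigO_of_approx (P : SympPair Ω J)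
    {H G Q G' Q' : E → ℝ} (hH : ContDiff ℝ ∞ H) (hG : ContDiff ℝ ∞ G) (hQ : ContDiff ℝ ∞ Q)
    (hG' : ContDiff ℝ ∞ G') (hQ' : ContDiff ℝ ∞ Q') {B : E →L[ℝ] E →L[ℝ] ℝ}
    (hB : ∀ u v, B u v = B v u) (hHB : (fun x => fderiv ℝ H x - B x) =O[𝓝 0] fun x => ‖x‖ ^ 2)
    (hG3 : G' =O[𝓝 0] fun x => ‖x‖ ^ 3) (hQ3 : Q' =O[𝓝 0] fun x => ‖x‖ ^ 3) {m : ℕ}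
    (hGm : (fun x => G x - G' x) =O[𝓝 0] fun x => ‖x‖ ^ (m + 3))
    (hQm : (fun x => Q x - Q' x) =O[𝓝 0] fun x => ‖x‖ ^ (m + 3))
    (h : hjDefect J H G' (fun x => 1 / 2 * B x x + Q' x) =O[𝓝 0] fun x => ‖x‖ ^ m) :
    hjDefect J H G (fun x => 1 / 2 * B x x + Q x) =O[𝓝 0] fun x => ‖x‖ ^ m := by
  have : CompleteSpace E := FiniteDimensional.complete ℝ E
  have hH₂s : ContDiff ℝ ∞ (fun x => 1 / 2 * B x x) := contDiff_half_quadratic B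
  have hKB : (fun x => fderiv ℝ (fun x => 1 / 2 * B x x + Q' x) x - B x)
      =O[𝓝 0] fun x => ‖x‖ ^ 2 := by
    refine (hQ'.fderiv_isBigO_pow hQ3).congr_left fun x => ?_
    rw [fderiv_fun_add (hH₂s.differentiable (by simp) x) (hQ'.differentiable (by simp) x),
      (fderiv_half_quadratic hB x).fderiv, add_sub_cancel_left]
  have hmain := P.hjDefect_add_isBigO hH hG' (hH₂s.add hQ') (hG.sub hG') (hQ.sub hQ') hHB hKB
    hG3 (e := m + 2) (by omega) hGm hQm
  have hD : (fun x => fderiv ℝ (fun x => G x - G' x) x ((1 / 2 : ℝ) • x + J (B x)))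
      =O[𝓝 0] fun x => ‖x‖ ^ m := by
    have h1 := (hG.sub hG').fderiv_isBigO_pow (d := m + 2) hGm
    have h2 : (fun x : E => (1 / 2 : ℝ) • x + J (B x)) =O[𝓝 0] fun _ => (1 : ℝ) :=
      Tendsto.isBigO_one (c := (1 / 2 : ℝ) • (0 : E) + J (B 0)) ℝ
        (Continuous.tendsto (by fun_prop) 0)
    have h3 := (isBigO_norm_pow_of_le h1 (show m ≤ m + 2 by omega)).norm_norm.mul h2.norm_norm
    simp only [norm_pow, norm_norm, norm_one, mul_one] at h3
    exact (IsBigO.of_bound 1 (Eventually.of_forall fun x => by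
      rw [one_mul, norm_mul, norm_norm, norm_norm]
      exact ContinuousLinearMap.le_opNorm _ _)).trans h3
  have h1 := ((isBigO_norm_pow_of_le hmain (show m ≤ m + 2 + 2 by omega)).add h).add
    (((isBigO_norm_pow_of_le hGm (show m ≤ m + 3 by omega)).sub hD).sub
      (isBigO_norm_pow_of_le hQm (show m ≤ m + 3 by omega)))
  refine h1.congr_left fun x => ?_
  have e1 : (fun y => G' y + (G y - G' y)) = G := by ext; ring
  have e2 : (fun y => 1 / 2 * B y y + Q' y + (Q y - Q' y)) = fun y => 1 / 2 * B y y + Q y := by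
    ext; ring
  rw [e1, e2]
  ring

theorem exists_contDiff_asymptotic_re_coordEval {κ : Type*} (z : κ → E →L[ℝ] ℂ)
    {p : ℕ → MvPolynomial κ ℂ} (hp : ∀ k, (p k).IsHomogeneous (k + 3)) :
    ∃ G : E → ℝ, ContDiff ℝ ∞ G ∧ ∀ m : ℕ, ∀ᶠ n in atTop, (fun x => G x -
      (coordEval z (∑ i ∈ Finset.range n, p i) x).re) =O[𝓝 0] fun x => ‖x‖ ^ m := by
  have hO : ∀ m : ℕ, ∀ᶠ k in atTop,
      (fun x => (coordEval z (p k) x).re) =O[𝓝 0] fun x => ‖x‖ ^ m := fun m => by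
    filter_upwards [eventually_ge_atTop m] with k hk
    exact isBigO_norm_pow_of_le (isBigO_re (coordEval_isBigO_of_isHomogeneous z (hp k)))
      (show m ≤ k + 3 by omega)
  obtain ⟨G, hG, hGO⟩ := exists_contDiff_asymptotic_series
    (p := fun k x => (coordEval z (p k) x).re) (fun k => contDiff_re_coordEval z (p k)) hO
  refine ⟨G, hG, fun m => ?_⟩
  filter_upwards [hGO m] with n hn
  refine hn.congr_left fun x => ?_
  rw [coordEval_sum, Complex.re_sum]

/-- Realisation of the formal normal form by smooth functions. -/
theorem SympPair.exists_hjDefect_flat (P : SympPair Ω J) (h : SpectralCoords S N δ z l)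
    {H : E → ℝ} (hH : ContDiff ℝ ∞ H) (hH0 : H 0 = 0) {B : E →L[ℝ] E →L[ℝ] ℝ}
    (hB : ∀ u v, B u v = B v u) (hHB : (fun x => fderiv ℝ H x - B x) =O[𝓝 0] fun x => ‖x‖ ^ 2)
    (hA : ∀ x, (1 / 2 : ℝ) • x + J (B x) = S x + N x) :
    ∃ G Q : E → ℝ, ContDiff ℝ ∞ G ∧ ContDiff ℝ ∞ Q ∧ (G =O[𝓝 0] fun x => ‖x‖ ^ 3) ∧
      (Q =O[𝓝 0] fun x => ‖x‖ ^ 3) ∧ (∀ x, fderiv ℝ Q x (S x) = Q x) ∧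
      ∀ m : ℕ, hjDefect J H G (fun x => 1 / 2 * B x x + Q x) =O[𝓝 0] fun x => ‖x‖ ^ m := by
  obtain ⟨p, q, hp, hq, hq1, hpq⟩ := P.exists_formal_normalForm h hH hH0 hB hHB hA
  obtain ⟨Q, hQ, hQS, hQO⟩ :=
    exists_equivariant_realization (S := LinearMap.toContinuousLinearMap S)
    (l := fun i : Fin n × Fin K => l i.1) (z := z) h.eig hq hq1
  obtain ⟨G, hG, hGO⟩ := exists_contDiff_asymptotic_re_coordEval z hp
  have hG3 : G =O[𝓝 0] fun x => ‖x‖ ^ 3 := by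
    obtain ⟨n, hn⟩ := (hGO 3).exists
    exact (hn.add (re_coordEval_sum_isBigO z hp n)).congr_left fun x => sub_add_cancel _ _
  have hQ3 : Q =O[𝓝 0] fun x => ‖x‖ ^ 3 := by
    obtain ⟨n, hn⟩ := (hQO 3).exists
    exact (hn.add (re_coordEval_sum_isBigO z hq n)).congr_left fun x => sub_add_cancel _ _
  refine ⟨G, Q, hG, hQ, hG3, hQ3, hQS, fun m => ?_⟩
  obtain ⟨k, ⟨hk1, hk2⟩, hkm⟩ :=
    (((hGO (m + 3)).and (hQO (m + 3))).and (eventually_ge_atTop m)).exists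
  exact P.hjDefect_isBigO_of_approx hH hG hQ (contDiff_re_coordEval z _)
    (contDiff_re_coordEval z _) hB hHB (re_coordEval_sum_isBigO z hp k)
    (re_coordEval_sum_isBigO z hq k) hk1 hk2
    (isBigO_norm_pow_of_le (hpq k) (show m ≤ k + 3 by omega))

/-- Every Liouville field is symplectically conjugate to a normal form up to a flat
Hamiltonian. -/
theorem SympPair.exists_sympConj_normalForm (P : SympPair Ω J) (h : SpectralCoords S N δ z l)
    {H : E → ℝ} (hH : ContDiff ℝ ∞ H) (hH0 : H 0 = 0) {B : E →L[ℝ] E →L[ℝ] ℝ}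
    (hB : ∀ u v, B u v = B v u) (hHB : (fun x => fderiv ℝ H x - B x) =O[𝓝 0] fun x => ‖x‖ ^ 2)
    (hA : ∀ x, (1 / 2 : ℝ) • x + J (B x) = S x + N x) :
    ∃ Q f : E → ℝ, ContDiff ℝ ∞ Q ∧ ContDiff ℝ ∞ f ∧ (Q =O[𝓝 0] fun x => ‖x‖ ^ 3) ∧
      (∀ x, fderiv ℝ Q x (S x) = Q x) ∧ (∀ m : ℕ, f =O[𝓝 0] fun x => ‖x‖ ^ m) ∧
      SympConj Ω (fun x => (1 / 2 : ℝ) • x + J (fderiv ℝ H x))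
        (fun x => S x + N x + J (fderiv ℝ Q x) + J (fderiv ℝ f x)) := by
  have : CompleteSpace E := FiniteDimensional.complete ℝ E
  obtain ⟨G, Q, hG, hQ, hG3, hQ3, hQS, hflat⟩ := P.exists_hjDefect_flat h hH hH0 hB hHB hA
  have hH₂s : ContDiff ℝ ∞ (fun x => 1 / 2 * B x x) := contDiff_half_quadratic B
  have zero_of : ∀ {F : Type _} [NormedAddCommGroup F] {f : E → F} {k : ℕ}, k ≠ 0 →
      (f =O[𝓝 0] fun x => ‖x‖ ^ k) → f 0 = 0 := by
    intro F _ f k hk hf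
    obtain ⟨C, hC⟩ := hf.bound
    have := hC.self_of_nhds
    rw [norm_zero, zero_pow hk] at this
    simpa using this
  have hG1 := hG.fderiv_isBigO_pow (d := 2) hG3
  have hG2 := (hG.fderiv_right (m := ∞) (by simp)).fderiv_isBigO_pow (d := 1) hG1
  obtain ⟨f, hf, hfO, hconj⟩ := P.exists_sympConj_of_hjDefect_flat hH hG (hH₂s.add hQ)
    (zero_of (by norm_num) hG1) (zero_of (by norm_num) hG2) hflat
  refine ⟨Q, f, hQ, hf, hQ3, hQS, hfO, hconj.congr EventuallyEq.rfl (.of_eq ?_)⟩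
  ext1 x
  rw [← hA, fderiv_fun_add (hH₂s.differentiable (by simp) x) (hQ.differentiable (by simp) x),
    (fderiv_half_quadratic hB x).fderiv, map_add, ← add_assoc ((1 / 2 : ℝ) • x)]

end SmoothRealization

section FlatRemoval

open Asymptotics Filter

variable {E : Type*} [NormedAddCommGroup E] [NormedSpace ℝ E] [FiniteDimensional ℝ E]
  {Ω : E →L[ℝ] E →L[ℝ] ℝ} {J : (E →L[ℝ] ℝ) →L[ℝ] E}

omit [NormedSpace ℝ E] [FiniteDimensional ℝ E] in
theorem exists_norm_le_pow_of_hasCompactSupport {F : Type*} [NormedAddCommGroup F] {f : E → F}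
    (hf : Continuous f) (hfc : HasCompactSupport f) {N : ℕ} (hO : f =O[𝓝 0] fun x => ‖x‖ ^ N) :
    ∃ C, ∀ x, ‖f x‖ ≤ C * ‖x‖ ^ N := by
  obtain ⟨C, hC0, hC⟩ := hO.exists_nonneg
  obtain ⟨r, hr, hCr⟩ := Metric.eventually_nhds_iff.1 hC.bound
  obtain ⟨M, hM⟩ := hf.bounded_above_of_compact_support hfc
  have hM0 : 0 ≤ M := (norm_nonneg _).trans (hM 0)
  refine ⟨C + M / r ^ N, fun x => ?_⟩
  have h0 : (0 : ℝ) ≤ ‖x‖ ^ N := by positivity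
  rcases lt_or_ge ‖x‖ r with hx | hx
  · have h1 := hCr (y := x) (by simpa using hx)
    rw [norm_pow, norm_norm] at h1
    have h2 : 0 ≤ M / r ^ N * ‖x‖ ^ N := by positivity
    linarith
  · have h1 : M ≤ M / r ^ N * ‖x‖ ^ N := by
      rw [div_mul_eq_mul_div, le_div_iff₀ (by positivity)]
      gcongr
    have h2 : 0 ≤ C * ‖x‖ ^ N := by positivity
    linarith [hM x]

omit [FiniteDimensional ℝ E] in
/-- The Hamiltonian field of an `S`-homogeneous function commutes with `S`. -/
theorem SympPair.fderiv_gradient_apply (P : SympPair Ω J) {S : E →L[ℝ] E}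
    (hS : ∀ u v, Ω (S u) v + Ω u (S v) = Ω u v) {Q : E → ℝ} (hQ : ContDiff ℝ ∞ Q)
    (hQS : ∀ x, fderiv ℝ Q x (S x) = Q x) (x : E) :
    fderiv ℝ (fun x => J (fderiv ℝ Q x)) x (S x) = S (J (fderiv ℝ Q x)) := by
  have hQ' : DifferentiableAt ℝ (fderiv ℝ Q) x :=
    (hQ.fderiv_right (m := ∞) (by simp)).differentiable (by simp) x
  have h1 : HasFDerivAt (fun x => fderiv ℝ Q x (S x)) _ x :=
    hQ'.hasFDerivAt.clm_apply S.hasFDerivAt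
  have h2 := (hQ.differentiable (by simp) x).hasFDerivAt
  rw [funext hQS] at h1
  have h3 := h1.unique h2
  refine P.eq_of_form_eq fun u => ?_
  have h4 := hS (J (fderiv ℝ Q x)) u
  have h5 := congrArg (fun L => L u) h3
  simp only [_root_.add_apply, ContinuousLinearMap.comp_apply, ContinuousLinearMap.flip_apply] at h5
  rw [(SympPair.hasFDerivAt_gradient hQ x).fderiv]
  simp only [ContinuousLinearMap.comp_apply, P.form_apply] at h4 ⊢
  rw [SympPair.symm_fderiv_fderiv hQ]
  linarith

theorem eq_exp_mul_of_hasDerivAt {g : ℝ → ℂ} {l : ℂ} (hg : ∀ t, HasDerivAt g (l * g t) t) (t : ℝ) :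
    g t = Complex.exp (l * t) * g 0 := by
  have he : ∀ t : ℝ, HasDerivAt (fun t : ℝ => Complex.exp (-(l * t)))
      (Complex.exp (-(l * t)) * -l) t := fun t => by
    have h1 : HasDerivAt (fun t : ℝ => (t : ℂ)) 1 t := Complex.ofRealCLM.hasDerivAt
    simpa using (h1.const_mul l).neg.cexp
  have hd : ∀ t, HasDerivAt (fun t : ℝ => Complex.exp (-(l * t)) * g t) 0 t := fun t => by
    refine ((he t).mul (hg t)).congr_deriv ?_
    ring
  have h1 : Complex.exp (-(l * t)) * g t = Complex.exp (-(l * (0 : ℝ))) * g 0 :=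
    is_const_of_deriv_eq_zero (fun t => (hd t).differentiableAt) (fun t => (hd t).deriv) t 0
  simp only [Complex.ofReal_zero, mul_zero, neg_zero, Complex.exp_zero, one_mul] at h1
  rw [← h1, ← mul_assoc, ← Complex.exp_add, add_neg_cancel, Complex.exp_zero, one_mul]

variable {S N : E →ₗ[ℝ] E} {δ : ℝ} {n K : ℕ} {z : Fin n × Fin K → E →L[ℝ] ℂ} {l : Fin n → ℂ}

/-- A vector field commuting with `S` preserves the unstable subspace of `S`. -/
theorem SpectralCoords.apply_eq_zero_of_commute (h : SpectralCoords S N δ z l)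
    {s u : Finset (Fin n)} (hs : ∀ i ∈ s, (l i).re < 0) (hu : ∀ i ∈ u, 0 < (l i).re)
    (hsu : ∀ i, i ∈ s ∨ i ∈ u) {P₀ : E → E} (hP : ContDiff ℝ ∞ P₀) (hP0 : P₀ 0 = 0)
    (hPS : ∀ x, fderiv ℝ P₀ x (S x) = S (P₀ x)) {x : E} (hx : ∀ i ∈ block n K s, z i x = 0)
    {i : Fin n × Fin K} (hi : i ∈ block n K s) : z i (P₀ x) = 0 := by
  have : CompleteSpace E := FiniteDimensional.complete ℝ E
  set S' : E →L[ℝ] E := LinearMap.toContinuousLinearMap S with hS'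
  obtain ⟨Φ, hΦ0, hΦ, -⟩ := exists_smooth_flow (X := S') S'.contDiff S'.lipschitz
  have hΦz : ∀ j t, z j (Φ t x) = Complex.exp (l j.1 * t) * z j x := fun j t => by
    have := eq_exp_mul_of_hasDerivAt (g := fun t => z j (Φ t x)) (l := l j.1) (fun t => by
      have h1 := (z j).hasFDerivAt.comp_hasDerivAt t (hΦ t x)
      exact h1.congr_deriv (h.eig j _)) t
    simpa only [hΦ0] using this
  have hPz : ∀ t, z i (P₀ (Φ t x)) = Complex.exp (l i.1 * t) * z i (P₀ x) := fun t => by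
    have := eq_exp_mul_of_hasDerivAt (g := fun t => z i (P₀ (Φ t x))) (l := l i.1) (fun t => by
      have h1 := (z i).hasFDerivAt.comp_hasDerivAt t
        ((hP.differentiable (by simp) (Φ t x)).hasFDerivAt.comp_hasDerivAt t (hΦ t x))
      refine h1.congr_deriv ?_
      rw [← h.eig, ← hPS]
      rfl) t
    simpa only [hΦ0] using this
  have hΦlim : Tendsto (fun t => Φ t x) atBot (𝓝 0) := by
    obtain ⟨C, hC, hCn⟩ := h.exists_norm_sq_le
    have h1 : Tendsto (fun t => C * quadSum z Finset.univ (Φ t x)) atBot (𝓝 0) := by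
      have h2 : Tendsto (fun t => ∑ j, ‖z j (Φ t x)‖ ^ 2) atBot
          (𝓝 (∑ j : Fin n × Fin K, (0 : ℝ) ^ 2)) := by
        refine tendsto_finsetSum _ fun j _ => Tendsto.pow ?_ 2
        simp only [hΦz, norm_mul, Complex.norm_exp]
        rcases hsu j.1 with hj | hj
        · rw [hx j (by simp [block, hj])]
          simp
        · have h3 : Tendsto (fun t : ℝ => Real.exp ((l j.1 * t).re) * ‖z j x‖) atBot
              (𝓝 (0 * ‖z j x‖)) := by
            refine (Real.tendsto_exp_atBot.comp ?_).mul_const _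
            simp only [Complex.re_mul_ofReal]
            exact tendsto_id.const_mul_atBot (hu _ hj)
          simpa using h3
      simpa [quadSum] using h2.const_mul C
    have h2 : Tendsto (fun t => ‖Φ t x‖ ^ 2) atBot (𝓝 0) :=
      squeeze_zero (fun _ => sq_nonneg _) (fun t => hCn _) h1
    rw [tendsto_zero_iff_norm_tendsto_zero]
    simpa using h2.sqrt
  have hlim : Tendsto (fun t => ‖z i (P₀ (Φ t x))‖) atBot (𝓝 0) := by
    have := (((z i).continuous.comp hP.continuous).tendsto 0).comp hΦlim
    simpa [hP0] using this.norm
  have hle : ∀ᶠ t in atBot, ‖z i (P₀ x)‖ ≤ ‖z i (P₀ (Φ t x))‖ := by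
    filter_upwards [eventually_le_atBot (0 : ℝ)] with t ht
    rw [hPz, norm_mul, Complex.norm_exp, Complex.re_mul_ofReal]
    refine le_mul_of_one_le_left (norm_nonneg _) (Real.one_le_exp ?_)
    exact mul_nonneg_of_nonpos_of_nonpos (hs _ (Finset.mem_product.1 hi).1).le ht
  exact norm_le_zero_iff.1 (ge_of_tendsto hlim hle)

end FlatRemoval

section FlatRemoval

open Asymptotics Filter SpectralCoords

variable {E : Type*} [NormedAddCommGroup E] [NormedSpace ℝ E] [FiniteDimensional ℝ E]
  {Ω : E →L[ℝ] E →L[ℝ] ℝ} {J : (E →L[ℝ] ℝ) →L[ℝ] E}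

omit [FiniteDimensional ℝ E] in
theorem norm_fderiv_gradient_le (J : (E →L[ℝ] ℝ) →L[ℝ] E) {G : E → ℝ} (hG : ContDiff ℝ ∞ G)
    (x : E) : ‖fderiv ℝ (fun x => J (fderiv ℝ G x)) x‖ ≤ ‖J‖ * ‖iteratedFDeriv ℝ 2 G x‖ := by
  rw [(SympPair.hasFDerivAt_gradient hG x).fderiv, ← norm_iteratedFDeriv_fderiv,
    ← norm_iteratedFDeriv_fderiv, norm_iteratedFDeriv_zero]
  exact J.opNorm_comp_le _

omit [FiniteDimensional ℝ E] in
theorem norm_sq_le_of_gradient_ne_zero {f q : E → ℝ} {C : ℝ} (hq : Continuous q)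
    (hf : ∀ x, f x ≠ 0 → ‖x‖ ^ 2 ≤ C * q x) {x : E} (hx : J (fderiv ℝ f x) ≠ 0) :
    ‖x‖ ^ 2 ≤ C * q x := by
  have h1 : x ∈ tsupport f := by
    refine tsupport_fderiv_subset ℝ (subset_tsupport _ fun h0 => hx ?_)
    rw [h0, map_zero]
  have h2 : IsClosed {x : E | ‖x‖ ^ 2 ≤ C * q x} :=
    isClosed_le (continuous_norm.pow 2) (hq.const_mul C)
  exact h2.closure_subset_iff.2 (fun y hy => hf y hy) h1

variable {S N : E →ₗ[ℝ] E} {δ : ℝ} {n K : ℕ} {z : Fin n × Fin K → E →L[ℝ] ℂ} {l : Fin n → ℂ}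

/-- A flat Hamiltonian perturbation supported away from the unstable directions of the linear part
can be removed from a vector field commuting with the linear part. -/
theorem SympPair.exists_flat_conjugacy (P : SympPair Ω J) (h : SpectralCoords S N δ z l)
    {c : ℝ} (hc : 0 < c) {s u : Finset (Fin n)} (hs : ∀ i ∈ s, (l i).re ≤ -c)
    (hu : ∀ i ∈ u, c ≤ (l i).re) (hsu : ∀ i, i ∈ s ∨ i ∈ u) (hδ : 2 * |δ| ≤ c) {κ : ℝ}
    (hA : ∀ v w, Ω (S v + N v) w + Ω v (S w + N w) = κ * Ω v w)
    {Q : E → ℝ} (hQ : ContDiff ℝ ∞ Q) (hQ3 : Q =O[𝓝 0] fun x => ‖x‖ ^ 3)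
    (hQS : ∀ x, fderiv ℝ (fun x => J (fderiv ℝ Q x)) x (S x) = S (J (fderiv ℝ Q x)))
    {f : E → ℝ} (hf : ContDiff ℝ ∞ f) (hfO : ∀ m : ℕ, f =O[𝓝 0] fun x => ‖x‖ ^ m) {C : ℝ}
    (hfs : ∀ᶠ x in 𝓝 0, f x ≠ 0 → ‖x‖ ^ 2 ≤ C * quadSum z (block n K s) x) :
    ∃ W : E → E, ContDiff ℝ ∞ W ∧ (∀ m : ℕ, (fun x => W x - x) =O[𝓝 0] fun x => ‖x‖ ^ m) ∧
      (∀ x u v, Ω (fderiv ℝ W x u) (fderiv ℝ W x v) = Ω u v) ∧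
      ∀ᶠ x in 𝓝 0, fderiv ℝ W x (S x + N x + J (fderiv ℝ Q x)) =
        S (W x) + N (W x) + J (fderiv ℝ Q (W x)) + J (fderiv ℝ f (W x)) := by
  have : CompleteSpace E := FiniteDimensional.complete ℝ E
  set a := quadSum z (block n K s) with ha
  set b := quadSum z (block n K u) with hb
  have has : ContDiff ℝ ∞ a := contDiff_quadSum z _
  have hbs : ContDiff ℝ ∞ b := contDiff_quadSum z _
  obtain ⟨ε, hε, hsad⟩ := h.exists_saddlePair hc hs hu hsu hδ
  obtain ⟨g, hg, hgc, hgQ, hg2, -⟩ := exists_small_representative hQ hQ3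
    (η := ε / (‖J‖ + 1)) (by positivity)
  set G : E → E := fun x => J (fderiv ℝ g x) with hG
  have hGs : ContDiff ℝ ∞ G := SympPair.contDiff_gradient hg
  have hGQ : G =ᶠ[𝓝 0] fun x => J (fderiv ℝ Q x) := (hgQ.fderiv (𝕜 := ℝ)).fun_comp J
  have hgrad0 : J (fderiv ℝ Q 0) = 0 := by
    have h1 := isBigO_norm_pow_of_le (hQ.fderiv_isBigO_pow (d := 2) hQ3) one_le_two
    obtain ⟨D, hD⟩ := h1.bound
    have h2 : fderiv ℝ Q 0 = 0 := by simpa using hD.self_of_nhds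
    rw [h2, map_zero]
  have hG0 : G 0 = 0 := hGQ.self_of_nhds.trans hgrad0
  have hGlip : ∀ x y, ‖G x - G y‖ ≤ ε * ‖x - y‖ := fun x y => by
    refine Convex.norm_image_sub_le_of_norm_fderiv_le (𝕜 := ℝ) (s := Set.univ)
      (fun w _ => hGs.differentiable (by simp) w) (fun w _ => ?_) convex_univ trivial trivial
    refine (norm_fderiv_gradient_le J hg w).trans ?_
    calc ‖J‖ * ‖iteratedFDeriv ℝ 2 g w‖ ≤ (‖J‖ + 1) * (ε / (‖J‖ + 1)) := by
          gcongr
          · linarith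
          · exact hg2 2 (by norm_num) w
      _ = ε := by field_simp
  obtain ⟨r, hr, hGr⟩ := Metric.eventually_nhds_iff.1 hGQ
  obtain ⟨ρ, hρ, hsad⟩ := hsad G hGlip hG0 (r / 2) (by positivity) fun x hx hxs i hi => by
    rw [hGr (by rw [dist_zero_right]; linarith)]
    exact h.apply_eq_zero_of_commute (fun i hi => (hs i hi).trans_lt (neg_neg_of_pos hc))
      (fun i hi => hc.trans_le (hu i hi)) hsu (SympPair.contDiff_gradient hQ) hgrad0 hQS hxs hi
  have hρb : ∀ᶠ x in 𝓝 (0 : E), b x < ρ := by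
    have h0 : b 0 = 0 := by simp [hb, quadSum]
    exact (hbs.continuous.tendsto 0).eventually (by rw [h0]; exact gt_mem_nhds hρ)
  obtain ⟨r₁, hr₁, hfr⟩ := Metric.eventually_nhds_iff.1 (hfs.and hρb)
  let χ : ContDiffBump (0 : E) := ⟨r₁ / 4, r₁ / 2, by positivity, by linarith⟩
  set k : E → ℝ := fun x => χ x * f x with hk
  have hχs : ∀ x, χ x ≠ 0 → ‖x‖ < r₁ / 2 := fun x hx => by
    have : x ∈ Metric.ball (0 : E) (r₁ / 2) := χ.support_eq ▸ hx
    simpa using this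
  have hks : ContDiff ℝ ∞ k := χ.contDiff.mul hf
  have hkc : HasCompactSupport k := χ.hasCompactSupport.mul_right
  have hkf : k =ᶠ[𝓝 0] f := by
    filter_upwards [χ.eventuallyEq_one] with x hx
    simp [hk, hx]
  have hksupp : ∀ x, k x ≠ 0 → ‖x‖ ^ 2 ≤ C * a x := fun x hx =>
    (hfr (by rw [dist_zero_right]; linarith [hχs x (left_ne_zero_of_mul hx)])).1
      (right_ne_zero_of_mul hx)
  set Z : E → E := fun x => J (fderiv ℝ k x) with hZ
  have hZs : ContDiff ℝ ∞ Z := SympPair.contDiff_gradient hks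
  have hZc : HasCompactSupport Z := hkc.fderiv ℝ |>.comp_left (g := J) (map_zero J)
  have hZO : ∀ m : ℕ, Z =O[𝓝 0] fun x => ‖x‖ ^ m := fun m =>
    (J.isBigO_comp _ _).trans
      (hks.fderiv_isBigO_pow ((hfO (m + 1)).congr' hkf.symm EventuallyEq.rfl))
  have hZb : ∀ x, Z x ≠ 0 → b x ≤ ρ := fun x hx => by
    have h1 : x ∈ tsupport k := by
      refine tsupport_fderiv_subset ℝ (subset_tsupport _ fun h0 => hx ?_)
      simp only [hZ, h0, map_zero]
    have h2 : tsupport k ⊆ Metric.closedBall 0 (r₁ / 2) :=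
      closure_minimal (fun y hy => mem_closedBall_zero_iff.2
        (hχs y (left_ne_zero_of_mul hy)).le) Metric.isClosed_closedBall
    have h3 := mem_closedBall_zero_iff.1 (h2 h1)
    exact (hfr (by rw [dist_zero_right]; linarith)).2.le
  have hGc : HasCompactSupport G := hgc.fderiv ℝ |>.comp_left (g := J) (map_zero J)
  obtain ⟨R₁, hR₁⟩ := hGc.isCompact.isBounded.subset_ball 0
  obtain ⟨R₂, hR₂⟩ := hZc.isCompact.isBounded.subset_ball 0
  have hGR : ∀ x, max R₁ R₂ ≤ ‖x‖ → G x = 0 := fun x hx => by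
    by_contra h0
    have := mem_ball_zero_iff.1 (hR₁ (subset_tsupport _ h0))
    exact absurd (le_max_left R₁ R₂) (by linarith)
  have hZR : ∀ x, max R₁ R₂ ≤ ‖x‖ → Z x = 0 := fun x hx => by
    by_contra h0
    have := mem_ball_zero_iff.1 (hR₂ (subset_tsupport _ h0))
    exact absurd (le_max_right R₁ R₂) (by linarith)
  set A : E →L[ℝ] E := LinearMap.toContinuousLinearMap (S + N) with hAdef
  have hAx : ∀ x, A x = S x + N x := fun x => rfl
  set Y : E → E := fun x => S x + N x + G x with hY
  have hYA : Y = fun x => A x + G x := rfl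
  have hYs : ContDiff ℝ ∞ Y := A.contDiff.add hGs
  obtain ⟨W, hW, hWid, hconj, hsymp⟩ := (hsad ρ le_rfl).exists_conjugacy (half_pos hc) hYs hZs
    (by simp [hY, hG0]) (A := A) (fun x hx => by rw [hYA]; simp [hGR x hx]) hZR
    (K := ∑ i ∈ block n K s, ‖z i‖ ^ 2) (C := C)
    (fun x => by
      rw [Finset.sum_mul]
      exact Finset.sum_le_sum fun i _ => by
        rw [← mul_pow]
        exact pow_le_pow_left₀ (norm_nonneg _) ((z i).le_opNorm x) 2)
    (fun x hx => ⟨norm_sq_le_of_gradient_ne_zero has.continuous hksupp hx, hZb x hx⟩)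
    (fun m => exists_norm_le_pow_of_hasCompactSupport hZs.continuous hZc (hZO m)) Ω (κ := κ)
    (fun x v w => by
      have h1 : fderiv ℝ Y x = A + fderiv ℝ G x := by
        rw [hYA, fderiv_fun_add A.differentiableAt (hGs.differentiable (by simp) x), A.fderiv]
      have h2 := P.gradient_skew hg x v w
      have h3 := hA v w
      simp only [h1, _root_.add_apply, map_add, hAx] at h3 ⊢
      linarith)
    (fun x v w => P.gradient_skew hks x v w)
  have hWO : ∀ m : ℕ, (fun x => W x - x) =O[𝓝 0] fun x => ‖x‖ ^ m := fun m => by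
    obtain ⟨C, hC⟩ := hWid m
    refine IsBigO.of_bound C ?_
    filter_upwards [Metric.closedBall_mem_nhds (0 : E) one_pos] with x hx
    simpa using hC x (mem_closedBall_zero_iff.1 hx)
  have hW0 : Tendsto W (𝓝 0) (𝓝 0) := by
    have := (tendsto_zero_of_isBigO_norm_pow one_ne_zero (hWO 1)).add tendsto_id
    simpa using this
  refine ⟨W, hW, hWO, hsymp, ?_⟩
  filter_upwards [hGQ, hW0.eventually hGQ, hW0.eventually (hkf.fderiv (𝕜 := ℝ))] with x h1 h2 h3
  have h4 := hconj x
  simp only [hY, hZ, h1, h2, h3] at h4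
  exact h4

end FlatRemoval

section FlatRemoval

open Asymptotics Filter SpectralCoords

theorem isBigO_comp_of_sub_id {E F : Type*} [NormedAddCommGroup E] [NormedAddCommGroup F]
    {W : E → E} (hW : (fun x => W x - x) =O[𝓝 0] fun x => ‖x‖ ^ 2) {f : E → F} {m : ℕ}
    (hf : f =O[𝓝 0] fun x => ‖x‖ ^ m) : (fun x => f (W x)) =O[𝓝 0] fun x => ‖x‖ ^ m :=
  (hf.comp_tendsto (isBigO_sub_id_tendsto hW)).trans ((isBigO_sub_id_norm hW).norm_left.pow m)

theorem eventually_norm_sq_le_quadSum_of_comp {E : Type*} [NormedAddCommGroup E] [NormedSpace ℝ E]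
    {κ : Type*} (z : κ → E →L[ℝ] ℂ) (s : Finset κ) {W : E → E}
    (hW : (fun x => W x - x) =O[𝓝 0] fun x => ‖x‖ ^ 2) {C : ℝ} (hC : 0 ≤ C) :
    ∀ᶠ x in 𝓝 0, ‖W x‖ ^ 2 ≤ C * quadSum z s (W x) → ‖x‖ ^ 2 ≤ 8 * C * quadSum z s x := by
  obtain ⟨D, hD, hWD⟩ := hW.exists_nonneg
  set M : ℝ := ∑ i ∈ s, ‖z i‖ ^ 2 with hM
  have hM0 : 0 ≤ M := Finset.sum_nonneg fun i _ => sq_nonneg _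
  have hsmall : ∀ᶠ x in 𝓝 (0 : E), (4 * C * M + 2) * D ^ 2 * ‖x‖ ^ 2 < 1 / 2 := by
    have h1 : Tendsto (fun x : E => (4 * C * M + 2) * D ^ 2 * ‖x‖ ^ 2) (𝓝 0)
        (𝓝 ((4 * C * M + 2) * D ^ 2 * ‖(0 : E)‖ ^ 2)) :=
      ((continuous_norm.pow 2).const_mul _).tendsto 0
    exact h1.eventually (gt_mem_nhds (by norm_num))
  filter_upwards [hWD.bound, hsmall] with x h1 h2 h3
  rw [norm_pow, norm_norm] at h1
  have h4 : ‖W x - x‖ ^ 2 ≤ D ^ 2 * ‖x‖ ^ 2 * ‖x‖ ^ 2 := by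
    calc ‖W x - x‖ ^ 2 ≤ (D * ‖x‖ ^ 2) ^ 2 := pow_le_pow_left₀ (norm_nonneg _) h1 2
      _ = _ := by ring
  have hsq : ∀ p q r : ℝ, 0 ≤ p → p ≤ q + r → p ^ 2 ≤ 2 * q ^ 2 + 2 * r ^ 2 :=
    fun p q r hp hpq => by
    nlinarith [sq_nonneg (q - r)]
  have h5 : quadSum z s (W x) ≤ 2 * quadSum z s x + 2 * M * ‖W x - x‖ ^ 2 := by
    rw [quadSum, quadSum, Finset.mul_sum, hM, Finset.mul_sum, Finset.sum_mul,
      ← Finset.sum_add_distrib]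
    refine Finset.sum_le_sum fun i _ => ?_
    have h6 : ‖z i (W x)‖ ≤ ‖z i x‖ + ‖z i‖ * ‖W x - x‖ := by
      have h7 : z i (W x) = z i x + z i (W x - x) := by rw [← map_add, add_sub_cancel]
      rw [h7]
      exact (norm_add_le _ _).trans (add_le_add_right ((z i).le_opNorm _) _)
    refine (hsq _ _ _ (norm_nonneg _) h6).trans_eq ?_
    ring
  have h6 : ‖x‖ ≤ ‖W x‖ + ‖W x - x‖ := by
    rw [norm_sub_rev]
    exact norm_le_norm_add_norm_sub' _ _
  have h7 := hsq _ _ _ (norm_nonneg _) h6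
  have h8 := mul_le_mul_of_nonneg_left h5 hC
  have h9 := mul_le_mul_of_nonneg_left h4 (show 0 ≤ 4 * C * M + 2 by positivity)
  have h10 := mul_le_mul_of_nonneg_right h2.le (sq_nonneg ‖x‖)
  nlinarith

variable {E : Type} [NormedAddCommGroup E] [NormedSpace ℝ E] [FiniteDimensional ℝ E]
  {Ω : E →L[ℝ] E →L[ℝ] ℝ} {J : (E →L[ℝ] ℝ) →L[ℝ] E}
  {S N : E →ₗ[ℝ] E} {δ : ℝ} {n K : ℕ} {z : Fin n × Fin K → E →L[ℝ] ℂ} {l : Fin n → ℂ}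

/-- A flat Hamiltonian perturbation of a hyperbolic normal form can be removed. -/
theorem SympPair.exists_sympConj_remove_flat (P : SympPair Ω J) (h : SpectralCoords S N δ z l)
    {c : ℝ} (hc : 0 < c) (hl : ∀ i, (l i).re ≤ -c ∨ c ≤ (l i).re) (hδ : 2 * |δ| ≤ c)
    (hA : ∀ v w, Ω (S v + N v) w + Ω v (S w + N w) = Ω v w)
    {Q : E → ℝ} (hQ : ContDiff ℝ ∞ Q) (hQ3 : Q =O[𝓝 0] fun x => ‖x‖ ^ 3)
    (hQS : ∀ x, fderiv ℝ (fun x => J (fderiv ℝ Q x)) x (S x) = S (J (fderiv ℝ Q x)))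
    {f : E → ℝ} (hf : ContDiff ℝ ∞ f) (hfO : ∀ m : ℕ, f =O[𝓝 0] fun x => ‖x‖ ^ m) :
    SympConj Ω (fun x => S x + N x + J (fderiv ℝ Q x) + J (fderiv ℝ f x))
      (fun x => S x + N x + J (fderiv ℝ Q x)) := by
  classical
  set s : Finset (Fin n) := Finset.univ.filter fun i => (l i).re ≤ -c with hs
  set u : Finset (Fin n) := Finset.univ.filter fun i => c ≤ (l i).re with hu
  have hs' : ∀ i ∈ s, (l i).re ≤ -c := fun i hi => (Finset.mem_filter.1 hi).2
  have hu' : ∀ i ∈ u, c ≤ (l i).re := fun i hi => (Finset.mem_filter.1 hi).2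
  have hsu : ∀ i, i ∈ s ∨ i ∈ u := fun i => by simpa [hs, hu] using hl i
  set a := quadSum z (block n K s) with ha
  set b := quadSum z (block n K u) with hb
  obtain ⟨C, hC, hab⟩ := h.exists_norm_sq_le_add hsu
  obtain ⟨θ, hθf, hθ0, hθ1, hθa, hθb⟩ := exists_cone_splitting (contDiff_quadSum z (block n K s))
    (contDiff_quadSum z (block n K u)) (quadSum_nonneg z _) (quadSum_nonneg z _)
    (fun x hx => by
      have h1 : 0 < ‖x‖ ^ 2 := by positivity
      exact pos_of_mul_pos_right (h1.trans_le (hab x)) hC.le)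
    (quadSum_smul z _) (quadSum_smul z _) hf hfO
  have hθO : ∀ m : ℕ, (fun x => θ x * f x) =O[𝓝 0] fun x => ‖x‖ ^ m := fun m => by
    refine (IsBigO.of_bound 1 (Eventually.of_forall fun x => ?_)).trans (hfO m)
    rw [norm_mul, Real.norm_of_nonneg (hθ0 x)]
    exact mul_le_mul_of_nonneg_right (hθ1 x) (norm_nonneg _)
  obtain ⟨W₁, hW₁, hW₁O, hW₁s, hW₁c⟩ := P.exists_flat_conjugacy h hc hs' hu' hsu hδ (κ := 1)
    (fun v w => by rw [hA, one_mul]) hQ hQ3 hQS hθf hθO (C := C * 5)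
    (Eventually.of_forall fun x hx => by
      have h1 : ¬ a x ≤ b x / 4 := fun h0 => left_ne_zero_of_mul hx (hθa x h0)
      refine (hab x).trans ?_
      rw [mul_assoc]
      exact mul_le_mul_of_nonneg_left (by linarith) hC.le)
  set g : E → ℝ := fun x => f x - θ x * f x with hg
  have hgs : ContDiff ℝ ∞ g := hf.sub hθf
  have hgO : ∀ m : ℕ, g =O[𝓝 0] fun x => ‖x‖ ^ m := fun m => (hfO m).sub (hθO m)
  have hgC : ∀ x, g x ≠ 0 → ‖x‖ ^ 2 ≤ C * 5 * b x := fun x hx => by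
    rcases eq_or_ne x 0 with rfl | hx0
    · rw [norm_zero, zero_pow two_ne_zero]
      exact mul_nonneg (by positivity) (quadSum_nonneg z _ _)
    · have h1 : ¬ b x ≤ a x / 4 := fun h0 => hx (by simp [hg, hθb x hx0 h0])
      refine (hab x).trans ?_
      rw [mul_assoc]
      exact mul_le_mul_of_nonneg_left (by linarith) hC.le
  set g₂ : E → ℝ := fun x => g (W₁ x) with hg₂
  have hg₂s : ContDiff ℝ ∞ g₂ := hgs.comp hW₁
  have hg₂O : ∀ m : ℕ, g₂ =O[𝓝 0] fun x => ‖x‖ ^ m := fun m =>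
    isBigO_comp_of_sub_id (hW₁O 2) (hgO m)
  have hnegQ : ∀ x, J (fderiv ℝ (fun y => -Q y) x) = -J (fderiv ℝ Q x) := fun x => by
    rw [fderiv_fun_neg, map_neg]
  have hnegg : ∀ x, J (fderiv ℝ (fun y => -g₂ y) x) = -J (fderiv ℝ g₂ x) := fun x => by
    rw [fderiv_fun_neg, map_neg]
  obtain ⟨W₂, hW₂, hW₂O, hW₂s, hW₂c⟩ := P.exists_flat_conjugacy h.neg hc (s := u) (u := s)
    (fun i hi => by simpa using hu' i hi) (fun i hi => by simpa using le_neg.1 (hs' i hi))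
    (fun i => (hsu i).symm) (by rwa [abs_neg]) (κ := -1)
    (fun v w => by
      have := hA v w
      simp only [LinearMap.neg_apply, ← neg_add, map_neg, _root_.neg_apply]
      linarith)
    hQ.neg hQ3.neg_left
    (fun x => by
      simp only [hnegQ, LinearMap.neg_apply, map_neg, neg_neg]
      rw [fderiv_fun_neg, _root_.neg_apply, neg_neg, hQS])
    hg₂s.neg (fun m => (hg₂O m).neg_left) (C := 8 * (C * 5))
    (by
      filter_upwards [eventually_norm_sq_le_quadSum_of_comp z (block n K u) (hW₁O 2)
        (C := C * 5) (by positivity)] with x hx hgx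
      exact hx (hgC _ (neg_ne_zero.1 hgx)))
  have hfix : ∀ {W : E → E}, (∀ m : ℕ, (fun x => W x - x) =O[𝓝 0] fun x => ‖x‖ ^ m) → W 0 = 0 :=
    fun hW => by
      obtain ⟨D, hD⟩ := (hW 1).bound
      simpa using hD.self_of_nhds
  have hc₁ : SympConj Ω (fun x => S x + N x + J (fderiv ℝ Q x) + J (fderiv ℝ f x))
      (fun x => S x + N x + J (fderiv ℝ Q x) + J (fderiv ℝ g₂ x)) := by
    refine ⟨W₁, hfix hW₁O, ?_⟩
    filter_upwards [hW₁c] with x hx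
    refine ⟨hW₁.contDiffAt, hW₁s x, ?_⟩
    have h1 : fderiv ℝ f (W₁ x) = fderiv ℝ (fun x => θ x * f x) (W₁ x) + fderiv ℝ g (W₁ x) := by
      rw [← fderiv_fun_add (hθf.differentiable (by simp) _) (hgs.differentiable (by simp) _)]
      simp only [hg, add_sub_cancel]
    rw [map_add, hx, P.fderiv_gradient_comp (hW₁.differentiable (by simp) x)
      (hgs.differentiable (by simp) _) (hW₁s x), h1, map_add, add_assoc _ (J _)]
  refine hc₁.trans ⟨W₂, hfix hW₂O, ?_⟩
  filter_upwards [hW₂c] with x hx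
  refine ⟨hW₂.contDiffAt, hW₂s x, neg_injective ?_⟩
  simp only [hnegQ, hnegg, LinearMap.neg_apply, ← neg_add, map_neg] at hx
  exact hx

end FlatRemoval

section NormalForm

open Asymptotics Filter

variable {E : Type} [NormedAddCommGroup E] [NormedSpace ℝ E] [FiniteDimensional ℝ E]
  {Ω : E →L[ℝ] E →L[ℝ] ℝ} {J : (E →L[ℝ] ℝ) →L[ℝ] E}

/-- Jordan–Chevalley decomposition of a real endomorphism. -/
theorem Module.End.exists_isSemisimple_add_isNilpotent (A : E →ₗ[ℝ] E) :
    ∃ S N : E →ₗ[ℝ] E, Module.End.IsSemisimple S ∧ IsNilpotent N ∧ Commute S N ∧ A = S + N := by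
  obtain ⟨N, hNm, S, hSm, hN, hS, hAE⟩ :=
    Module.End.exists_isNilpotent_isSemisimple (K := ℝ) (f := A)
  exact ⟨S, N, hS, hN, (Algebra.commute_of_mem_adjoin_singleton_of_commute hNm
    (Algebra.commute_of_mem_adjoin_self hSm).symm), hAE.trans (add_comm N S)⟩

/-- The Hamiltonian perturbation of a conformal linear field commutes with its semisimple part. -/
theorem SympPair.normalForm_commute (P : SympPair Ω J) {S N : E →ₗ[ℝ] E}
    (hSΩ : ∀ u v, Ω (S u) v + Ω u (S v) = Ω u v) (hSN : Commute S N) {Q : E → ℝ}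
    (hQ : ContDiff ℝ ∞ Q) (hQ3 : Q =O[𝓝 0] fun x => ‖x‖ ^ 3)
    (hQS : ∀ x, fderiv ℝ Q x (S x) = Q x) :
    ContDiff ℝ ∞ (fun x => S x + N x + J (fderiv ℝ Q x)) ∧
      (∀ v, fderiv ℝ (fun x => S x + N x + J (fderiv ℝ Q x)) 0 v = S v + N v) ∧
      (∀ x, fderiv ℝ (fun x => J (fderiv ℝ Q x)) x (S x) = S (J (fderiv ℝ Q x))) ∧
      ∀ x, fderiv ℝ (fun x => S x + N x + J (fderiv ℝ Q x)) x (S x) =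
        S (S x + N x + J (fderiv ℝ Q x)) := by
  have : CompleteSpace E := FiniteDimensional.complete ℝ E
  obtain ⟨T, hT⟩ : ∃ T : E →L[ℝ] E, ∀ x, T x = S x :=
    ⟨LinearMap.toContinuousLinearMap S, fun x => rfl⟩
  obtain ⟨A, hA⟩ : ∃ A : E →L[ℝ] E, ∀ x, S x + N x = A x :=
    ⟨LinearMap.toContinuousLinearMap (S + N), fun x => rfl⟩
  have hQS' : ∀ x, fderiv ℝ (fun x => J (fderiv ℝ Q x)) x (S x) = S (J (fderiv ℝ Q x)) :=
    fun x => by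
    rw [← hT, ← hT]
    exact P.fderiv_gradient_apply (S := T) (by simpa only [hT] using hSΩ) hQ
      (by simpa only [hT] using hQS) x
  have hGs : ContDiff ℝ ∞ (fun x => J (fderiv ℝ Q x)) := SympPair.contDiff_gradient hQ
  have hY : ∀ x, fderiv ℝ (fun x => S x + N x + J (fderiv ℝ Q x)) x =
      A + fderiv ℝ (fun x => J (fderiv ℝ Q x)) x := fun x => by
    simp only [hA]
    rw [fderiv_fun_add A.differentiableAt (hGs.differentiable (by simp) x), A.fderiv]
  refine ⟨?_, fun v => ?_, hQS', fun x => ?_⟩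
  · simp only [hA]
    exact A.contDiff.add hGs
  · have h1 := ((hQ.fderiv_right (m := ∞) (by simp)).fderiv_isBigO_pow (d := 1)
      (hQ.fderiv_isBigO_pow (d := 2) hQ3))
    obtain ⟨D, hD⟩ := h1.bound
    have h2 : fderiv ℝ (fderiv ℝ Q) 0 = 0 := by simpa using hD.self_of_nhds
    rw [hY, hA, (SympPair.hasFDerivAt_gradient hQ 0).fderiv, h2]
    simp
  · rw [hY, _root_.add_apply, hQS', ← hA, map_add, map_add]
    have h1 : N (S x) = S (N x) := (LinearMap.congr_fun hSN.eq x).symm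
    rw [h1]

/-- Smooth normalization of a Liouville vector field with hyperbolic linear part. -/
theorem SympPair.exists_sympConj_commute (P : SympPair Ω J) {H : E → ℝ} (hH : ContDiff ℝ ∞ H)
    (hH0 : H 0 = 0) {B : E →L[ℝ] E →L[ℝ] ℝ} (hB : ∀ u v, B u v = B v u)
    (hHB : (fun x => fderiv ℝ H x - B x) =O[𝓝 0] fun x => ‖x‖ ^ 2) {c : ℝ} (hc : 0 < c)
    (hyp : ∀ (l : ℂ) (y : E →ₗ[ℝ] ℂ), y ≠ 0 → (∀ x, y ((1 / 2 : ℝ) • x + J (B x)) = l * y x) →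
      c ≤ |l.re|) :
    ∃ (S N : E →ₗ[ℝ] E) (Y : E → E), Module.End.IsSemisimple S ∧ IsNilpotent N ∧ Commute S N ∧
      ContDiff ℝ ∞ Y ∧ (∀ v, fderiv ℝ Y 0 v = S v + N v) ∧
      (∀ x, fderiv ℝ Y x (S x) = S (Y x)) ∧
      SympConj Ω (fun x => (1 / 2 : ℝ) • x + J (fderiv ℝ H x)) Y := by
  obtain ⟨A, hAx⟩ : ∃ A : E →ₗ[ℝ] E, ∀ x, A x = (1 / 2 : ℝ) • x + J (B x) :=
    ⟨((1 / 2 : ℝ) • ContinuousLinearMap.id ℝ E + J.comp B : E →L[ℝ] E), fun x => rfl⟩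
  have hAΩ : ∀ u v, Ω (A u) v + Ω u (A v) = Ω u v := fun u v => by
    have h1 := P.skew u (J (B v))
    simp only [hAx, map_add, map_smul, _root_.add_apply, _root_.smul_apply, P.form_apply, h1,
      smul_eq_mul, hB v u]
    ring
  obtain ⟨S, N, hS, hN, hSN, hAE⟩ := Module.End.exists_isSemisimple_add_isNilpotent A
  have hASN : ∀ x, S x + N x = A x := fun x => (LinearMap.congr_fun hAE x).symm
  have hSΩ := P.conformal_of_isSemisimple hAΩ hAE hS hN hSN
  obtain ⟨n, K, z, l, h, hl⟩ := exists_spectralCoords hS hN hSN (δ := c / 2) (by positivity)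
  obtain ⟨Q, f, hQ, hf, hQ3, hQS, hfO, hconj⟩ := P.exists_sympConj_normalForm h hH hH0 hB hHB
    fun x => by rw [hASN, hAx]
  obtain ⟨h1, h2, h3, h4⟩ := P.normalForm_commute hSΩ hSN hQ hQ3 hQS
  refine ⟨S, N, fun x => S x + N x + J (fderiv ℝ Q x), hS, hN, hSN, h1, h2, h4,
    hconj.trans (P.exists_sympConj_remove_flat h hc (fun i => ?_) ?_ ?_ hQ hQ3 h3 hf hfO)⟩
  · obtain ⟨y, hy, hyA⟩ := hl i
    have := hyp (l i) y hy fun x => by rw [← hAx, ← hASN, hyA]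
    rcases le_abs.1 this with h | h
    · exact Or.inr h
    · exact Or.inl (by linarith)
  · rw [abs_of_pos (by positivity)]
    linarith
  · intro v w
    rw [hASN, hASN, hAΩ]

end NormalForm

section Liouville

open Asymptotics Filter

variable {E : Type} [NormedAddCommGroup E] [NormedSpace ℝ E] [FiniteDimensional ℝ E]
  {Ω : E →L[ℝ] E →L[ℝ] ℝ} {J : (E →L[ℝ] ℝ) →L[ℝ] E}

/-- A smooth primitive of a constant symplectic form is half its contraction with the position
vector, up to an exact form. -/
theorem SympPair.exists_hamiltonian_of_primitive (P : SympPair Ω J) {U : Set E} (hU : IsOpen U)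
    (h0U : (0 : E) ∈ U) {γ : E → E →L[ℝ] ℝ} (hγ : ContDiffOn ℝ ∞ γ U)
    (hdγ : ∀ x ∈ U, ∀ u v, fderiv ℝ γ x u v - fderiv ℝ γ x v u = Ω u v) :
    ∃ H : E → ℝ, ContDiff ℝ ∞ H ∧ H 0 = 0 ∧
      ∀ᶠ x in 𝓝 0, fderiv ℝ H x = γ x - (1 / 2 : ℝ) • Ω x := by
  obtain ⟨r, hr, hrU⟩ := Metric.isOpen_iff.1 hU 0 h0U
  have hθ : ContDiffOn ℝ ∞ (fun x => γ x - ((1 / 2 : ℝ) • Ω) x) (Metric.ball 0 r) :=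
    (hγ.mono hrU).sub ((1 / 2 : ℝ) • Ω).contDiff.contDiffOn
  have hθd := hθ.differentiableOn (by simp)
  obtain ⟨f, hf⟩ := (convex_ball (0 : E) r).exists_forall_hasFDerivAt_of_fderiv_symmetric
    Metric.isOpen_ball hθd fun a ha x y => by
      have hγa : DifferentiableAt ℝ γ a :=
        ((hγ.differentiableOn (by simp)) a (hrU ha)).differentiableAt (hU.mem_nhds (hrU ha))
      have h1 := hdγ a (hrU ha) x y
      have h2 := P.skew x y
      rw [fderiv_fun_sub hγa ((1 / 2 : ℝ) • Ω).differentiableAt, ContinuousLinearMap.fderiv]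
      simp only [_root_.sub_apply, _root_.smul_apply, smul_eq_mul]
      linarith
  have hfs : ContDiffOn ℝ ∞ f (Metric.ball 0 r) :=
    (contDiffOn_infty_iff_fderiv_of_isOpen Metric.isOpen_ball).2
      ⟨fun x hx => (hf x hx).differentiableAt.differentiableWithinAt,
        hθ.congr fun x hx => (hf x hx).fderiv⟩
  have hb : ∀ᶠ x in 𝓝 (0 : E), x ∈ Metric.ball (0 : E) r := Metric.ball_mem_nhds 0 hr
  obtain ⟨g, hg, hgf⟩ := exists_contDiff_eventuallyEq (f := f) (by
    filter_upwards [hb] with x hx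
    exact hfs.contDiffAt (Metric.isOpen_ball.mem_nhds hx))
  refine ⟨fun x => g x - g 0, hg.sub contDiff_const, sub_self _, ?_⟩
  filter_upwards [hb, hgf.fderiv (𝕜 := ℝ)] with x hx hx'
  rw [fderiv_sub_const, hx', (hf x hx).fderiv]
  rfl

/-- Smooth normalization of a primitive of a constant symplectic form. -/
theorem SympPair.exists_sympConj_of_primitive (P : SympPair Ω J) {U : Set E} (hU : IsOpen U)
    (h0U : (0 : E) ∈ U) {γ : E → E →L[ℝ] ℝ} (hγ : ContDiffOn ℝ ∞ γ U) (hγ0 : γ 0 = 0)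
    (hdγ : ∀ x ∈ U, ∀ u v, fderiv ℝ γ x u v - fderiv ℝ γ x v u = Ω u v)
    {X : E → E} (hX : ∀ x ∈ U, ∀ v, Ω (X x) v = γ x v) {c : ℝ} (hc : 0 < c)
    (hyp : ∀ (l : ℂ) (y : E →ₗ[ℝ] ℂ), y ≠ 0 → (∀ x, y (fderiv ℝ X 0 x) = l * y x) →
      c ≤ |l.re|) :
    ∃ (S N : E →ₗ[ℝ] E) (Y : E → E), Module.End.IsSemisimple S ∧ IsNilpotent N ∧ Commute S N ∧
      ContDiff ℝ ∞ Y ∧ (∀ v, fderiv ℝ Y 0 v = S v + N v) ∧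
      (∀ x, fderiv ℝ Y x (S x) = S (Y x)) ∧ SympConj Ω X Y := by
  obtain ⟨H, hH, hH0, hHγ⟩ := P.exists_hamiltonian_of_primitive hU h0U hγ hdγ
  have hXH : (fun x => (1 / 2 : ℝ) • x + J (fderiv ℝ H x)) =ᶠ[𝓝 0] X := by
    filter_upwards [hHγ, hU.mem_nhds h0U] with x hx hxU
    rw [hx, map_sub, map_smul, P.apply_form, add_sub_cancel]
    exact P.eq_of_form_eq fun w => by rw [P.form_apply, hX x hxU]
  have hH' : ContDiff ℝ ∞ (fderiv ℝ H) := hH.fderiv_right (m := ∞) (by simp)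
  have hdH0 : fderiv ℝ H 0 = 0 := by
    rw [hHγ.self_of_nhds, hγ0]
    simp
  set B := fderiv ℝ (fderiv ℝ H) 0 with hBdef
  have hfX : ∀ x, fderiv ℝ X 0 x = (1 / 2 : ℝ) • x + J (B x) := fun x => by
    have h1 : HasFDerivAt (fun x => (1 / 2 : ℝ) • x + J (fderiv ℝ H x)) _ 0 :=
      ((hasFDerivAt_id (0 : E)).const_smul (1 / 2 : ℝ)).add (SympPair.hasFDerivAt_gradient hH 0)
    rw [← hXH.fderiv_eq, h1.fderiv]
    rfl
  have hgs : ContDiff ℝ ∞ (fun x => fderiv ℝ H x - B x) := hH'.sub B.contDiff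
  have hg' : ContDiff ℝ ∞ (fderiv ℝ fun x => fderiv ℝ H x - B x) :=
    hgs.fderiv_right (m := ∞) (by simp)
  have hHB : (fun x => fderiv ℝ H x - B x) =O[𝓝 0] fun x => ‖x‖ ^ 2 := by
    refine isBigO_pow_succ_of_fderiv (hgs.differentiable (by simp)) (by simp [hdH0]) ?_
    have h1 : fderiv ℝ (fun x => fderiv ℝ H x - B x) 0 = 0 := by
      rw [fderiv_fun_sub (hH'.differentiable (by simp) 0) B.differentiableAt, B.fderiv, ← hBdef,
        sub_self]
    have h2 := (hg'.differentiable (by simp) 0).isBigO_sub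
    simp only [h1, sub_zero] at h2
    simpa only [pow_one] using h2.norm_right
  obtain ⟨S, N, Y, hS, hN, hSN, hY, hY0, hYS, hconj⟩ := P.exists_sympConj_commute hH hH0
    (B := B) (fun u v => SympPair.symm_fderiv_fderiv hH 0 u v) hHB hc
    fun l y hy hyl => hyp l y hy fun x => by rw [hfX, hyl]
  exact ⟨S, N, Y, hS, hN, hSN, hY, hY0, hYS, hconj.congr hXH EventuallyEq.rfl⟩

/-- A symplectic conjugacy of germs at the origin restricts to a diffeomorphism onto its image. -/
theorem SympPair.exists_openPartialHomeomorph_of_sympConj (P : SympPair Ω J) {X Y : E → E}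
    (h : SympConj Ω X Y) {U : Set E} (hU : U ∈ 𝓝 0) :
    ∃ e : OpenPartialHomeomorph E E, (0 : E) ∈ e.source ∧ e 0 = 0 ∧ ContDiffOn ℝ ∞ e e.source ∧
      ContDiffOn ℝ ∞ e.symm e.target ∧ ∀ x ∈ e.source, e x ∈ U ∧
        (∀ u v, Ω (fderiv ℝ e x u) (fderiv ℝ e x v) = Ω u v) ∧ fderiv ℝ e x (Y x) = X (e x) := by
  have : CompleteSpace E := FiniteDimensional.complete ℝ E
  obtain ⟨φ, hφ0, hφ⟩ := h
  obtain ⟨h1, h2, -⟩ := hφ.self_of_nhds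
  have hU' : ∀ᶠ x in 𝓝 (0 : E), φ x ∈ U := h1.continuousAt.eventually (by rwa [hφ0])
  obtain ⟨e', he'⟩ : ∃ e' : E ≃L[ℝ] E, (e' : E →L[ℝ] E) = fderiv ℝ φ 0 :=
    ⟨ContinuousLinearEquiv.ofBijective (fderiv ℝ φ 0)
      (LinearMap.ker_eq_bot.2 (P.injective_of_symplectic h2))
      (LinearMap.range_eq_top.2 (P.surjective_of_symplectic h2)), by ext; simp⟩
  obtain ⟨e, he, h0, hs, hsm, hsym⟩ := exists_openPartialHomeomorph_of_smooth
    (hφ.mono fun x hx => hx.1) (e' := e')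
    (by rw [he']; exact (h1.differentiableAt (by simp)).hasFDerivAt) (hφ.and hU')
  refine ⟨e, h0, by rw [he, hφ0], fun x hx => ?_, fun y hy => (hsym y hy).contDiffWithinAt,
    fun x hx => ?_⟩
  · rw [he]
    exact (hsm x hx).contDiffWithinAt
  · rw [he]
    exact ⟨(hs hx).2, (hs hx).1.2⟩

end Liouville

section Standard

/-- The standard symplectic form together with its inverse. -/
theorem exists_sympPair_standard (n : ℕ) :
    ∃ (Ω : (Fin (n + n) → ℝ) →L[ℝ] (Fin (n + n) → ℝ) →L[ℝ] ℝ)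
      (J : ((Fin (n + n) → ℝ) →L[ℝ] ℝ) →L[ℝ] (Fin (n + n) → ℝ)), SympPair Ω J ∧
      ∀ u v, Ω u v = ∑ i : Fin n, (u (Fin.castAdd n i) * v (Fin.natAdd n i) -
        u (Fin.natAdd n i) * v (Fin.castAdd n i)) := by
  let p : Fin (n + n) → (Fin (n + n) → ℝ) →L[ℝ] ℝ := fun i => ContinuousLinearMap.proj i
  let Ω : (Fin (n + n) → ℝ) →L[ℝ] (Fin (n + n) → ℝ) →L[ℝ] ℝ :=
    ∑ i : Fin n, ((p (Fin.castAdd n i)).smulRight (p (Fin.natAdd n i)) -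
      (p (Fin.natAdd n i)).smulRight (p (Fin.castAdd n i)))
  let a : Fin (n + n) → ((Fin (n + n) → ℝ) →L[ℝ] ℝ) →L[ℝ] ℝ := fun i =>
    ContinuousLinearMap.apply ℝ ℝ (Pi.single i 1)
  let J : ((Fin (n + n) → ℝ) →L[ℝ] ℝ) →L[ℝ] (Fin (n + n) → ℝ) := ContinuousLinearMap.pi
    (Fin.addCases (fun i => a (Fin.natAdd n i)) fun i => -a (Fin.castAdd n i))
  have hΩ : ∀ u v, Ω u v = ∑ i : Fin n, (u (Fin.castAdd n i) * v (Fin.natAdd n i) -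
      u (Fin.natAdd n i) * v (Fin.castAdd n i)) := fun u v => by
    simp [Ω, p]
  have hJ₁ : ∀ f i, J f (Fin.castAdd n i) = f (Pi.single (Fin.natAdd n i) 1) := fun f i => by
    simp [J, a]
  have hJ₂ : ∀ f i, J f (Fin.natAdd n i) = -f (Pi.single (Fin.castAdd n i) 1) := fun f i => by
    simp [J, a, -Fin.natAdd_eq_addNat]
  have hform : ∀ f v, Ω (J f) v = f v := fun f v => by
    have h1 : f v = ∑ i, v i * f (Pi.single i 1) := by
      conv_lhs => rw [← Finset.univ_sum_single v, map_sum]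
      refine Finset.sum_congr rfl fun i _ => ?_
      rw [← smul_eq_mul, ← map_smul, ← Pi.single_smul, smul_eq_mul, mul_one]
    rw [h1, hΩ, Fin.sum_univ_add, ← Finset.sum_add_distrib]
    refine Finset.sum_congr rfl fun i _ => ?_
    rw [hJ₁, hJ₂]
    ring
  refine ⟨Ω, J, ⟨fun u v => ?_, hform, fun u => ?_⟩, hΩ⟩
  · rw [hΩ, hΩ, ← Finset.sum_neg_distrib]
    exact Finset.sum_congr rfl fun i _ => by ring
  · have hne : ∀ i j : Fin n, Fin.castAdd n i ≠ Fin.natAdd n j := fun i j h => by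
      have := congrArg Fin.val h
      simp only [Fin.val_castAdd, Fin.val_natAdd] at this
      omega
    funext k
    refine Fin.addCases (fun i => ?_) (fun i => ?_) k
    · rw [hJ₁, hΩ]
      simp [Pi.single_apply, hne, -Fin.natAdd_eq_addNat]
    · rw [hJ₂, hΩ]
      simp [Pi.single_apply, (hne _ _).symm, -Fin.natAdd_eq_addNat]

/-- The real parts of the eigenvalues of a hyperbolic matrix are bounded away from zero. -/
theorem exists_pos_le_abs_re_of_charpoly {m : ℕ} (A : (Fin m → ℝ) →ₗ[ℝ] (Fin m → ℝ))
    (hA : ∀ μ ∈ (Matrix.charpoly ((LinearMap.toMatrix' A).map (algebraMap ℝ ℂ))).roots,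
      Complex.re μ ≠ 0) :
    ∃ c > 0, ∀ (l : ℂ) (y : (Fin m → ℝ) →ₗ[ℝ] ℂ), y ≠ 0 → (∀ x, y (A x) = l * y x) →
      c ≤ |l.re| := by
  set M := (LinearMap.toMatrix' A).map (algebraMap ℝ ℂ) with hM
  have hroot : ∀ (l : ℂ) (y : (Fin m → ℝ) →ₗ[ℝ] ℂ), y ≠ 0 → (∀ x, y (A x) = l * y x) →
      l ∈ M.charpoly.roots := by
    intro l y hy hyl
    rw [Polynomial.mem_roots M.charpoly_monic.ne_zero, Polynomial.IsRoot.def, Matrix.eval_charpoly]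
    refine Matrix.exists_vecMul_eq_zero_iff.1 ⟨fun j => y (Pi.single j 1), fun h0 => hy ?_, ?_⟩
    · exact (Pi.basisFun ℝ (Fin m)).ext fun j => by simpa using congrFun h0 j
    · funext j
      have h1 : y (A (Pi.single j 1)) = ∑ i, y (Pi.single i 1) * M i j := by
        conv_lhs => rw [← Finset.univ_sum_single (A (Pi.single j 1)), map_sum]
        refine Finset.sum_congr rfl fun i _ => ?_
        have h2 : Pi.single i (A (Pi.single j 1) i) =
            A (Pi.single j 1) i • (Pi.single i 1 : Fin m → ℝ) := by
          rw [← Pi.single_smul, smul_eq_mul, mul_one]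
        rw [h2, map_smul, Complex.real_smul, mul_comm, hM, Matrix.map_apply,
          LinearMap.toMatrix'_apply]
        rfl
      rw [Matrix.vecMul_sub, Pi.sub_apply, Pi.zero_apply, Matrix.scalar_apply,
        Matrix.vecMul_diagonal, Matrix.vecMul, dotProduct, ← h1, hyl, mul_comm, sub_self]
  obtain hs | hs := M.charpoly.roots.toFinset.eq_empty_or_nonempty
  · refine ⟨1, one_pos, fun l y hy hyl => ?_⟩
    have := Multiset.mem_toFinset.2 (hroot l y hy hyl)
    simp [hs] at this
  · obtain ⟨μ, hμ, hmin⟩ := Finset.exists_min_image _ (fun l : ℂ => |l.re|) hs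
    exact ⟨|μ.re|, abs_pos.2 (hA μ (Multiset.mem_toFinset.1 hμ)), fun l y hy hyl =>
      hmin l (Multiset.mem_toFinset.2 (hroot l y hy hyl))⟩

end Standard

end Preliminaries

/-- (Smooth normalization of a hyperbolic primitive 1-form.) If `γ` is a smooth
primitive 1-form of the standard symplectic form `ω₀` on `ℝ^{2n}` with `γ(0) = 0` whose
associated conformal vector field `X` (with `ω₀(X(x),·) = γₓ`) has hyperbolic linear part
`DX(0)`, then there is a local smooth diffeomorphism `φ` fixing `0` which preserves `ω₀` and
transports `X` to a vector field `Y` (with `Dφ(x)·Y(x) = X(φ(x))`) in Poincaré–Dulac normal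
form: `Y` commutes with the linear vector field of the semisimple part `S` of the
Jordan–Chevalley decomposition of `DY(0)`. Consequently `φ*γ = i_Y ω₀`. -/
theorem primitive_one_form_smooth_normalization
    (n : ℕ)
    (ω₀ : (Fin (n+n) → ℝ) → (Fin (n+n) → ℝ) → ℝ)
    (hω₀ : ∀ u v : Fin (n+n) → ℝ, ω₀ u v =
      ∑ i : Fin n, (u (Fin.castAdd n i) * v (Fin.natAdd n i)
                    - u (Fin.natAdd n i) * v (Fin.castAdd n i)))
    (U : Set (Fin (n+n) → ℝ)) (hU : IsOpen U) (h0U : (0 : Fin (n+n) → ℝ) ∈ U)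
    (γ : (Fin (n+n) → ℝ) → (Fin (n+n) → ℝ) →L[ℝ] ℝ)
    (hγ : ContDiffOn ℝ (⊤ : ℕ∞) γ U) (hγ0 : γ 0 = 0)
    -- dγ = ω₀ :
    (hdγ : ∀ x ∈ U, ∀ u v : Fin (n+n) → ℝ,
      fderiv ℝ γ x u v - fderiv ℝ γ x v u = ω₀ u v)
    -- the associated conformal (Liouville) vector field :
    (X : (Fin (n+n) → ℝ) → (Fin (n+n) → ℝ))
    (hX : ∀ x ∈ U, ∀ v : Fin (n+n) → ℝ, ω₀ (X x) v = γ x v)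
    -- hyperbolicity: no complex eigenvalue of DX(0) has zero real part :
    (hhyp : ∀ μ ∈ (Matrix.charpoly ((LinearMap.toMatrix'
        ((fderiv ℝ X 0 : (Fin (n+n) → ℝ) →L[ℝ] (Fin (n+n) → ℝ)) :
          (Fin (n+n) → ℝ) →ₗ[ℝ] (Fin (n+n) → ℝ))).map (algebraMap ℝ ℂ))).roots,
      Complex.re μ ≠ 0) :
    ∃ V : Set (Fin (n+n) → ℝ), IsOpen V ∧ (0 : Fin (n+n) → ℝ) ∈ V ∧
    ∃ φ ψ : (Fin (n+n) → ℝ) → (Fin (n+n) → ℝ),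
      φ 0 = 0 ∧
      ContDiffOn ℝ (⊤ : ℕ∞) φ V ∧
      Set.InjOn φ V ∧ IsOpen (φ '' V) ∧
      ContDiffOn ℝ (⊤ : ℕ∞) ψ (φ '' V) ∧
      (∀ x ∈ V, ψ (φ x) = x) ∧ (∀ y ∈ φ '' V, φ (ψ y) = y) ∧
      (∀ x ∈ V, φ x ∈ U) ∧
      -- (a) φ preserves the symplectic form :
      (∀ x ∈ V, ∀ u v : Fin (n+n) → ℝ,
        ω₀ (fderiv ℝ φ x u) (fderiv ℝ φ x v) = ω₀ u v) ∧
      -- (b) the transported vector field Y is in Poincaré–Dulac normal form :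
      ∃ Y : (Fin (n+n) → ℝ) → (Fin (n+n) → ℝ),
        ContDiffOn ℝ (⊤ : ℕ∞) Y V ∧
        (∀ x ∈ V, fderiv ℝ φ x (Y x) = X (φ x)) ∧
        (∀ S N : (Fin (n+n) → ℝ) →ₗ[ℝ] (Fin (n+n) → ℝ),
          ((fderiv ℝ Y 0 : (Fin (n+n) → ℝ) →L[ℝ] (Fin (n+n) → ℝ)) :
              (Fin (n+n) → ℝ) →ₗ[ℝ] (Fin (n+n) → ℝ)) = S + N →
          Module.End.IsSemisimple S → IsNilpotent N → Commute S N →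
          ∀ x ∈ V, fderiv ℝ Y x (S x) = S (Y x)) ∧
        -- consequently φ*γ is the contraction of ω₀ with Y :
        (∀ x ∈ V, ∀ u : Fin (n+n) → ℝ,
          γ (φ x) (fderiv ℝ φ x u) = ω₀ (Y x) u) := by
  obtain ⟨Ω, J, P, hΩ⟩ := exists_sympPair_standard n
  have hω : ∀ u v, ω₀ u v = Ω u v := fun u v => by rw [hω₀, hΩ]
  simp only [hω] at hdγ hX ⊢
  obtain ⟨c, hc, hyp⟩ := exists_pos_le_abs_re_of_charpoly _ hhyp
  obtain ⟨S, N, Y, hS, hN, hSN, hY, hY0, hYS, hconj⟩ :=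
    P.exists_sympConj_of_primitive hU h0U hγ hγ0 hdγ hX hc hyp
  obtain ⟨e, h0, he0, he, hes, hex⟩ :=
    P.exists_openPartialHomeomorph_of_sympConj hconj (hU.mem_nhds h0U)
  have himg : e '' e.source = e.target := e.image_source_eq_target
  refine ⟨e.source, e.open_source, h0, e, e.symm, he0, he, e.injOn, ?_, ?_,
    fun x hx => e.left_inv hx, fun y hy => e.right_inv (himg ▸ hy), fun x hx => (hex x hx).1,
    fun x hx => (hex x hx).2.1, Y, hY.contDiffOn, fun x hx => (hex x hx).2.2, ?_, ?_⟩
  · rw [himg]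
    exact e.open_target
  · rw [himg]
    exact hes
  · intro S' N' hSN' hS' hN' hc' x _
    have h1 : N' + S' = N + S :=
      (add_comm N' S').trans (hSN'.symm.trans ((LinearMap.ext hY0).trans (add_comm S N)))
    obtain ⟨-, rfl⟩ := Module.End.isNilpotent_isSemisimple_unique hN' hS' hN hS hc'.symm
      hSN.symm h1
    exact hYS x
  · intro x hx u
    obtain ⟨h1, h2, h3⟩ := hex x hx
    rw [← hX _ h1, ← h3, h2]
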